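/- Let Φ={φ_i}_{i∈Λ} be an analytic IFS on I=[0,1] with 0<|φ_i'(x)|<1 for all i∈Λ and x∈I. Suppose the maps in Φ do not have a common fixed point and that Φ is exponentially separated. Then the Hausdorff dimension of the attractor K_Φ equals min{1, s(Φ)}, where s(Φ) is the conformal similarity dimension. -/

import Mathlib

open MeasureTheory Filter Set Metric Topology

noncomputable section

/-- The unit interval `I = [0,1]`. -/
def unitI : Set ℝ := Set.Icc 0 1

/-- For a word `u = i₁…iₙ`, `compWord φ u = φ_{i₁} ∘ … ∘ φ_{iₙ}`. -/
def compWord {Λ : Type*} (φ : Λ → ℝ → ℝ) : List Λ → ℝ → ℝ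
  | [] => id
  | i :: u => φ i ∘ compWord φ u

/-- Exponential separation of the IFS `φ`. -/
def ExpSep {Λ : Type*} (φ : Λ → ℝ → ℝ) : Prop :=
  ∃ c : ℝ, 0 < c ∧ ∀ N : ℕ, ∃ n, N ≤ n ∧ ∀ u₁ u₂ : List Λ,
    u₁.length = n → u₂.length = n → u₁ ≠ u₂ →
      ∃ x ∈ unitI, c ^ n ≤ |compWord φ u₁ x - compWord φ u₂ x|

/-- The supremum norm `‖φ_u'‖_I` of the derivative of `φ_u` over `I`. -/
def supDerivNorm {Λ : Type*} (φ : Λ → ℝ → ℝ) (u : List Λ) : ℝ :=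
  sSup ((fun x => |deriv (compWord φ u) x|) '' unitI)

section Entropy

open Classical in
/-- The class of `ω` in `S` under the kernel relation of `X`. -/
def fib {Ω β : Type*} (S : Finset Ω) (X : Ω → β) (ω : Ω) : Finset Ω :=
  S.filter (fun a => X a = X ω)

/-- Entropy in bits of `X` under the uniform distribution on `S`. -/
def ent {Ω β : Type*} (S : Finset Ω) (X : Ω → β) : ℝ :=
  (∑ ω ∈ S, Real.logb 2 (S.card / (fib S X ω).card)) / S.card

/-- Conditional entropy in bits of `X` given `Y` under the uniform distribution on `S`. -/
def cent {Ω β γ : Type*} (S : Finset Ω) (X : Ω → β) (Y : Ω → γ) : ℝ :=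
  ent S (fun ω => (X ω, Y ω)) - ent S Y

variable {Ω Ω' β β' γ γ' δ : Type*} {S : Finset Ω}

lemma mem_fib {X : Ω → β} {ω a : Ω} : a ∈ fib S X ω ↔ a ∈ S ∧ X a = X ω := by
  classical
  simp [fib]

lemma fib_subset {X : Ω → β} {ω : Ω} : fib S X ω ⊆ S := fun _ h => (mem_fib.1 h).1

lemma self_mem_fib {X : Ω → β} {ω : Ω} (h : ω ∈ S) : ω ∈ fib S X ω := mem_fib.2 ⟨h, rfl⟩

lemma fib_card_pos {X : Ω → β} {ω : Ω} (h : ω ∈ S) : (0 : ℝ) < (fib S X ω).card := by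
  exact_mod_cast Finset.card_pos.2 ⟨ω, self_mem_fib h⟩

lemma fib_congr {X : Ω → β} {a ω : Ω} (h : X a = X ω) : fib S X a = fib S X ω := by
  ext b; simp [mem_fib, h]

lemma fib_eq_filter (X : Ω → β) (ω : Ω) [DecidablePred fun a => X a = X ω] :
    fib S X ω = S.filter (fun a => X a = X ω) := by
  ext a; simp [mem_fib]

lemma ent_mono {X : Ω → β} {Y : Ω → γ} (h : ∀ a ∈ S, ∀ b ∈ S, X a = X b → Y a = Y b) :
    ent S Y ≤ ent S X := by
  unfold ent
  gcongr with ω hω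
  · norm_num
  · exact div_pos (lt_of_lt_of_le (fib_card_pos (X := X) hω)
      (by exact_mod_cast Finset.card_le_card fib_subset)) (fib_card_pos hω)
  · exact fib_card_pos hω
  · intro a ha
    rw [mem_fib] at ha ⊢
    exact ⟨ha.1, h _ ha.1 _ hω ha.2⟩

lemma ent_congr {X : Ω → β} {Y : Ω → γ} (h : ∀ a ∈ S, ∀ b ∈ S, X a = X b ↔ Y a = Y b) :
    ent S X = ent S Y :=
  le_antisymm (ent_mono fun a ha b hb => (h a ha b hb).2)
    (ent_mono fun a ha b hb => (h a ha b hb).1)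

lemma ent_nonneg (X : Ω → β) : 0 ≤ ent S X := by
  unfold ent
  refine div_nonneg (Finset.sum_nonneg fun ω hω => ?_) (Nat.cast_nonneg _)
  refine Real.logb_nonneg (by norm_num) ?_
  rw [one_le_div (fib_card_pos hω)]
  exact_mod_cast Finset.card_le_card fib_subset

lemma cent_nonneg (X : Ω → β) (Y : Ω → γ) : 0 ≤ cent S X Y :=
  sub_nonneg.2 (ent_mono fun _ _ _ _ h => (Prod.ext_iff.1 h).2)

lemma cent_eq_sum (X : Ω → β) (Y : Ω → γ) :
    cent S X Y = (∑ ω ∈ S, Real.logb 2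
      ((fib S Y ω).card / (fib S (fun ω => (X ω, Y ω)) ω).card)) / S.card := by
  unfold cent ent
  rw [← sub_div, ← Finset.sum_sub_distrib]
  congr 1
  refine Finset.sum_congr rfl fun ω hω => ?_
  have h1 := fib_card_pos (X := Y) hω
  have h2 := fib_card_pos (X := fun ω => (X ω, Y ω)) hω
  have h3 : (0 : ℝ) < S.card := by exact_mod_cast Finset.card_pos.2 ⟨ω, hω⟩
  rw [Real.logb_div h3.ne' h2.ne', Real.logb_div h3.ne' h1.ne', Real.logb_div h1.ne' h2.ne']
  ring

lemma cent_congr {X : Ω → β} {X' : Ω → β'} {Y : Ω → γ} {Y' : Ω → γ'}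
    (hX : ∀ a ∈ S, ∀ b ∈ S, X a = X b ↔ X' a = X' b)
    (hY : ∀ a ∈ S, ∀ b ∈ S, Y a = Y b ↔ Y' a = Y' b) : cent S X Y = cent S X' Y' := by
  unfold cent
  rw [ent_congr hY, ent_congr (X := fun ω => (X ω, Y ω)) (Y := fun ω => (X' ω, Y' ω))]
  intro a ha b hb
  simp [hX a ha b hb, hY a ha b hb]

lemma cent_mono_left {X : Ω → β} {X' : Ω → β'} {Y : Ω → γ}
    (h : ∀ a ∈ S, ∀ b ∈ S, X' a = X' b → Y a = Y b → X a = X b) :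
    cent S X Y ≤ cent S X' Y := by
  unfold cent
  gcongr
  refine ent_mono fun a ha b hb hab => ?_
  simp only [Prod.mk.injEq] at hab ⊢
  exact ⟨h a ha b hb hab.1 hab.2, hab.2⟩

lemma cent_chain (X : Ω → β) (Y : Ω → γ) (Z : Ω → δ) :
    cent S (fun ω => (X ω, Y ω)) Z = cent S Y Z + cent S X (fun ω => (Y ω, Z ω)) := by
  unfold cent
  rw [ent_congr (X := fun ω => ((X ω, Y ω), Z ω)) (Y := fun ω => (X ω, Y ω, Z ω))]
  · ring
  · simp [and_assoc]

/-- Averaging over classes does not change a sum. -/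
lemma sum_fib_avg (Y : Ω → γ) (f : Ω → ℝ) :
    ∑ ω ∈ S, (∑ a ∈ fib S Y ω, f a) / (fib S Y ω).card = ∑ ω ∈ S, f ω := by
  classical
  have h : ∀ ω ∈ S, (∑ a ∈ fib S Y ω, f a) / (fib S Y ω).card
      = ∑ a ∈ S, if Y a = Y ω then f a / (fib S Y a).card else 0 := by
    intro ω _
    rw [Finset.sum_div, fib, Finset.sum_filter]
    refine Finset.sum_congr rfl fun a _ => ?_
    split_ifs with hh
    · simp [fib, hh]
    · rfl
  rw [Finset.sum_congr rfl h, Finset.sum_comm]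
  refine Finset.sum_congr rfl fun a ha => ?_
  have : ∀ ω, (Y a = Y ω) = (Y ω = Y a) := fun ω => propext eq_comm
  simp_rw [this]
  rw [← Finset.sum_filter, Finset.sum_const, nsmul_eq_mul]
  change ((fib S Y a).card : ℝ) * _ = _
  have := (fib_card_pos (X := Y) ha).ne'
  field_simp

lemma fib_fib (X : Ω → β) (Y : Ω → γ) {ω a : Ω} (ha : a ∈ fib S Y ω) :
    fib (fib S Y ω) X a = fib S (fun ω => (X ω, Y ω)) a := by
  ext b
  have := (mem_fib.1 ha).2
  simp [mem_fib, this]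
  tauto

lemma cent_eq_avg (X : Ω → β) (Y : Ω → γ) :
    cent S X Y = (∑ ω ∈ S, ent (fib S Y ω) X) / S.card := by
  rw [cent_eq_sum, ← sum_fib_avg Y]
  congr 1
  refine Finset.sum_congr rfl fun ω _ => ?_
  unfold ent
  congr 1
  refine Finset.sum_congr rfl fun a ha => ?_
  rw [fib_fib X Y ha]
  rw [fib_congr (mem_fib.1 ha).2]

lemma cent_pair_eq_avg (X : Ω → β) (Y : Ω → γ) (Z : Ω → δ) :
    cent S X (fun ω => (Y ω, Z ω)) = (∑ ω ∈ S, cent (fib S Y ω) X Z) / S.card := by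
  have h : cent S X (fun ω => (Y ω, Z ω)) = cent S (fun ω => (X ω, Z ω)) Y - cent S Z Y := by
    unfold cent
    rw [ent_congr (X := fun ω => ((X ω, Z ω), Y ω)) (Y := fun ω => (X ω, Y ω, Z ω)),
      ent_congr (X := fun ω => (Z ω, Y ω)) (Y := fun ω => (Y ω, Z ω))]
    · ring
    · simp [and_comm]
    · simp; tauto
  rw [h, cent_eq_avg, cent_eq_avg, ← sub_div, ← Finset.sum_sub_distrib]
  rfl

lemma sum_inv_fib_le_one (X : Ω → β) (T : Finset Ω) (hT : T ⊆ S)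
    (h : ∀ a ∈ T, ∀ b ∈ T, X a = X b) : ∑ ω ∈ T, (1 : ℝ) / (fib S X ω).card ≤ 1 := by
  rcases T.eq_empty_or_nonempty with rfl | ⟨a, ha⟩
  · simp
  have : ∀ ω ∈ T, (1 : ℝ) / (fib S X ω).card = 1 / (fib S X a).card := by
    intro ω hω
    rw [fib_congr (h ω hω a ha)]
  rw [Finset.sum_congr rfl this, Finset.sum_const, nsmul_eq_mul, mul_one_div,
    div_le_one (fib_card_pos (hT ha))]
  exact_mod_cast Finset.card_le_card fun b hb => mem_fib.2 ⟨hT hb, h b hb a ha⟩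

lemma log_le_sub_one_two {x : ℝ} (hx : 0 < x) : Real.logb 2 x ≤ (x - 1) / Real.log 2 := by
  unfold Real.logb
  have := Real.log_pos (x := 2) (by norm_num)
  gcongr
  exact Real.log_le_sub_one_of_pos hx

lemma cent_anti_right {X : Ω → β} {Y : Ω → γ} {Y' : Ω → γ'}
    (h : ∀ a ∈ S, ∀ b ∈ S, Y' a = Y' b → Y a = Y b) : cent S X Y' ≤ cent S X Y := by
  classical
  rw [cent_eq_sum, cent_eq_sum, ← sub_nonneg, ← sub_div, ← Finset.sum_sub_distrib]
  refine div_nonneg ?_ (Nat.cast_nonneg _)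
  set XY := fun ω => (X ω, Y ω)
  set XY' := fun ω => (X ω, Y' ω)
  have hlog := Real.log_pos (x := 2) (by norm_num)
  have hpt : ∀ ω ∈ S, (1 - ((fib S XY ω).card : ℝ) * (fib S Y' ω).card /
      ((fib S Y ω).card * (fib S XY' ω).card)) / Real.log 2 ≤
      Real.logb 2 ((fib S Y ω).card / (fib S XY ω).card) -
      Real.logb 2 ((fib S Y' ω).card / (fib S XY' ω).card) := by
    intro ω hω
    have h1 := fib_card_pos (X := Y) hω
    have h2 := fib_card_pos (X := XY) hω
    have h3 := fib_card_pos (X := Y') hω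
    have h4 := fib_card_pos (X := XY') hω
    have := log_le_sub_one_two (x := ((fib S XY ω).card : ℝ) * (fib S Y' ω).card /
      ((fib S Y ω).card * (fib S XY' ω).card)) (by positivity)
    rw [Real.logb_div (by positivity) (by positivity), Real.logb_mul h2.ne' h3.ne',
      Real.logb_mul h1.ne' h4.ne'] at this
    rw [Real.logb_div h1.ne' h2.ne', Real.logb_div h3.ne' h4.ne']
    have e : ∀ x : ℝ, (1 - x) / Real.log 2 = - ((x - 1) / Real.log 2) := by intro x; ring
    rw [e]
    linarith
  refine le_trans ?_ (Finset.sum_le_sum hpt)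
  rw [← Finset.sum_div]
  refine div_nonneg ?_ hlog.le
  rw [Finset.sum_sub_distrib, sub_nonneg, Finset.sum_const, nsmul_eq_mul, mul_one]
  have key : ∀ ω ∈ S, ((fib S XY ω).card : ℝ) * (fib S Y' ω).card /
      ((fib S Y ω).card * (fib S XY' ω).card) = ∑ a ∈ S, ∑ b ∈ S,
        (1 / ((fib S Y a).card : ℝ)) *
        (if XY ω = XY a ∧ Y' ω = Y' b then 1 / ((fib S XY' ω).card : ℝ) else 0) := by
    intro ω hω
    have h1 : ((fib S Y' ω).card : ℝ) = ∑ b ∈ S, if Y' ω = Y' b then 1 else 0 := by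
      rw [fib, Finset.card_filter]; push_cast
      exact Finset.sum_congr rfl fun b _ => by simp [eq_comm]
    have h2 : ((fib S XY ω).card : ℝ) / (fib S Y ω).card =
        ∑ a ∈ S, if XY ω = XY a then 1 / ((fib S Y a).card : ℝ) else 0 := by
      have : ∀ a ∈ S, (if XY ω = XY a then 1 / ((fib S Y a).card : ℝ) else 0) =
          (if XY a = XY ω then 1 / ((fib S Y ω).card : ℝ) else 0) := by
        intro a _
        by_cases hh : XY a = XY ω
        · have : Y a = Y ω := (Prod.ext_iff.1 hh).2
          simp [hh, fib_congr this]
        · rw [if_neg hh, if_neg (fun h => hh h.symm)]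
      rw [Finset.sum_congr rfl this, ← Finset.sum_filter, Finset.sum_const, nsmul_eq_mul,
        mul_one_div, fib_eq_filter XY]
    rw [mul_div_mul_comm, h2, h1, Finset.sum_div, Finset.sum_mul_sum]
    refine Finset.sum_congr rfl fun a _ => Finset.sum_congr rfl fun b _ => ?_
    by_cases c1 : XY ω = XY a <;> by_cases c2 : Y' ω = Y' b <;> simp [c1, c2]
  rw [Finset.sum_congr rfl key, Finset.sum_comm]
  have : ∀ a ∈ S, ∑ ω ∈ S, ∑ b ∈ S, (1 / ((fib S Y a).card : ℝ)) *
      (if XY ω = XY a ∧ Y' ω = Y' b then 1 / ((fib S XY' ω).card : ℝ) else 0) ≤ 1 := by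
    intro a ha
    rw [Finset.sum_comm]
    simp_rw [← Finset.mul_sum]
    rw [one_div, inv_mul_le_iff₀ (fib_card_pos ha), mul_one]
    have hb : ∀ b ∈ S, ∑ ω ∈ S,
        (if XY ω = XY a ∧ Y' ω = Y' b then 1 / ((fib S XY' ω).card : ℝ) else 0) ≤
        if Y b = Y a then 1 else 0 := by
      intro b hb
      rw [← Finset.sum_filter]
      split_ifs with hh
      · refine sum_inv_fib_le_one _ _ (Finset.filter_subset _ _) fun c hc d hd => ?_
        simp only [XY, Finset.mem_filter, Prod.mk.injEq] at hc hd
        simp only [XY', Prod.mk.injEq]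
        exact ⟨hc.2.1.1.trans hd.2.1.1.symm, hc.2.2.trans hd.2.2.symm⟩
      · rw [Finset.sum_eq_zero]
        intro ω hω
        exfalso
        simp only [XY, Finset.mem_filter, Prod.mk.injEq] at hω
        exact hh ((h _ hω.1 _ hb hω.2.2).symm.trans hω.2.1.2)
    refine (Finset.sum_le_sum hb).trans ?_
    rw [← Finset.sum_filter, Finset.sum_const, nsmul_eq_mul, mul_one, fib_eq_filter Y]
  refine (Finset.sum_le_sum this).trans ?_
  simp

lemma ent_le_gibbs {X : Ω → β} (q : β → ℝ) (g : Finset β) (hX : ∀ ω ∈ S, X ω ∈ g)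
    (hq : ∀ x ∈ g, 0 < q x) (hsum : ∑ x ∈ g, q x ≤ 1) :
    ent S X ≤ (∑ ω ∈ S, -Real.logb 2 (q (X ω))) / S.card := by
  classical
  rw [← sub_nonneg, ent, ← sub_div, ← Finset.sum_sub_distrib]
  refine div_nonneg ?_ (Nat.cast_nonneg _)
  have hlog := Real.log_pos (x := 2) (by norm_num)
  have hpt : ∀ ω ∈ S, (1 - (S.card : ℝ) * (q (X ω) / (fib S X ω).card)) / Real.log 2 ≤
      -Real.logb 2 (q (X ω)) - Real.logb 2 (S.card / (fib S X ω).card) := by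
    intro ω hω
    have h1 := fib_card_pos (X := X) hω
    have h2 : (0 : ℝ) < S.card := by exact_mod_cast Finset.card_pos.2 ⟨ω, hω⟩
    have h3 := hq _ (hX ω hω)
    have := log_le_sub_one_two (x := (S.card : ℝ) * (q (X ω) / (fib S X ω).card)) (by positivity)
    rw [Real.logb_mul h2.ne' (by positivity), Real.logb_div h3.ne' h1.ne'] at this
    rw [Real.logb_div h2.ne' h1.ne']
    have e : ∀ x : ℝ, (1 - x) / Real.log 2 = - ((x - 1) / Real.log 2) := by intro x; ring
    rw [e]
    linarith
  refine le_trans ?_ (Finset.sum_le_sum hpt)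
  rw [← Finset.sum_div]
  refine div_nonneg ?_ hlog.le
  rw [Finset.sum_sub_distrib, sub_nonneg, Finset.sum_const, nsmul_eq_mul, mul_one,
    ← Finset.mul_sum]
  refine mul_le_of_le_one_right (Nat.cast_nonneg _) (le_trans ?_ hsum)
  rw [← Finset.sum_fiberwise_of_maps_to hX]
  refine Finset.sum_le_sum fun x hx => ?_
  have : ∀ ω ∈ S.filter (fun ω => X ω = x), q (X ω) / ((fib S X ω).card : ℝ) =
      q x * (1 / (fib S X ω).card) := by
    intro ω hω
    rw [(Finset.mem_filter.1 hω).2, mul_one_div]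
  rw [Finset.sum_congr rfl this, ← Finset.mul_sum]
  refine mul_le_of_le_one_right (hq x hx).le (sum_inv_fib_le_one _ _ (Finset.filter_subset _ _) ?_)
  intro a ha b hb
  rw [(Finset.mem_filter.1 ha).2, (Finset.mem_filter.1 hb).2]

lemma ent_le_logb {X : Ω → β} (g : Finset β) (hX : ∀ ω ∈ S, X ω ∈ g) {K : ℝ} (hK : g.card ≤ K)
    (hK1 : 1 ≤ K) : ent S X ≤ Real.logb 2 K := by
  rcases S.eq_empty_or_nonempty with rfl | hS
  · simpa [ent] using Real.logb_nonneg (by norm_num) hK1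
  refine (ent_le_gibbs (fun _ => 1 / K) g hX (fun _ _ => by positivity) ?_).trans ?_
  · rw [Finset.sum_const, nsmul_eq_mul, mul_one_div, div_le_one (by positivity)]
    exact hK
  · have : (0 : ℝ) < S.card := by exact_mod_cast hS.card_pos
    rw [Finset.sum_const, nsmul_eq_mul, mul_div_cancel_left₀ _ this.ne']
    simp

lemma avg_le {f : Ω → ℝ} {c : ℝ} (hc : 0 ≤ c) (h : ∀ ω ∈ S, f ω ≤ c) :
    (∑ ω ∈ S, f ω) / S.card ≤ c := by
  refine div_le_of_le_mul₀ (Nat.cast_nonneg _) hc ?_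
  simpa [mul_comm] using Finset.sum_le_sum h

lemma le_avg {f : Ω → ℝ} {c : ℝ} (hS : S.Nonempty) (h : ∀ ω ∈ S, c ≤ f ω) :
    c ≤ (∑ ω ∈ S, f ω) / S.card := by
  rw [le_div_iff₀ (by exact_mod_cast hS.card_pos)]
  simpa [mul_comm] using Finset.sum_le_sum h

lemma cent_le_logb {X : Ω → β} {Y : Ω → γ} {K : ℝ} (hK1 : 1 ≤ K)
    (h : ∀ ω ∈ S, ∃ g : Finset β, (g.card : ℝ) ≤ K ∧ ∀ a ∈ S, Y a = Y ω → X a ∈ g) :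
    cent S X Y ≤ Real.logb 2 K := by
  rw [cent_eq_avg]
  refine avg_le (Real.logb_nonneg (by norm_num) hK1) fun ω hω => ?_
  obtain ⟨g, hg, h'⟩ := h ω hω
  exact ent_le_logb g (fun a ha => h' a (mem_fib.1 ha).1 (mem_fib.1 ha).2) hg hK1

lemma cent_int_le {X : Ω → ℤ} {Y : Ω → γ} (d : ℕ)
    (h : ∀ a ∈ S, ∀ b ∈ S, Y a = Y b → |X a - X b| ≤ d) :
    cent S X Y ≤ Real.logb 2 (2 * d + 1) := by
  refine cent_le_logb (by linarith [(Nat.cast_nonneg d : (0 : ℝ) ≤ d)]) fun ω hω =>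
    ⟨Finset.Icc (X ω - d) (X ω + d), ?_, fun a ha hY => ?_⟩
  · rw [Int.card_Icc]
    have : (X ω + d + 1 - (X ω - d)).toNat = 2 * d + 1 := by omega
    rw [this]; push_cast; rfl
  · have := abs_le.1 (h a ha ω hω hY)
    rw [Finset.mem_Icc]
    constructor <;> linarith

lemma cent_le_add (X : Ω → β) (X' : Ω → β') (Y : Ω → γ) :
    cent S X Y ≤ cent S X' Y + cent S X (fun ω => (X' ω, Y ω)) := by
  rw [← cent_chain]
  exact cent_mono_left fun a _ b _ h _ => (Prod.ext_iff.1 h).1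

lemma cent_le_cond (X : Ω → β) (Y : Ω → γ) (Y' : Ω → γ') :
    cent S X Y ≤ cent S X Y' + cent S Y' Y := by
  have := cent_le_add (S := S) X Y' Y
  have h2 : cent S X (fun ω => (Y' ω, Y ω)) ≤ cent S X Y' :=
    cent_anti_right fun a _ b _ h => (Prod.ext_iff.1 h).1
  linarith

open Classical in
lemma ent_map {f : Ω → Ω'} {S' : Finset Ω'} {N : ℕ} (hf : ∀ ω ∈ S, f ω ∈ S') (hN : 0 < N)
    (hcard : ∀ y ∈ S', (S.filter (fun ω => f ω = y)).card = N) (X : Ω' → β) :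
    ent S (fun ω => X (f ω)) = ent S' X := by
  have hfib : ∀ T ⊆ S', ((S.filter fun ω => f ω ∈ T).card : ℝ) = N * T.card := by
    intro T hT
    rw [Finset.card_eq_sum_card_fiberwise (s := S.filter fun ω => f ω ∈ T) (f := f) (t := T)
      (fun ω hω => (Finset.mem_filter.1 hω).2)]
    push_cast
    rw [Finset.sum_congr rfl (g := fun _ => (N : ℝ)), Finset.sum_const, nsmul_eq_mul, mul_comm]
    intro y hy
    rw [Finset.filter_filter, ← hcard y (hT hy)]
    congr 2
    ext ω
    simp only [Finset.mem_filter, and_congr_right_iff, and_iff_right_iff_imp]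
    rintro _ rfl
    exact hy
  have hS : (S.card : ℝ) = N * S'.card := by
    rw [← hfib S' subset_rfl]
    congr 2
    ext ω
    simpa using hf ω
  have h1 : ∀ ω ∈ S, ((fib S (fun ω => X (f ω)) ω).card : ℝ) = N * (fib S' X (f ω)).card := by
    intro ω hω
    rw [← hfib _ fib_subset]
    congr 2
    ext a
    simp only [mem_fib, Finset.mem_filter]
    exact ⟨fun h => ⟨h.1, hf _ h.1, h.2⟩, fun h => ⟨h.1, h.2.2⟩⟩
  have hN' : (0 : ℝ) < N := by exact_mod_cast hN
  unfold ent
  rw [hS, ← Finset.sum_fiberwise_of_maps_to hf, ← div_div, Finset.sum_div]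
  congr 1
  refine Finset.sum_congr rfl fun y hy => ?_
  rw [Finset.sum_congr rfl (g := fun _ => Real.logb 2 (S'.card / (fib S' X y).card)),
    Finset.sum_const, hcard y hy, nsmul_eq_mul, mul_div_cancel_left₀ _ hN'.ne']
  intro ω hω
  obtain ⟨hωS, rfl⟩ := Finset.mem_filter.1 hω
  rw [h1 ω hωS, mul_div_mul_left _ _ hN'.ne']

lemma ent_bij {f : Ω → Ω'} {S' : Finset Ω'} (hf : Set.BijOn f S S') (X : Ω' → β) :
    ent S (fun ω => X (f ω)) = ent S' X := by
  classical
  refine ent_map (N := 1) hf.mapsTo one_pos (fun y hy => ?_) X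
  obtain ⟨a, ha, rfl⟩ := hf.surjOn hy
  rw [Finset.card_eq_one]
  refine ⟨a, ?_⟩
  ext b
  simp only [Finset.mem_filter, Finset.mem_singleton]
  exact ⟨fun h => hf.injOn h.1 ha h.2, by rintro rfl; exact ⟨ha, rfl⟩⟩

lemma cent_bij {f : Ω → Ω'} {S' : Finset Ω'} (hf : Set.BijOn f S S') (X : Ω' → β) (Y : Ω' → γ) :
    cent S (fun ω => X (f ω)) (fun ω => Y (f ω)) = cent S' X Y := by
  unfold cent
  rw [ent_bij hf Y, ent_bij hf (fun ω => (X ω, Y ω))]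

section Product
variable {Ω₁ Ω₂ : Type*} {S₁ : Finset Ω₁} {S₂ : Finset Ω₂}

lemma ent_fst (h₂ : S₂.Nonempty) (X : Ω₁ → β) :
    ent (S₁ ×ˢ S₂) (fun p => X p.1) = ent S₁ X := by
  classical
  refine ent_map (N := S₂.card) (by simp +contextual) h₂.card_pos (fun y hy => ?_) X
  have : (S₁ ×ˢ S₂).filter (fun p => p.1 = y) = {y} ×ˢ S₂ := by
    ext p; simp; grind
  rw [this]; simp

lemma ent_snd (h₁ : S₁.Nonempty) (X : Ω₂ → β) :
    ent (S₁ ×ˢ S₂) (fun p => X p.2) = ent S₂ X := by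
  classical
  refine ent_map (N := S₁.card) (by simp +contextual) h₁.card_pos (fun y hy => ?_) X
  have : (S₁ ×ˢ S₂).filter (fun p => p.2 = y) = S₁ ×ˢ {y} := by
    ext p; simp; grind
  rw [this]; simp

lemma fib_prod_fst {a : Ω₁} {b : Ω₂} (ha : a ∈ S₁) :
    fib (S₁ ×ˢ S₂) Prod.fst (a, b) = {a} ×ˢ S₂ := by
  ext p; simp [mem_fib]; grind

lemma bijOn_singleton_prod (a : Ω₁) (S₂ : Finset Ω₂) :
    Set.BijOn (fun b => (a, b)) (S₂ : Set Ω₂) (({a} ×ˢ S₂ : Finset (Ω₁ × Ω₂)) : Set (Ω₁ × Ω₂)) := by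
  refine ⟨fun b hb => by simpa using hb, fun b _ c _ h => (Prod.ext_iff.1 h).2, ?_⟩
  rintro ⟨c, d⟩ h
  simp at h
  exact ⟨d, h.1, by rw [h.2]⟩

lemma cent_prod_fst_pair (h₂ : S₂.Nonempty) (X : Ω₁ × Ω₂ → β) (Z : Ω₁ × Ω₂ → γ) :
    cent (S₁ ×ˢ S₂) X (fun p => (p.1, Z p)) =
      (∑ a ∈ S₁, cent S₂ (fun b => X (a, b)) (fun b => Z (a, b))) / S₁.card := by
  have h2 : (0 : ℝ) < S₂.card := by exact_mod_cast h₂.card_pos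
  rw [cent_pair_eq_avg, Finset.sum_product, Finset.card_product, Nat.cast_mul, mul_comm,
    ← div_div, Finset.sum_div]
  congr 1
  refine Finset.sum_congr rfl fun a ha => ?_
  rw [Finset.sum_congr rfl (g := fun _ => cent S₂ (fun b => X (a, b)) (fun b => Z (a, b))),
    Finset.sum_const, nsmul_eq_mul, mul_div_cancel_left₀ _ h2.ne']
  intro b _
  rw [fib_prod_fst ha, ← cent_bij (bijOn_singleton_prod a S₂)]

lemma ent_prod (h₁ : S₁.Nonempty) (h₂ : S₂.Nonempty) (X : Ω₁ → β) (Y : Ω₂ → γ) :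
    ent (S₁ ×ˢ S₂) (fun p => (X p.1, Y p.2)) = ent S₁ X + ent S₂ Y := by
  rw [← ent_fst h₂ X, ← ent_snd (S₁ := S₁) h₁ Y]
  unfold ent
  rw [← add_div, ← Finset.sum_add_distrib]
  congr 1
  refine Finset.sum_congr rfl fun p hp => ?_
  have hp' := Finset.mem_product.1 hp
  have e1 : fib (S₁ ×ˢ S₂) (fun p => (X p.1, Y p.2)) p = fib S₁ X p.1 ×ˢ fib S₂ Y p.2 := by
    ext q; simp [mem_fib]; tauto
  have e2 : fib (S₁ ×ˢ S₂) (fun p => X p.1) p = fib S₁ X p.1 ×ˢ S₂ := by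
    ext q; simp [mem_fib]; tauto
  have e3 : fib (S₁ ×ˢ S₂) (fun p => Y p.2) p = S₁ ×ˢ fib S₂ Y p.2 := by
    ext q; simp [mem_fib]; tauto
  have p1 := fib_card_pos (X := X) hp'.1
  have p2 := fib_card_pos (X := Y) hp'.2
  have p3 : (0 : ℝ) < S₁.card := by exact_mod_cast h₁.card_pos
  have p4 : (0 : ℝ) < S₂.card := by exact_mod_cast h₂.card_pos
  rw [e1, e2, e3]
  simp only [Finset.card_product, Nat.cast_mul]
  rw [← Real.logb_mul (by positivity) (by positivity)]
  congr 1
  field_simp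

end Product

/-- Submodularity of the entropy of sums of independent variables. -/
lemma ent_add_add_le {ΩA ΩB ΩC : Type*} {SA : Finset ΩA} {SB : Finset ΩB} {SC : Finset ΩC}
    (hA : SA.Nonempty) (hB : SB.Nonempty) (hC : SC.Nonempty)
    (A : ΩA → ℤ) (B : ΩB → ℤ) (C : ΩC → ℤ) :
    ent (SA ×ˢ SB ×ˢ SC) (fun p => A p.1 + (B p.2.1 + C p.2.2)) + ent SA A ≤
      ent (SA ×ˢ SB) (fun p => A p.1 + B p.2) + ent (SA ×ˢ SC) (fun p => A p.1 + C p.2) := by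
  set U := (SA ×ˢ SB) ×ˢ SC
  have hAB : (SA ×ˢ SB).Nonempty := hA.product hB
  have hAC : (SA ×ˢ SC).Nonempty := hA.product hC
  have e0 : ent (SA ×ˢ SB ×ˢ SC) (fun p => A p.1 + (B p.2.1 + C p.2.2)) =
      ent U (fun p => A p.1.1 + B p.1.2 + C p.2) := by
    rw [← ent_bij (S := U) (f := fun p => (p.1.1, p.1.2, p.2))]
    · simp only [add_assoc]
    · refine ⟨fun p hp => by simp [U] at hp ⊢; tauto, fun p _ q _ h => ?_, fun p hp => ?_⟩
      · simp at h; ext <;> simp [h]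
      · exact ⟨((p.1, p.2.1), p.2.2), by simp [U] at hp ⊢; tauto, rfl⟩
  have e1 := ent_prod hAB hC (fun p => A p.1 + B p.2) C
  have e2 := ent_prod hA hC A C
  have c1 : ent U (fun p => (C p.2, A p.1.1 + B p.1.2 + C p.2)) =
      ent U (fun p => (A p.1.1 + B p.1.2, C p.2)) :=
    ent_congr fun a _ b _ => by simp only [Prod.mk.injEq]; constructor <;> intro h <;> constructor <;> omega
  have c2 : ent (SA ×ˢ SC) (fun p => (C p.2, A p.1 + C p.2)) =
      ent (SA ×ˢ SC) (fun p => (A p.1, C p.2)) :=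
    ent_congr fun a _ b _ => by simp only [Prod.mk.injEq]; constructor <;> intro h <;> constructor <;> omega
  have key : cent (SA ×ˢ SC) (fun p => C p.2) (fun p => A p.1 + C p.2) ≤
      cent U (fun p => C p.2) (fun p => A p.1.1 + B p.1.2 + C p.2) := by
    have h1 : cent U (fun p => C p.2) (fun p => (A p.1.1 + C p.2, B p.1.2)) ≤
        cent U (fun p => C p.2) (fun p => A p.1.1 + B p.1.2 + C p.2) :=
      cent_anti_right fun a _ b _ h => by simp only [Prod.mk.injEq] at h; omega
    refine le_trans (le_of_eq ?_) h1
    have hbij : Set.BijOn (fun p : (ΩA × ΩB) × ΩC => ((p.1.1, p.2), p.1.2)) (U : Set _)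
        (((SA ×ˢ SC) ×ˢ SB : Finset _) : Set _) := by
      refine ⟨fun p hp => by simp [U] at hp ⊢; tauto, fun p _ q _ h => ?_, fun p hp => ?_⟩
      · simp at h; ext <;> simp [h]
      · exact ⟨((p.1.1, p.2), p.1.2), by simp [U] at hp ⊢; tauto, rfl⟩
    rw [cent_bij hbij (fun p => C p.1.2) (fun p => (A p.1.1 + C p.1.2, B p.2))]
    unfold cent
    have f1 := ent_prod hAC hB (fun p => A p.1 + C p.2) B
    have f2 := ent_prod hAC hB (fun p => (C p.2, A p.1 + C p.2)) B
    rw [f1, ent_congr (S := (SA ×ˢ SC) ×ˢ SB)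
      (X := fun p => (C p.1.2, A p.1.1 + C p.1.2, B p.2))
      (Y := fun p => ((C p.1.2, A p.1.1 + C p.1.2), B p.2)) (by simp [and_assoc]), f2]
    ring
  unfold cent at key
  rw [c1, c2, e2] at key
  have : ent U (fun p => (A p.1.1 + B p.1.2, C p.2)) = _ := e1
  rw [e0]
  linarith

lemma bijOn_cons_piFinset {k : ℕ} (T : Finset Ω) :
    Set.BijOn (fun p : Ω × (Fin k → Ω) => (Fin.cons p.1 p.2 : Fin (k + 1) → Ω))
      ((T ×ˢ Fintype.piFinset fun _ : Fin k => T : Finset _) : Set _)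
      ((Fintype.piFinset fun _ : Fin (k + 1) => T : Finset _) : Set _) := by
  refine ⟨fun p hp => ?_, fun p _ q _ h => ?_, fun p hp => ?_⟩
  · simp at hp ⊢
    intro i
    refine Fin.cases hp.1 (fun j => hp.2 j) i
  · have := Fin.cons_inj.1 h
    exact Prod.ext this.1 this.2
  · simp at hp
    exact ⟨(p 0, fun j => p j.succ), by simp [hp], Fin.cons_self_tail p⟩

/-- Entropy growth under adding `k` independent copies is at most `k` times the growth under
adding one copy. -/
lemma ent_add_sum_le {ΩA ΩB : Type*} {SA : Finset ΩA} {SB : Finset ΩB}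
    (hA : SA.Nonempty) (hB : SB.Nonempty) (A : ΩA → ℤ) (B : ΩB → ℤ) (k : ℕ) :
    ent (SA ×ˢ Fintype.piFinset fun _ : Fin k => SB) (fun p => A p.1 + ∑ j, B (p.2 j)) ≤
      ent SA A + k * (ent (SA ×ˢ SB) (fun p => A p.1 + B p.2) - ent SA A) := by
  induction k with
  | zero =>
    have := ent_fst (S₁ := SA) (S₂ := Fintype.piFinset fun _ : Fin 0 => SB) (by simp) A
    simp [← this]
  | succ k ih =>
    have hP : (Fintype.piFinset fun _ : Fin k => SB).Nonempty :=
      Fintype.piFinset_nonempty.2 fun _ => hB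
    have h := ent_add_add_le hA hB hP A B (fun b => ∑ j, B (b j))
    have e : ent (SA ×ˢ Fintype.piFinset fun _ : Fin (k + 1) => SB)
        (fun p => A p.1 + ∑ j, B (p.2 j)) =
        ent (SA ×ˢ SB ×ˢ Fintype.piFinset fun _ : Fin k => SB)
          (fun p => A p.1 + (B p.2.1 + ∑ j, B (p.2.2 j))) := by
      have hb := bijOn_cons_piFinset (k := k) SB
      rw [← ent_bij (f := fun p : ΩA × ΩB × (Fin k → ΩB) =>
        (p.1, (Fin.cons p.2.1 p.2.2 : Fin (k + 1) → ΩB)))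
        (S := SA ×ˢ SB ×ˢ Fintype.piFinset fun _ : Fin k => SB)]
      · simp [Fin.sum_univ_succ]
      · simp only [Finset.coe_product] at hb ⊢
        exact (Set.bijOn_id _).prodMap hb
    rw [e]
    push_cast
    linarith

end Entropy

section LittlewoodOfford

lemma centralBinom_mul_sqrt_le (n : ℕ) :
    (n.centralBinom : ℝ) * √(2 * n + 1) ≤ 4 ^ n := by
  induction n with
  | zero => simp
  | succ n ih =>
    have h : ((n : ℝ) + 1) * (n + 1).centralBinom = 2 * (2 * n + 1) * n.centralBinom := by
      exact_mod_cast Nat.succ_mul_centralBinom_succ n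
    have h1 : (0 : ℝ) < n + 1 := by positivity
    have hs : (2 * (n : ℝ) + 1) * √(2 * (n + 1 : ℕ) + 1) ≤ 2 * (n + 1) * √(2 * n + 1) := by
      refine (sq_le_sq₀ (by positivity) (by positivity)).1 ?_
      rw [mul_pow, mul_pow, Real.sq_sqrt (by positivity), Real.sq_sqrt (by positivity)]
      push_cast
      nlinarith [(Nat.cast_nonneg n : (0 : ℝ) ≤ n)]
    refine le_of_mul_le_mul_left ?_ h1
    calc ((n : ℝ) + 1) * ((n + 1).centralBinom * √(2 * (n + 1 : ℕ) + 1))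
        = 2 * n.centralBinom * ((2 * n + 1) * √(2 * (n + 1 : ℕ) + 1)) := by
          rw [← mul_assoc, h]; ring
      _ ≤ 2 * n.centralBinom * (2 * (n + 1) * √(2 * n + 1)) := by gcongr
      _ = 4 * (n + 1) * (n.centralBinom * √(2 * n + 1)) := by ring
      _ ≤ 4 * (n + 1) * 4 ^ n := by gcongr
      _ = (n + 1) * 4 ^ (n + 1) := by ring

lemma choose_half_le (n : ℕ) : (n.choose (n / 2) : ℝ) ≤ 2 ^ n / √(n + 1) := by
  rw [le_div_iff₀ (by positivity)]
  obtain ⟨j, rfl | rfl⟩ := n.even_or_odd'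
  · have := centralBinom_mul_sqrt_le j
    rw [Nat.centralBinom_eq_two_mul_choose] at this
    rw [Nat.mul_div_cancel_left _ two_pos, pow_mul]
    norm_num at this ⊢
    exact this
  · have := centralBinom_mul_sqrt_le (j + 1)
    have h2 : (j + 1).centralBinom = 2 * (2 * j + 1).choose j := by
      rw [Nat.centralBinom_eq_two_mul_choose, show 2 * (j + 1) = 2 * j + 1 + 1 by ring,
        Nat.choose_succ_succ, Nat.choose_symm_half]
      ring
    rw [h2, pow_succ] at this
    have e : (2 * j + 1) / 2 = j := by omega
    rw [e, pow_succ, pow_mul]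
    push_cast at this ⊢
    have h3 : √(2 * (j : ℝ) + 1 + 1) ≤ √(2 * (j + 1) + 1) := Real.sqrt_le_sqrt (by linarith)
    have h4 : ((2 * j + 1).choose j : ℝ) * √(2 * (j : ℝ) + 1 + 1) ≤
      ((2 * j + 1).choose j : ℝ) * √(2 * (j + 1) + 1) := by gcongr
    norm_num
    linarith

open Finset in
lemma littlewood_offord {ι : Type*} [Fintype ι] [DecidableEq ι] (D : ι → ℤ) (θ : ℤ)
    (J : Finset ι) (hJ : ∀ j ∈ J, θ ≤ |D j|) :
    ((univ.filter fun T : Finset ι => |∑ j, if j ∈ T then D j else -D j| < θ).card : ℝ) ≤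
      2 ^ Fintype.card ι / √(J.card + 1) := by
  set 𝒜 := univ.filter fun T : Finset ι => |∑ j, if j ∈ T then D j else -D j| < θ with h𝒜
  have hmap : ∀ T ∈ 𝒜, T ∩ Jᶜ ∈ (Jᶜ).powerset := fun T _ => by simp
  rw [Finset.card_eq_sum_card_fiberwise hmap]
  have hfib : ∀ R ∈ (Jᶜ).powerset,
      ((𝒜.filter fun T => T ∩ Jᶜ = R).card : ℝ) ≤ 2 ^ J.card / √(J.card + 1) := by
    intro R _
    set 𝒯 := 𝒜.filter fun T => T ∩ Jᶜ = R
    set f : Finset ι → Finset J := fun T => univ.filter fun j => (j : ι) ∈ T ↔ 0 ≤ D j with hf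
    have hout : ∀ T₁ ∈ 𝒯, ∀ T₂ ∈ 𝒯, ∀ j ∉ J, j ∈ T₁ ↔ j ∈ T₂ := by
      intro T₁ h₁ T₂ h₂ j hj
      have := (Finset.mem_filter.1 h₁).2.trans (Finset.mem_filter.1 h₂).2.symm
      have := congrArg (j ∈ ·) this
      simpa [hj] using this
    have hinj : Set.InjOn f 𝒯 := by
      intro T₁ h₁ T₂ h₂ h
      ext j
      by_cases hj : j ∈ J
      · have : (⟨j, hj⟩ : J) ∈ f T₁ ↔ (⟨j, hj⟩ : J) ∈ f T₂ := by rw [h]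
        simp only [hf, mem_filter, Finset.mem_univ, true_and] at this
        tauto
      · exact hout T₁ h₁ T₂ h₂ j hj
    have hanti : IsAntichain (· ⊆ ·) ((𝒯.image f : Finset (Finset J)) : Set (Finset J)) := by
      intro a ha b hb hne hsub
      obtain ⟨T₁, h₁, rfl⟩ := Finset.mem_image.1 (Finset.mem_coe.1 ha)
      obtain ⟨T₂, h₂, rfl⟩ := Finset.mem_image.1 (Finset.mem_coe.1 hb)
      obtain ⟨j₀, hj₂, hj₁⟩ : ∃ j, j ∈ f T₂ ∧ j ∉ f T₁ := by
        by_contra! hcon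
        exact hne (Finset.Subset.antisymm hsub hcon)
      have b₁ := (Finset.mem_filter.1 (Finset.mem_filter.1 h₁).1).2
      have b₂ := (Finset.mem_filter.1 (Finset.mem_filter.1 h₂).1).2
      have hterm : ∀ j, 0 ≤ (if j ∈ T₂ then D j else -D j) - (if j ∈ T₁ then D j else -D j) := by
        intro j
        by_cases hj : j ∈ J
        · have := @hsub ⟨j, hj⟩
          simp only [hf, mem_filter, Finset.mem_univ, true_and] at this
          by_cases c₁ : j ∈ T₁ <;> by_cases c₂ : j ∈ T₂ <;> simp [c₁, c₂] at this ⊢ <;> omega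
        · simp [hout T₁ h₁ T₂ h₂ j hj]
      have hj0 : 2 * θ ≤ (if (j₀ : ι) ∈ T₂ then D j₀ else -D j₀) -
          (if (j₀ : ι) ∈ T₁ then D j₀ else -D j₀) := by
        have h3 := hJ j₀ j₀.2
        simp only [hf, mem_filter, Finset.mem_univ, true_and] at hj₁ hj₂
        rcases abs_cases (D j₀) with ⟨e, _⟩ | ⟨e, _⟩ <;> rw [e] at h3 <;>
        by_cases c₁ : (j₀ : ι) ∈ T₁ <;> by_cases c₂ : (j₀ : ι) ∈ T₂ <;>
          simp only [c₁, c₂, if_true, if_false, true_iff, false_iff, not_not] at hj₁ hj₂ ⊢ <;>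
          omega
      have hsum := Finset.single_le_sum (f := fun j =>
        (if j ∈ T₂ then D j else -D j) - (if j ∈ T₁ then D j else -D j))
        (fun j _ => hterm j) (Finset.mem_univ (j₀ : ι))
      simp only [Finset.sum_sub_distrib] at hsum
      have := abs_lt.1 b₁
      have := abs_lt.1 b₂
      linarith
    have hs := hanti.sperner
    rw [Finset.card_image_of_injOn hinj, Fintype.card_coe] at hs
    exact (Nat.cast_le.2 hs).trans (choose_half_le _)
  push_cast
  refine (Finset.sum_le_sum hfib).trans ?_
  rw [Finset.sum_const, Finset.card_powerset, nsmul_eq_mul, Finset.card_compl]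
  push_cast
  rw [← mul_div_assoc, ← pow_add, Nat.sub_add_cancel (Finset.card_le_univ J)]

end LittlewoodOfford

section Collision

open Classical in
lemma sum_weight_div_le {α : Type*} (Q : Finset α) (w : α → ℝ) (act : α → Prop)
    (hw : ∀ p ∈ Q, 0 ≤ w p) (k : ℕ) (hpos : 0 < ∑ p ∈ Q with act p, w p) :
    ∑ π ∈ Fintype.piFinset (fun _ : Fin k => Q), (∏ j, w (π j)) /
      ((Finset.univ.filter fun j => act (π j)).card + 1) ≤
      (∑ p ∈ Q, w p) ^ (k + 1) / ((k + 1) * ∑ p ∈ Q with act p, w p) := by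
  set W := ∑ p ∈ Q, w p
  set a := ∑ p ∈ Q with act p, w p
  have hsplit : W = a + ∑ p ∈ Q with ¬ act p, w p :=
    (Finset.sum_filter_add_sum_filter_not Q act w).symm
  have hrest : 0 ≤ W - a := by
    rw [hsplit, add_sub_cancel_left]
    exact Finset.sum_nonneg fun p hp => hw p (Finset.mem_filter.1 hp).1
  have hint : ∀ x : ℝ, ∑ π ∈ Fintype.piFinset (fun _ : Fin k => Q), (∏ j, w (π j)) *
      x ^ (Finset.univ.filter fun j => act (π j)).card = (a * x + (W - a)) ^ k := by
    intro x
    have : a * x + (W - a) = ∑ p ∈ Q, w p * (if act p then x else 1) := by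
      rw [hsplit, add_sub_cancel_left, Finset.sum_filter]
      change (∑ p ∈ Q with act p, w p) * x + _ = _
      rw [Finset.sum_filter, Finset.sum_mul, ← Finset.sum_add_distrib]
      refine Finset.sum_congr rfl fun p _ => ?_
      split_ifs <;> simp
    rw [this]
    have h2 := Finset.prod_univ_sum (fun _ : Fin k => Q)
      (fun _ p => w p * (if act p then x else 1))
    rw [Finset.prod_const, Finset.card_univ, Fintype.card_fin] at h2
    rw [h2]
    refine Finset.sum_congr rfl fun π _ => ?_
    rw [Finset.prod_mul_distrib, Finset.prod_ite]
    simp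
  have h1 : ∑ π ∈ Fintype.piFinset (fun _ : Fin k => Q), (∏ j, w (π j)) /
      ((Finset.univ.filter fun j => act (π j)).card + 1) =
      ∫ x in (0 : ℝ)..1, (a * x + (W - a)) ^ k := by
    simp_rw [← hint]
    rw [intervalIntegral.integral_finsetSum]
    · refine Finset.sum_congr rfl fun π _ => ?_
      rw [intervalIntegral.integral_const_mul, integral_pow]
      simp [div_eq_mul_inv]
    · intro π _
      exact (Continuous.intervalIntegrable (by fun_prop) _ _)
  rw [h1, intervalIntegral.integral_comp_mul_add (fun x => x ^ k) hpos.ne', integral_pow]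
  rw [smul_eq_mul]
  have : a * 1 + (W - a) = W := by ring
  rw [this, mul_zero, zero_add, inv_mul_eq_div, div_div]
  gcongr
  linarith [pow_nonneg hrest (k + 1)]

lemma fib_piFinset {Ω γ : Type*} {S : Finset Ω} (Y : Ω → γ) {k : ℕ} (b : Fin k → Ω) :
    fib (Fintype.piFinset fun _ : Fin k => S) (fun b j => Y (b j)) b =
      Fintype.piFinset fun j => fib S Y (b j) := by
  ext b'
  simp only [mem_fib, Fintype.mem_piFinset, funext_iff]
  exact ⟨fun h j => ⟨h.1 j, h.2 j⟩, fun h => ⟨fun j => (h j).1, fun j => (h j).2⟩⟩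

open Classical in
/-- The total weight of colliding pairs is at most its average over random swaps. -/
lemma sum_swap_le {α : Type*} (Q : Finset (α × α)) (hQ : ∀ p ∈ Q, p.swap ∈ Q)
    (w : α × α → ℝ) (hw : ∀ p ∈ Q, 0 ≤ w p) (hsymm : ∀ p ∈ Q, w p.swap = w p)
    (B : α → ℤ) (θ : ℤ) (act : α × α → Prop)
    (hact : ∀ p ∈ Q, w p ≠ 0 → act p → θ ≤ |B p.2 - B p.1|) (k : ℕ) :
    ∑ π ∈ Fintype.piFinset (fun _ : Fin k => Q), (∏ j, w (π j)) *
      (if |∑ j, (B (π j).2 - B (π j).1)| < θ then 1 else 0) ≤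
    ∑ π ∈ Fintype.piFinset (fun _ : Fin k => Q), (∏ j, w (π j)) *
      (1 / √((Finset.univ.filter fun j => act (π j)).card + 1)) := by
  set R := Fintype.piFinset (fun _ : Fin k => Q)
  have hmem : ∀ T : Finset (Fin k), ∀ π ∈ R, (fun j => if j ∈ T then π j else (π j).swap) ∈ R := by
    intro T π hπ
    rw [Fintype.mem_piFinset] at hπ ⊢
    intro j
    split_ifs
    · exact hπ j
    · exact hQ _ (hπ j)
  have hinv : ∀ (T : Finset (Fin k)) (π : Fin k → α × α), (fun j => if j ∈ T then
      (fun j => if j ∈ T then π j else (π j).swap) j else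
      ((fun j => if j ∈ T then π j else (π j).swap) j).swap) = π := by
    intro T π
    ext1 j
    by_cases h : j ∈ T <;> simp [h]
  have hT : ∀ T : Finset (Fin k), ∑ π ∈ R, (∏ j, w (π j)) *
      (if |∑ j, (B (π j).2 - B (π j).1)| < θ then (1 : ℝ) else 0) =
      ∑ π ∈ R, (∏ j, w (π j)) * (if |∑ j, if j ∈ T then B (π j).2 - B (π j).1 else
        -(B (π j).2 - B (π j).1)| < θ then 1 else 0) := by
    intro T
    refine Finset.sum_nbij' (fun π j => if j ∈ T then π j else (π j).swap)
      (fun π j => if j ∈ T then π j else (π j).swap) (hmem T) (hmem T)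
      (fun π _ => hinv T π) (fun π _ => hinv T π) fun π hπ => ?_
    rw [Fintype.mem_piFinset] at hπ
    congr 1
    · refine Finset.prod_congr rfl fun j _ => ?_
      by_cases h : j ∈ T
      · simp [h]
      · simp [h, hsymm _ (hπ j)]
    · have : ∀ j, (B (π j).2 - B (π j).1) = if j ∈ T then
          B (if j ∈ T then π j else (π j).swap).2 - B (if j ∈ T then π j else (π j).swap).1 else
          -(B (if j ∈ T then π j else (π j).swap).2 -
            B (if j ∈ T then π j else (π j).swap).1) := by
        intro j
        by_cases h : j ∈ T <;> simp [h]
      simp only [← this]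
  have h2 : (2 : ℝ) ^ k * ∑ π ∈ R, (∏ j, w (π j)) *
      (if |∑ j, (B (π j).2 - B (π j).1)| < θ then (1 : ℝ) else 0) =
      ∑ π ∈ R, (∏ j, w (π j)) * ((Finset.univ.filter fun T : Finset (Fin k) =>
        |∑ j, if j ∈ T then B (π j).2 - B (π j).1 else -(B (π j).2 - B (π j).1)| < θ).card : ℝ) := by
    have : (2 : ℝ) ^ k = ((Finset.univ : Finset (Finset (Fin k))).card : ℝ) := by simp
    rw [this, ← nsmul_eq_mul, ← Finset.sum_const, Finset.sum_congr rfl (fun T _ => hT T),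
      Finset.sum_comm]
    refine Finset.sum_congr rfl fun π _ => ?_
    rw [← Finset.mul_sum, Finset.card_filter]
    push_cast
    rfl
  refine le_of_mul_le_mul_left ?_ (show (0 : ℝ) < 2 ^ k by positivity)
  rw [h2, Finset.mul_sum]
  refine Finset.sum_le_sum fun π hπ => ?_
  rw [Fintype.mem_piFinset] at hπ
  have hprod : 0 ≤ ∏ j, w (π j) := Finset.prod_nonneg fun j _ => hw _ (hπ j)
  by_cases h0 : ∏ j, w (π j) = 0
  · simp [h0]
  · have hne : ∀ j, w (π j) ≠ 0 := fun j => (Finset.prod_ne_zero_iff.1 h0) j (Finset.mem_univ j)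
    have := littlewood_offord (fun j => B (π j).2 - B (π j).1) θ
      (Finset.univ.filter fun j => act (π j))
      fun j hj => hact _ (hπ j) (hne j) (Finset.mem_filter.1 hj).2
    rw [Fintype.card_fin] at this
    calc _ ≤ (∏ j, w (π j)) * (2 ^ k / √((Finset.univ.filter fun j => act (π j)).card + 1)) := by
          gcongr
      _ = _ := by ring

lemma one_div_sqrt_le {x q : ℝ} (hx : 0 < x) (hq : 0 < q) :
    1 / √x ≤ (q * (1 / x) + 1 / q) / 2 := by
  have hs := Real.sqrt_pos.2 hx
  have e : 1 / x = (1 / √x) ^ 2 := by rw [div_pow, Real.sq_sqrt hx.le]; simp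
  rw [e]
  have : 0 ≤ q * (1 / √x - 1 / q) ^ 2 := by positivity
  have e2 : q * (1 / √x - 1 / q) ^ 2 = q * (1 / √x) ^ 2 - 2 * (1 / √x) + 1 / q := by
    field_simp
    ring
  linarith

end Collision

section CollisionEntropy

variable {Ω β γ δ : Type*} {S : Finset Ω}

lemma neg_logb_le_cent (hS : S.Nonempty) (X : Ω → β) (Y : Ω → γ) {p : ℝ} (hp : 0 < p)
    (h : ∑ ω ∈ S, ((fib S (fun ω => (X ω, Y ω)) ω).card : ℝ) / (fib S Y ω).card ≤ S.card * p) :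
    -Real.logb 2 p ≤ cent S X Y := by
  have hS' : (0 : ℝ) < S.card := by exact_mod_cast hS.card_pos
  have hlog := Real.log_pos (x := 2) (by norm_num)
  rw [cent_eq_sum, le_div_iff₀ hS']
  have hpt : ∀ ω ∈ S, -Real.logb 2 p - ((((fib S (fun ω => (X ω, Y ω)) ω).card : ℝ) /
      (fib S Y ω).card) / p - 1) / Real.log 2 ≤
      Real.logb 2 ((fib S Y ω).card / (fib S (fun ω => (X ω, Y ω)) ω).card) := by
    intro ω hω
    have h1 := fib_card_pos (X := Y) hω
    have h2 := fib_card_pos (X := fun ω => (X ω, Y ω)) hω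
    have := log_le_sub_one_two (x := (((fib S (fun ω => (X ω, Y ω)) ω).card : ℝ) /
      (fib S Y ω).card) / p) (by positivity)
    rw [Real.logb_div (by positivity) hp.ne', Real.logb_div h2.ne' h1.ne'] at this
    rw [Real.logb_div h1.ne' h2.ne']
    linarith
  refine le_trans ?_ (Finset.sum_le_sum hpt)
  rw [Finset.sum_sub_distrib, Finset.sum_const, nsmul_eq_mul, ← Finset.sum_div,
    Finset.sum_sub_distrib, ← Finset.sum_div, Finset.sum_const, nsmul_eq_mul, mul_one]
  have : ((∑ ω ∈ S, ((fib S (fun ω => (X ω, Y ω)) ω).card : ℝ) / (fib S Y ω).card) / p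
      - S.card) / Real.log 2 ≤ 0 := by
    refine div_nonpos_of_nonpos_of_nonneg ?_ hlog.le
    rw [sub_nonpos, div_le_iff₀ hp]
    exact h
  linarith

lemma sum_piFinset_product {k : ℕ} (g : (Fin k → Ω) → (Fin k → Ω) → ℝ) :
    ∑ b ∈ Fintype.piFinset (fun _ : Fin k => S), ∑ b' ∈ Fintype.piFinset (fun _ : Fin k => S),
      g b b' = ∑ π ∈ Fintype.piFinset (fun _ : Fin k => S ×ˢ S),
        g (fun j => (π j).1) (fun j => (π j).2) := by
  rw [← Finset.sum_product']
  refine Finset.sum_nbij' (fun p j => (p.1 j, p.2 j)) (fun π => (fun j => (π j).1, fun j => (π j).2))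
    ?_ ?_ (fun _ _ => rfl) (fun _ _ => rfl) (fun _ _ => rfl)
  · intro p hp
    simp only [Finset.mem_product, Fintype.mem_piFinset] at hp ⊢
    exact fun j => ⟨hp.1 j, hp.2 j⟩
  · intro p hp
    simp only [Finset.mem_product, Fintype.mem_piFinset] at hp ⊢
    exact ⟨fun j => (hp j).1, fun j => (hp j).2⟩

open Classical in
/-- Entropy of a sum of `k` independent copies of `B`, conditioned on the classes of the summands,
in terms of the probability `a` that two summands in the same class are `θ`-separated. -/
lemma le_cent_sum (hS : S.Nonempty) (B : Ω → ℤ) (X : Ω → β) (Y : Ω → γ) (θ : ℤ)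
    (hsep : ∀ b ∈ S, ∀ b' ∈ S, Y b = Y b' → X b ≠ X b' → θ ≤ |B b' - B b|) (k : ℕ)
    (Z : (Fin k → Ω) → δ) (hZ : ∀ b b', Z b = Z b' → |∑ j, (B (b' j) - B (b j))| < θ)
    {a : ℝ} (ha : 0 < a) (haS : a * S.card ≤
      ∑ ω ∈ S, (1 - ((fib S (fun ω => (X ω, Y ω)) ω).card : ℝ) / (fib S Y ω).card)) :
    Real.logb 2 (√((k + 1) * a)) ≤
      cent (Fintype.piFinset fun _ : Fin k => S) Z (fun b j => Y (b j)) := by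
  have hS' : (0 : ℝ) < S.card := by exact_mod_cast hS.card_pos
  set P := Fintype.piFinset fun _ : Fin k => S
  set w : Ω × Ω → ℝ := fun p => if Y p.2 = Y p.1 then 1 / (fib S Y p.1).card else 0 with hw
  obtain ⟨act, hact⟩ : ∃ act : Ω × Ω → Prop, act = fun p => X p.2 ≠ X p.1 := ⟨_, rfl⟩
  have hw0 : ∀ p, 0 ≤ w p := fun p => by simp only [hw]; split_ifs <;> positivity
  have hW : ∑ p ∈ S ×ˢ S, w p = S.card := by
    rw [Finset.sum_product, Finset.sum_congr rfl (g := fun _ => (1 : ℝ)), Finset.sum_const,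
      nsmul_eq_mul, mul_one]
    intro b hb
    rw [← Finset.sum_filter]
    change ∑ _ ∈ S with Y _ = Y b, 1 / ((fib S Y b).card : ℝ) = 1
    rw [Finset.sum_const, nsmul_eq_mul, ← fib_eq_filter Y,
      mul_one_div, div_self (fib_card_pos hb).ne']
  have hWact : ∑ p ∈ S ×ˢ S with act p, w p =
      ∑ ω ∈ S, (1 - ((fib S (fun ω => (X ω, Y ω)) ω).card : ℝ) / (fib S Y ω).card) := by
    have h1 : ∑ p ∈ S ×ˢ S with ¬ act p, w p =
        ∑ ω ∈ S, ((fib S (fun ω => (X ω, Y ω)) ω).card : ℝ) / (fib S Y ω).card := by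
      rw [Finset.sum_filter, Finset.sum_product]
      refine Finset.sum_congr rfl fun b hb => ?_
      rw [fib_eq_filter (fun ω => (X ω, Y ω)), ← mul_one_div, ← nsmul_eq_mul, ← Finset.sum_const,
        Finset.sum_filter]
      refine Finset.sum_congr rfl fun b' _ => ?_
      by_cases c1 : X b' = X b <;> by_cases c2 : Y b' = Y b <;> simp [hact, hw, c1, c2]
    have h2 := Finset.sum_filter_add_sum_filter_not (S ×ˢ S) act w
    rw [hW, h1] at h2
    rw [Finset.sum_sub_distrib, Finset.sum_const, nsmul_eq_mul, mul_one]
    linarith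
  have hq : 0 < ((k : ℝ) + 1) * a := by positivity
  set q := √(((k : ℝ) + 1) * a) with hqdef
  have hqpos : 0 < q := Real.sqrt_pos.2 hq
  have hlog : Real.logb 2 q = -Real.logb 2 (1 / q) := by rw [one_div, Real.logb_inv, neg_neg]
  rw [hlog]
  refine neg_logb_le_cent (Fintype.piFinset_nonempty.2 fun _ => hS) _ _ (by positivity) ?_
  have hstep1 : ∀ b ∈ P, ((fib P (fun b => (Z b, fun j => Y (b j))) b).card : ℝ) /
      (fib P (fun b j => Y (b j)) b).card ≤ ∑ b' ∈ P, (∏ j, w (b j, b' j)) *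
        (if |∑ j, (B (b' j) - B (b j))| < θ then 1 else 0) := by
    intro b hb
    have hprod : ∀ b' ∈ P, ∏ j, w (b j, b' j) = if (fun j => Y (b' j)) = (fun j => Y (b j)) then
        1 / ((fib P (fun b j => Y (b j)) b).card : ℝ) else 0 := by
      intro b' _
      simp only [hw]
      rw [Finset.prod_ite_zero, fib_piFinset, Fintype.card_piFinset]
      simp [funext_iff]
    rw [fib_eq_filter (fun b => (Z b, fun j => Y (b j))), ← mul_one_div, ← nsmul_eq_mul,
      ← Finset.sum_const, Finset.sum_filter]
    refine Finset.sum_le_sum fun b' hb' => ?_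
    rw [hprod b' hb']
    by_cases c1 : Z b' = Z b <;> by_cases c2 : (fun j => Y (b' j)) = (fun j => Y (b j))
    · rw [if_pos (by rw [c1, c2]), if_pos c2, if_pos (hZ b b' c1.symm), mul_one]
    · simp [c2]
    · simp only [c1, c2, Prod.mk.injEq, false_and, if_false, if_true]
      split_ifs <;> simp
    · simp [c2]
  refine (Finset.sum_le_sum hstep1).trans ?_
  rw [sum_piFinset_product (fun b b' => (∏ j, w (b j, b' j)) *
    (if |∑ j, (B (b' j) - B (b j))| < θ then 1 else 0))]
  refine (sum_swap_le (S ×ˢ S) (fun p hp => ?_) w (fun p _ => hw0 p) (fun p _ => ?_) B θ act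
    (fun p hp hne hpa => ?_) k).trans ?_
  · simp only [Finset.mem_product] at hp ⊢
    exact ⟨hp.2, hp.1⟩
  · by_cases c : Y p.2 = Y p.1
    · simp [hw, c, fib_congr c]
    · have c' : ¬ Y p.1 = Y p.2 := fun h => c h.symm
      simp [hw, c, c']
  · rw [Finset.mem_product] at hp
    have : Y p.2 = Y p.1 := by
      by_contra hcon
      exact hne (by simp [hw, hcon])
    exact hsep _ hp.1 _ hp.2 this.symm (fun h => (by simpa [hact] using hpa : _ ≠ _) h.symm)
  · have hpos : 0 < ∑ p ∈ S ×ˢ S with act p, w p := by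
      rw [hWact]; exact lt_of_lt_of_le (by positivity) haS
    have h5 := sum_weight_div_le (S ×ˢ S) w act (fun p _ => hw0 p) k hpos
    have hPc : ((P.card : ℕ) : ℝ) = (S.card : ℝ) ^ k := by simp [P]
    have hall : ∑ π ∈ Fintype.piFinset (fun _ : Fin k => S ×ˢ S), ∏ j, w (π j) =
        (S.card : ℝ) ^ k := by
      rw [← hW]
      have := Finset.prod_univ_sum (fun _ : Fin k => S ×ˢ S) (fun _ p => w p)
      rw [← this]; simp
    have h6 : (∑ p ∈ S ×ˢ S, w p) ^ (k + 1) / ((k + 1) * ∑ p ∈ S ×ˢ S with act p, w p) ≤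
        (S.card : ℝ) ^ k / ((k + 1) * a) := by
      rw [hW, hWact]
      calc (S.card : ℝ) ^ (k + 1) / ((k + 1) * ∑ ω ∈ S, (1 - ((fib S (fun ω => (X ω, Y ω)) ω).card
            : ℝ) / (fib S Y ω).card)) ≤ (S.card : ℝ) ^ (k + 1) / ((k + 1) * (a * S.card)) := by
            gcongr
        _ = _ := by rw [div_eq_div_iff (by positivity) (by positivity)]; ring
    have hpt : ∀ π ∈ Fintype.piFinset (fun _ : Fin k => S ×ˢ S), (∏ j, w (π j)) *
        (1 / √((Finset.univ.filter fun j => act (π j)).card + 1)) ≤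
        q / 2 * ((∏ j, w (π j)) / ((Finset.univ.filter fun j => act (π j)).card + 1)) +
        1 / q / 2 * (∏ j, w (π j)) := by
      intro π _
      have hp : 0 ≤ ∏ j, w (π j) := Finset.prod_nonneg fun j _ => hw0 _
      have := one_div_sqrt_le (x := (Finset.univ.filter fun j => act (π j)).card + 1)
        (by positivity) hqpos
      calc _ ≤ (∏ j, w (π j)) * _ := mul_le_mul_of_nonneg_left this hp
        _ = _ := by ring
    refine (Finset.sum_le_sum hpt).trans ?_
    rw [Finset.sum_add_distrib, ← Finset.mul_sum, ← Finset.mul_sum, hall, hPc]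
    have h7 := h5.trans h6
    have h8 : (S.card : ℝ) ^ k / ((k + 1) * a) = (S.card : ℝ) ^ k * (1 / q) ^ 2 := by
      rw [div_pow, hqdef, Real.sq_sqrt hq.le]; ring
    rw [h8] at h7
    calc _ ≤ q / 2 * ((S.card : ℝ) ^ k * (1 / q) ^ 2) + 1 / q / 2 * (S.card : ℝ) ^ k := by gcongr
      _ = _ := by field_simp; ring

end CollisionEntropy

section Variance

variable {Ω γ : Type*} {S : Finset Ω}

lemma sum_piFinset_succ {k : ℕ} (T : Finset Ω) (F : (Fin (k + 1) → Ω) → ℝ) :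
    ∑ b ∈ Fintype.piFinset (fun _ : Fin (k + 1) => T), F b =
      ∑ a ∈ T, ∑ b ∈ Fintype.piFinset (fun _ : Fin k => T), F (Fin.cons a b) := by
  rw [← Finset.sum_product']
  symm
  refine Finset.sum_nbij (fun p : Ω × (Fin k → Ω) => (Fin.cons p.1 p.2 : Fin (k + 1) → Ω))
    ?_ ?_ ?_ ?_
  · intro p hp; exact_mod_cast (bijOn_cons_piFinset T).mapsTo (by exact_mod_cast hp)
  · exact (bijOn_cons_piFinset T).injOn
  · exact (bijOn_cons_piFinset T).surjOn
  · intro p _; rfl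

lemma sum_piFinset_sum_eq_zero {d : Ω → ℝ} (hd : ∑ ω ∈ S, d ω = 0) (k : ℕ) :
    ∑ b ∈ Fintype.piFinset (fun _ : Fin k => S), ∑ j, d (b j) = 0 := by
  induction k with
  | zero => simp
  | succ k ih =>
    rw [sum_piFinset_succ]
    simp only [Fin.sum_univ_succ, Fin.cons_zero, Fin.cons_succ, Finset.sum_add_distrib, ih,
      Finset.sum_const, add_zero]
    rw [← Finset.smul_sum, hd, smul_zero]

lemma sum_piFinset_sq {d : Ω → ℝ} (hd : ∑ ω ∈ S, d ω = 0) (k : ℕ) :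
    ∑ b ∈ Fintype.piFinset (fun _ : Fin k => S), (∑ j, d (b j)) ^ 2 * S.card =
      k * (S.card : ℝ) ^ k * ∑ ω ∈ S, d ω ^ 2 := by
  induction k with
  | zero => simp
  | succ k ih =>
    rw [sum_piFinset_succ]
    have h0 := sum_piFinset_sum_eq_zero hd k
    have : ∀ a ∈ S, ∑ b ∈ Fintype.piFinset (fun _ : Fin k => S),
        (∑ j, d ((Fin.cons a b : Fin (k + 1) → Ω) j)) ^ 2 * (S.card : ℝ) =
        (S.card : ℝ) ^ (k + 1) * d a ^ 2 + k * (S.card : ℝ) ^ k * ∑ ω ∈ S, d ω ^ 2 := by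
      intro a _
      rw [← ih]
      have e : ∀ b : Fin k → Ω, (∑ j, d ((Fin.cons a b : Fin (k + 1) → Ω) j)) ^ 2 * (S.card : ℝ) =
          d a ^ 2 * S.card + 2 * d a * S.card * (∑ j, d (b j)) + (∑ j, d (b j)) ^ 2 * S.card := by
        intro b
        simp only [Fin.sum_univ_succ, Fin.cons_zero, Fin.cons_succ]
        ring
      simp only [e, Finset.sum_add_distrib, ← Finset.mul_sum, h0, Finset.sum_const,
        Fintype.card_piFinset]
      simp [pow_succ]; ring
    rw [Finset.sum_congr rfl this, Finset.sum_add_distrib, ← Finset.mul_sum, Finset.sum_const,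
      nsmul_eq_mul]
    push_cast; ring

lemma sum_abs_sum_le {d : Ω → ℝ} (hS : S.Nonempty) (hd : ∑ ω ∈ S, d ω = 0) {θ : ℝ}
    (hθ : ∀ ω ∈ S, |d ω| ≤ θ) (k : ℕ) :
    ∑ b ∈ Fintype.piFinset (fun _ : Fin k => S), |∑ j, d (b j)| ≤
      √k * θ * (Fintype.piFinset (fun _ : Fin k => S)).card := by
  have hθ0 : 0 ≤ θ := (abs_nonneg _).trans (hθ _ hS.choose_spec)
  have hc : (0 : ℝ) < S.card := by exact_mod_cast hS.card_pos
  have h1 := sum_piFinset_sq hd k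
  have h2 : ∑ ω ∈ S, d ω ^ 2 ≤ S.card * θ ^ 2 := by
    rw [← nsmul_eq_mul]
    exact Finset.sum_le_card_nsmul _ _ _ fun ω h => sq_le_sq' (neg_le_of_abs_le (hθ ω h))
      (le_of_abs_le (hθ ω h))
  have h3 : ∑ b ∈ Fintype.piFinset (fun _ : Fin k => S), (∑ j, d (b j)) ^ 2 ≤
      k * (S.card : ℝ) ^ k * θ ^ 2 := by
    rw [← Finset.sum_mul] at h1
    refine le_of_mul_le_mul_right ?_ hc
    rw [h1]
    calc _ ≤ k * (S.card : ℝ) ^ k * (S.card * θ ^ 2) := by gcongr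
      _ = _ := by ring
  have hcard : ((Fintype.piFinset (fun _ : Fin k => S)).card : ℝ) = (S.card : ℝ) ^ k := by
    simp [Fintype.card_piFinset]
  have h4 := sq_sum_le_card_mul_sum_sq (s := Fintype.piFinset (fun _ : Fin k => S))
    (f := fun b => |∑ j, d (b j)|)
  simp only [sq_abs] at h4
  rw [hcard] at h4 ⊢
  refine abs_le_of_sq_le_sq' ?_ (by positivity) |>.2
  calc _ ≤ (S.card : ℝ) ^ k * (k * (S.card : ℝ) ^ k * θ ^ 2) := h4.trans (by gcongr)
    _ = (√k * θ * (S.card : ℝ) ^ k) ^ 2 := by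
      rw [mul_pow, mul_pow, Real.sq_sqrt (by positivity)]; ring

lemma cent_le_ent {β : Type*} (X : Ω → β) (Y : Ω → γ) : cent S X Y ≤ ent S X := by
  have h := cent_anti_right (S := S) (X := X) (Y := fun _ => ()) (Y' := Y) (by simp)
  refine h.trans ?_
  have : ent S (fun ω => (X ω, ())) = ent S X := ent_congr (by simp)
  have h0 := ent_nonneg (S := S) (fun _ : Ω => ())
  unfold cent
  linarith

lemma sum_two_pow_natAbs_le (g : Finset ℤ) : ∑ z ∈ g, (1 / 2 : ℝ) ^ z.natAbs / 4 ≤ 1 := by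
  rw [← Finset.sum_div, div_le_one (by norm_num)]
  have key : ∀ s : Finset ℤ, Set.InjOn Int.natAbs (s : Set ℤ) →
      ∑ z ∈ s, (1 / 2 : ℝ) ^ z.natAbs ≤ 2 := by
    intro s hs
    rw [← Finset.sum_image (f := fun n : ℕ => (1 / 2 : ℝ) ^ n) hs]
    exact (summable_geometric_two.sum_le_tsum _ fun _ _ => by positivity).trans_eq
      tsum_geometric_two
  rw [← Finset.sum_filter_add_sum_filter_not g (fun z => 0 ≤ z)]
  have a1 := key (g.filter fun z => 0 ≤ z) (by intro x hx y hy h; simp at hx hy h; omega)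
  have a2 := key (g.filter fun z => ¬ 0 ≤ z) (by intro x hx y hy h; simp at hx hy h; omega)
  linarith

lemma ent_int_le (hS : S.Nonempty) (W : Ω → ℤ) :
    ent S W ≤ 2 + (∑ ω ∈ S, |(W ω : ℝ)|) / S.card := by
  have hc : (0 : ℝ) < S.card := by exact_mod_cast hS.card_pos
  classical
  refine (ent_le_gibbs (fun z => (1 / 2 : ℝ) ^ z.natAbs / 4) (S.image W)
    (fun ω h => Finset.mem_image_of_mem _ h) (fun _ _ => by positivity)
    (sum_two_pow_natAbs_le _)).trans ?_
  rw [div_le_iff₀ hc, add_mul, div_mul_cancel₀ _ hc.ne', mul_comm (2 : ℝ), ← nsmul_eq_mul,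
    ← Finset.sum_const, ← Finset.sum_add_distrib]
  refine Finset.sum_le_sum fun ω _ => le_of_eq ?_
  rw [Real.logb_div (by positivity) (by norm_num), Real.logb_pow,
    show (1 / 2 : ℝ) = 2⁻¹ by norm_num, Real.logb_inv, Real.logb_self_eq_one (by norm_num),
    show (4 : ℝ) = 2 ^ (2 : ℕ) by norm_num, Real.logb_pow, Real.logb_self_eq_one (by norm_num)]
  have : ((W ω).natAbs : ℝ) = |(W ω : ℝ)| := by simp
  rw [this]; push_cast; ring

/-- Entropy of a coarse cell of a sum of `k` independent variables, given prefixes. -/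
lemma cent_sum_div_le (hS : S.Nonempty) (B : Ω → ℤ) (Y : Ω → γ) (θ : ℝ)
    (hθ : ∀ b ∈ S, ∀ b' ∈ S, Y b = Y b' → |(B b : ℝ) - B b'| ≤ θ) (k : ℕ) (a N : ℤ) (hN : 0 < N) :
    cent (Fintype.piFinset fun _ : Fin k => S) (fun b => (a + ∑ j, B (b j)) / N)
      (fun b j => Y (b j)) ≤ 3 + √k * θ / N := by
  set P := Fintype.piFinset fun _ : Fin k => S with hP
  have hPne : P.Nonempty := Fintype.piFinset_nonempty.2 fun _ => hS
  have hPc : (0 : ℝ) < P.card := by exact_mod_cast hPne.card_pos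
  have hN' : (0 : ℝ) < N := by exact_mod_cast hN
  set μ : Ω → ℝ := fun ω => (∑ b ∈ fib S Y ω, (B b : ℝ)) / (fib S Y ω).card with hμ
  have hμY : ∀ b b', Y b = Y b' → μ b = μ b' := by
    intro b b' h; simp only [hμ, fib_congr h]
  set d : Ω → ℝ := fun ω => B ω - μ ω with hd
  have hd0 : ∑ ω ∈ S, d ω = 0 := by
    simp only [hd, hμ, Finset.sum_sub_distrib]
    rw [sum_fib_avg (S := S) Y (fun b => (B b : ℝ)), sub_self]
  have hdθ : ∀ ω ∈ S, |d ω| ≤ θ := by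
    intro ω hω
    have hc := fib_card_pos (X := Y) hω
    have : d ω = (∑ b ∈ fib S Y ω, ((B ω : ℝ) - B b)) / (fib S Y ω).card := by
      simp only [hd, hμ, Finset.sum_sub_distrib, Finset.sum_const, nsmul_eq_mul]
      field_simp
    rw [this, abs_div, Nat.abs_cast, div_le_iff₀ hc, mul_comm, ← nsmul_eq_mul]
    refine (Finset.abs_sum_le_sum_abs _ _).trans (Finset.sum_le_card_nsmul _ _ _ fun b hb => ?_)
    have hb' := mem_fib.1 hb
    exact hθ _ hω _ hb'.1 hb'.2.symm
  set Z0 : (Fin k → Ω) → ℤ := fun b => ⌊((a : ℝ) + ∑ j, μ (b j)) / N⌋ with hZ0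
  set W : (Fin k → Ω) → ℤ := fun b => (a + ∑ j, B (b j)) / N - Z0 b with hW
  have h1 : cent P (fun b => (a + ∑ j, B (b j)) / N) (fun b j => Y (b j)) ≤
      cent P W (fun b j => Y (b j)) := by
    refine cent_mono_left fun b _ b' _ hWW hYY => ?_
    have : Z0 b = Z0 b' := by
      simp only [hZ0]
      rw [Finset.sum_congr rfl fun j _ => hμY (b j) (b' j) (congrFun hYY j)]
    simp only [hW] at hWW
    omega
  refine h1.trans ((cent_le_ent _ _).trans ((ent_int_le hPne W).trans ?_))
  have h2 := sum_abs_sum_le hS hd0 hdθ k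
  have h3 : ∀ b ∈ P, |(W b : ℝ)| ≤ 1 + |∑ j, d (b j)| / N := by
    intro b _
    have e1 : (((a + ∑ j, B (b j)) / N : ℤ) : ℝ) = ⌊((a : ℝ) + ∑ j, (B (b j) : ℝ)) / N⌋ := by
      have := Int.floor_div_cast_of_nonneg (k := ℝ) hN.le ((a : ℝ) + ∑ j, (B (b j) : ℝ))
      rw [this]
      congr 2
      symm
      rw [Int.floor_eq_iff]; push_cast; constructor <;> linarith
    have e2 : ∑ j, d (b j) = ((a : ℝ) + ∑ j, (B (b j) : ℝ)) - (a + ∑ j, μ (b j)) := by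
      simp only [hd, Finset.sum_sub_distrib]; ring
    simp only [hW, hZ0]; push_cast [e1]
    rw [e2, ← abs_of_pos hN', ← abs_div, sub_div, abs_of_pos hN']
    set x := ((a : ℝ) + ∑ j, (B (b j) : ℝ)) / N
    set y := ((a : ℝ) + ∑ j, μ (b j)) / N
    have := Int.floor_le x; have := Int.lt_floor_add_one x
    have := Int.floor_le y; have := Int.lt_floor_add_one y
    have := le_abs_self (x - y); have := neg_abs_le (x - y)
    rw [abs_le]; constructor <;> linarith
  have h4 : (∑ b ∈ P, |(W b : ℝ)|) / P.card ≤ 1 + √k * θ / N := by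
    rw [div_le_iff₀ hPc]
    refine (Finset.sum_le_sum h3).trans ?_
    rw [Finset.sum_add_distrib, ← Finset.sum_div, Finset.sum_const, nsmul_eq_mul, add_mul]
    have : (∑ b ∈ P, |∑ j, d (b j)|) / N ≤ √k * θ * P.card / N := by gcongr
    calc _ ≤ (P.card : ℝ) * 1 + √k * θ * P.card / N := by gcongr
      _ = _ := by ring
  linarith

end Variance

section Blocks

variable {Ω Ω' γ : Type*} {S : Finset Ω}

lemma ent_const (c : γ) : ent S (fun _ => c) = 0 := by
  refine le_antisymm ?_ (ent_nonneg _)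
  have := ent_le_logb (S := S) (X := fun _ => c) {c} (by simp) (K := 1) (by simp) le_rfl
  simpa using this

lemma ediv_pow_of_le (x : ℤ) {v w : ℕ} (h : v ≤ w) :
    x / 2 ^ w = x / 2 ^ v / 2 ^ (w - v) := by
  rw [Int.ediv_ediv_of_nonneg (by positivity), ← pow_add, Nat.add_sub_cancel' h]

lemma cent_div_pow (X : Ω → ℤ) {v w : ℕ} (h : v ≤ w) :
    cent S (fun ω => X ω / 2 ^ v) (fun ω => X ω / 2 ^ w) =
      ent S (fun ω => X ω / 2 ^ v) - ent S (fun ω => X ω / 2 ^ w) := by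
  unfold cent
  congr 1
  refine ent_congr fun a _ b _ => ?_
  simp only [Prod.mk.injEq, and_iff_left_iff_imp]
  intro hab
  rw [ediv_pow_of_le _ h, ediv_pow_of_le _ h, hab]

lemma ent_le_ent_add_cent (X : Ω → γ) {β : Type*} (X' : Ω → β) :
    ent S X ≤ ent S X' + cent S X X' := by
  unfold cent
  have := ent_mono (S := S) (X := fun ω => (X ω, X' ω)) (Y := X) (by simp +contextual)
  linarith

lemma ent_le_of_close (X X' : Ω → ℤ) (c : ℤ) (h : ∀ a ∈ S, X a - X' a - c ∈ Set.Icc (0 : ℤ) 1) :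
    ent S X ≤ ent S X' + 2 := by
  refine (ent_le_ent_add_cent X X').trans ?_
  have := cent_int_le (S := S) (X := X) (Y := X') 1 fun a ha b hb hab => by
    have h1 := h a ha; have h2 := h b hb
    simp only [Set.mem_Icc] at h1 h2
    rw [abs_le]; push_cast; constructor <;> omega
  have h3 : Real.logb 2 (2 * (1 : ℕ) + 1) ≤ 2 := by
    rw [Real.logb_le_iff_le_rpow (by norm_num) (by norm_num)]; norm_num
  linarith

lemma ediv_add_sub (x c : ℤ) {N : ℤ} (hN : 0 < N) :
    (x + c) / N - x / N - c / N ∈ Set.Icc (0 : ℤ) 1 := by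
  have h1 := Int.emod_add_mul_ediv x N
  have h2 := Int.emod_add_mul_ediv c N
  have h3 := Int.emod_nonneg x hN.ne'
  have h4 := Int.emod_nonneg c hN.ne'
  have h5 := Int.emod_lt_of_pos x hN
  have h6 := Int.emod_lt_of_pos c hN
  have e : (x + c) / N = x / N + c / N + (x % N + c % N) / N := by
    conv_lhs => rw [← h1, ← h2]
    rw [show x % N + N * (x / N) + (c % N + N * (c / N)) =
      (x % N + c % N) + N * (x / N + c / N) by ring, Int.add_mul_ediv_left _ _ hN.ne']
    ring
  rw [e]
  have h7 : 0 ≤ (x % N + c % N) / N := Int.ediv_nonneg (by omega) hN.le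
  have h8 : (x % N + c % N) / N < 2 := Int.ediv_lt_of_lt_mul hN (by linarith)
  simp only [Set.mem_Icc]
  constructor <;> omega

lemma abs_ent_shift (X : Ω → ℤ) (c : ℤ) (v : ℕ) :
    |ent S (fun ω => (X ω + c) / 2 ^ v) - ent S (fun ω => X ω / 2 ^ v)| ≤ 2 := by
  have hN : (0 : ℤ) < 2 ^ v := by positivity
  have h1 := ent_le_of_close (S := S) (fun ω => (X ω + c) / 2 ^ v) (fun ω => X ω / 2 ^ v) (c / 2 ^ v)
    fun a _ => ediv_add_sub _ _ hN
  have h2 := ent_le_of_close (S := S) (fun ω => X ω / 2 ^ v) (fun ω => (X ω + c) / 2 ^ v)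
    (-(c / 2 ^ v) - 1) fun a _ => by
      have := ediv_add_sub (X a) c hN
      simp only [Set.mem_Icc] at this ⊢
      constructor <;> omega
  rw [abs_le]; constructor <;> linarith

lemma cent_shift_ge (X : Ω → ℤ) (c : ℤ) {v w : ℕ} (h : v ≤ w) :
    cent S (fun ω => X ω / 2 ^ v) (fun ω => X ω / 2 ^ w) - 4 ≤
      cent S (fun ω => (X ω + c) / 2 ^ v) (fun ω => (X ω + c) / 2 ^ w) := by
  rw [cent_div_pow X h, cent_div_pow (fun ω => X ω + c) h]
  have h1 := abs_le.1 (abs_ent_shift (S := S) X c v)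
  have h2 := abs_le.1 (abs_ent_shift (S := S) X c w)
  linarith [h1.1, h2.2]

variable {ΩA ΩB : Type*} {SA : Finset ΩA} {SB : Finset ΩB}

lemma cent_prod_snd_pair {β δ : Type*} (hA : SA.Nonempty) (X : ΩA × ΩB → β) (Z : ΩA × ΩB → δ) :
    cent (SA ×ˢ SB) X (fun p => (p.2, Z p)) =
      (∑ b ∈ SB, cent SA (fun a => X (a, b)) (fun a => Z (a, b))) / SB.card := by
  have h := cent_prod_fst_pair (S₁ := SB) hA (fun p : ΩB × ΩA => X p.swap) (fun p => Z p.swap)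
  simp only [Prod.swap_prod_mk] at h
  rw [← h]
  symm
  refine cent_bij (f := Prod.swap) (S := SB ×ˢ SA) (S' := SA ×ˢ SB) ?_ X
    (fun p => (p.2, Z p))
  refine ⟨fun p hp => ?_, Prod.swap_injective.injOn, fun p hp => ⟨p.swap, ?_, by simp⟩⟩
  · simp at hp ⊢; tauto
  · simp at hp ⊢; tauto

/-- Adding an independent variable essentially does not decrease block entropy. -/
lemma cent_block_add_ge (hA : SA.Nonempty) (hB : SB.Nonempty) (A : ΩA → ℤ) (B : ΩB → ℤ) {v w : ℕ}
    (h : v ≤ w) :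
    cent SA (fun a => A a / 2 ^ v) (fun a => A a / 2 ^ w) - 4 ≤
      cent (SA ×ˢ SB) (fun p => (A p.1 + B p.2) / 2 ^ v) (fun p => (A p.1 + B p.2) / 2 ^ w) := by
  refine le_trans ?_ (cent_anti_right
    (Y' := fun p : ΩA × ΩB => (p.2, (A p.1 + B p.2) / 2 ^ w)) (by simp +contextual))
  rw [cent_prod_snd_pair hA]
  exact le_avg hB fun b _ => cent_shift_ge A (B b) h

lemma ent_add_ge (hA : SA.Nonempty) (hB : SB.Nonempty) (A : ΩA → ℤ) (B : ΩB → ℤ) (v : ℕ) :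
    ent SA (fun a => A a / 2 ^ v) - 2 ≤ ent (SA ×ˢ SB) (fun p => (A p.1 + B p.2) / 2 ^ v) := by
  refine le_trans ?_ (cent_le_ent _ (fun p : ΩA × ΩB => (p.2, ())))
  rw [cent_prod_snd_pair hA]
  refine le_avg hB fun b _ => ?_
  have h1 := abs_le.1 (abs_ent_shift (S := SA) A (B b) v)
  have : cent SA (fun a => (A a + B b) / 2 ^ v) (fun _ => ()) =
      ent SA (fun a => (A a + B b) / 2 ^ v) := by
    unfold cent
    rw [ent_const, sub_zero]
    exact ent_congr (by simp)
  simp only [this]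
  linarith [h1.1]

/-- Collision defect of the cells of `B` at levels `v` and `v + g`. -/
def defect (S : Finset Ω) (B : Ω → ℤ) (v g : ℕ) : ℝ :=
  (∑ ω ∈ S, (1 - ((fib S (fun ω => (B ω / 2 ^ v, B ω / 2 ^ (v + g))) ω).card : ℝ) /
    (fib S (fun ω => B ω / 2 ^ (v + g)) ω).card)) / S.card

lemma cent_active_ge (hA : SA.Nonempty) (hB : SB.Nonempty) (A : ΩA → ℤ) (B : ΩB → ℤ) (v g m : ℕ)
    (hpar : ∀ b ∈ SB, ∀ b' ∈ SB, Even (B b / 2 ^ v - B b' / 2 ^ v))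
    {δ : ℝ} (hδ : 0 < δ) (hδB : δ ≤ defect SB B v g) :
    m + Real.logb 2 δ / 2 - 3 - 2 ^ g ≤
      cent (SA ×ˢ Fintype.piFinset fun _ : Fin (4 ^ m) => SB)
        (fun p => (A p.1 + ∑ j, B (p.2 j)) / 2 ^ v)
        (fun p => (A p.1 + ∑ j, B (p.2 j)) / 2 ^ (v + m)) := by
  set k := 4 ^ m with hk
  set P := Fintype.piFinset fun _ : Fin k => SB with hP
  have hPne : P.Nonempty := Fintype.piFinset_nonempty.2 fun _ => hB
  set Y : ΩB → ℤ := fun b => B b / 2 ^ (v + g) with hY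
  set U : ΩA × (Fin k → ΩB) → ℤ := fun p => (A p.1 + ∑ j, B (p.2 j)) / 2 ^ v with hU
  set V : ΩA × (Fin k → ΩB) → ℤ := fun p => (A p.1 + ∑ j, B (p.2 j)) / 2 ^ (v + m) with hV
  set I : ΩA × (Fin k → ΩB) → ΩA × (Fin k → ℤ) := fun p => (p.1, fun j => Y (p.2 j)) with hI
  have hc : (0 : ℝ) < SB.card := by exact_mod_cast hB.card_pos
  have h1 : cent (SA ×ˢ P) U (fun p => (V p, I p)) ≤ cent (SA ×ˢ P) U V :=
    cent_anti_right (by simp +contextual)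
  have h2 : cent (SA ×ˢ P) U I ≤ cent (SA ×ˢ P) V I + cent (SA ×ˢ P) U (fun p => (V p, I p)) :=
    cent_le_add _ _ _
  have h3 : cent (SA ×ˢ P) V I ≤ 3 + 2 ^ g := by
    rw [hI, cent_prod_fst_pair hPne]
    refine avg_le (by positivity) fun a _ => ?_
    refine (cent_sum_div_le hB B Y (2 ^ (v + g)) (fun b _ b' _ hbb => ?_) k (A a) (2 ^ (v + m))
      (by positivity)).trans_eq ?_
    · have e1 := Int.emod_add_mul_ediv (B b) (2 ^ (v + g))
      have e2 := Int.emod_add_mul_ediv (B b') (2 ^ (v + g))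
      have p1 := Int.emod_nonneg (B b) (b := 2 ^ (v + g)) (by positivity)
      have p2 := Int.emod_nonneg (B b') (b := 2 ^ (v + g)) (by positivity)
      have p3 := Int.emod_lt_of_pos (B b) (b := 2 ^ (v + g)) (by positivity)
      have p4 := Int.emod_lt_of_pos (B b') (b := 2 ^ (v + g)) (by positivity)
      simp only [hY] at hbb
      rw [hbb] at e1
      have : |B b - B b'| ≤ 2 ^ (v + g) := by rw [abs_le]; constructor <;> linarith
      exact_mod_cast this
    · have : √(k : ℝ) = 2 ^ m := by
        rw [hk]; push_cast
        rw [show (4 : ℝ) ^ m = (2 ^ m) ^ 2 by rw [← pow_mul, mul_comm, pow_mul]; norm_num]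
        exact Real.sqrt_sq (by positivity)
      rw [this]
      push_cast
      rw [pow_add, pow_add]
      field_simp
  have h4 : Real.logb 2 (√((k + 1) * δ)) ≤ cent (SA ×ˢ P) U I := by
    rw [hI, cent_prod_fst_pair hPne]
    refine le_avg hA fun a _ => ?_
    refine le_cent_sum hB B (fun b => B b / 2 ^ v) Y (2 ^ v) (fun b hb b' hb' _ hX => ?_) k _
      (fun b b' hZ => ?_) hδ ?_
    · obtain ⟨t, ht⟩ := hpar b hb b' hb'
      have e1 := Int.emod_add_mul_ediv (B b) (2 ^ v)
      have e2 := Int.emod_add_mul_ediv (B b') (2 ^ v)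
      have p1 := Int.emod_nonneg (B b) (b := 2 ^ v) (by positivity)
      have p2 := Int.emod_nonneg (B b') (b := 2 ^ v) (by positivity)
      have p3 := Int.emod_lt_of_pos (B b) (b := 2 ^ v) (by positivity)
      have p4 := Int.emod_lt_of_pos (B b') (b := 2 ^ v) (by positivity)
      have hN : (0 : ℤ) < 2 ^ v := by positivity
      generalize (2 : ℤ) ^ v = N at *
      have e3 : B b - B b' = B b % N - B b' % N + N * (t + t) := by rw [← ht]; linarith
      rcases lt_trichotomy t 0 with h | h | h
      · rw [le_abs]; left; nlinarith
      · exfalso; apply hX; subst h; linarith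
      · rw [le_abs]; right; nlinarith
    · simp only [hU] at hZ
      rw [Finset.sum_sub_distrib]
      have e1 := Int.emod_add_mul_ediv (A a + ∑ j, B (b j)) (2 ^ v)
      have e2 := Int.emod_add_mul_ediv (A a + ∑ j, B (b' j)) (2 ^ v)
      have p1 := Int.emod_nonneg (A a + ∑ j, B (b j)) (b := 2 ^ v) (by positivity)
      have p2 := Int.emod_nonneg (A a + ∑ j, B (b' j)) (b := 2 ^ v) (by positivity)
      have p3 := Int.emod_lt_of_pos (A a + ∑ j, B (b j)) (b := 2 ^ v) (by positivity)
      have p4 := Int.emod_lt_of_pos (A a + ∑ j, B (b' j)) (b := 2 ^ v) (by positivity)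
      rw [hZ] at e1
      rw [abs_lt]; constructor <;> linarith
    · rw [defect, le_div_iff₀ hc] at hδB
      exact hδB
  have h5 : m + Real.logb 2 δ / 2 ≤ Real.logb 2 (√((k + 1) * δ)) := by
    rw [Real.logb, Real.logb, Real.log_sqrt (by positivity),
      Real.log_mul (by positivity) hδ.ne']
    have hl := Real.log_pos (by norm_num : (1 : ℝ) < 2)
    rw [add_div, add_div, div_right_comm]
    have : (m : ℝ) ≤ Real.log (k + 1) / 2 / Real.log 2 := by
      rw [le_div_iff₀ hl, le_div_iff₀ (by norm_num)]
      have e : (m : ℝ) * Real.log 2 * 2 = Real.log (4 ^ m) := by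
        rw [Real.log_pow, show (4 : ℝ) = 2 ^ 2 by norm_num, Real.log_pow]; push_cast; ring
      rw [e]
      refine Real.log_le_log (by positivity) ?_
      rw [hk]; push_cast; linarith
    linarith
  linarith

lemma log_le_weighted {x l : ℝ} (hx : 1 ≤ x) (hl : 0 < l) :
    Real.log x ≤ l * x + (1 - 1 / x) / l := by
  have hx0 : 0 < x := by linarith
  have hs := Real.sqrt_pos.2 hx0
  have hss := Real.sq_sqrt hx0.le
  have hs1 : 1 ≤ √x := Real.one_le_sqrt.2 hx
  have h1 : Real.log x ≤ 2 * (√x - 1) := by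
    have := Real.log_le_sub_one_of_pos hs
    rw [Real.log_sqrt hx0.le] at this
    linarith
  set y := √x
  set p := 1 - 1 / x with hp
  have hp0 : 0 ≤ p := by
    rw [hp, sub_nonneg, div_le_one hx0]; exact hx
  have hp1 : p ≤ 1 := by rw [hp]; have : 0 ≤ 1 / x := by positivity
                         linarith
  have h2 : y - 1 ≤ y * p := by
    rw [hp, ← hss]; field_simp
    nlinarith
  have h3 : 2 * (y * p) ≤ l * y ^ 2 + p ^ 2 / l := by
    have : 0 ≤ (l * y - p) ^ 2 / l := by positivity
    have e : (l * y - p) ^ 2 / l = l * y ^ 2 + p ^ 2 / l - 2 * (y * p) := by field_simp; ring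
    linarith
  have h4 : p ^ 2 / l ≤ p / l := by
    gcongr; nlinarith
  rw [hss] at h3
  linarith

lemma sum_fib_ratio_le (X : Ω → ℤ) (Y : Ω → ℤ) {K : ℕ}
    (h : ∀ ω ∈ S, ∃ g : Finset ℤ, g.card ≤ K ∧ ∀ a ∈ S, Y a = Y ω → X a ∈ g) :
    ∑ ω ∈ S, ((fib S Y ω).card : ℝ) / (fib S (fun ω => (X ω, Y ω)) ω).card ≤ K * S.card := by
  rw [← sum_fib_avg (S := S) Y, mul_comm, ← nsmul_eq_mul]
  refine Finset.sum_le_card_nsmul _ _ _ fun ω hω => ?_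
  have hc := fib_card_pos (X := Y) hω
  rw [div_le_iff₀ hc, mul_comm]
  have e : ∀ a ∈ fib S Y ω, ((fib S Y a).card : ℝ) / (fib S (fun ω => (X ω, Y ω)) a).card =
      (fib S Y ω).card * (1 / (fib (fib S Y ω) X a).card) := by
    intro a ha
    rw [fib_fib X Y ha, fib_congr (mem_fib.1 ha).2, mul_one_div]
  rw [Finset.sum_congr rfl e, ← Finset.mul_sum]
  gcongr
  obtain ⟨g, hgK, hg⟩ := h ω hω
  rw [← Finset.sum_fiberwise_of_maps_to (g := X) (t := g)
    fun a ha => hg a (mem_fib.1 ha).1 (mem_fib.1 ha).2]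
  refine (Finset.sum_le_card_nsmul _ _ 1 fun x _ => ?_).trans ?_
  · exact sum_inv_fib_le_one X _ (Finset.filter_subset _ _) fun a ha b hb =>
      (Finset.mem_filter.1 ha).2.trans (Finset.mem_filter.1 hb).2.symm
  · simpa using hgK

/-- A level with small defect carries little entropy. -/
lemma cent_level_le (hS : S.Nonempty) (B : Ω → ℤ) (v g : ℕ) {l : ℝ} (hl : 0 < l) :
    cent S (fun ω => B ω / 2 ^ v) (fun ω => B ω / 2 ^ (v + g)) ≤
      2 * (l * (2 ^ g + 1) + defect S B v g / l) := by
  have hc : (0 : ℝ) < S.card := by exact_mod_cast hS.card_pos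
  set X : Ω → ℤ := fun ω => B ω / 2 ^ v with hX
  set Y : Ω → ℤ := fun ω => B ω / 2 ^ (v + g) with hY
  have h0 : ∑ ω ∈ S, ((fib S Y ω).card : ℝ) / (fib S (fun ω => (X ω, Y ω)) ω).card ≤
      (2 ^ g + 1 : ℕ) * S.card := by
    refine sum_fib_ratio_le X Y fun ω _ => ⟨Finset.Icc (Y ω * 2 ^ g) (Y ω * 2 ^ g + 2 ^ g),
      ?_, fun a _ ha => ?_⟩
    · rw [Int.card_Icc]
      have : (Y ω * 2 ^ g + 2 ^ g + 1 - Y ω * 2 ^ g : ℤ) = ((2 ^ g + 1 : ℕ) : ℤ) := by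
        push_cast; ring
      rw [this, Int.toNat_natCast]
    · have e : Y a = X a / 2 ^ g := by
        simp only [hX, hY]; rw [ediv_pow_of_le _ (Nat.le_add_right v g), Nat.add_sub_cancel_left]
      rw [← ha, e]
      have e1 := Int.emod_add_mul_ediv (X a) (2 ^ g)
      have p1 := Int.emod_nonneg (X a) (b := 2 ^ g) (by positivity)
      have p3 := Int.emod_lt_of_pos (X a) (b := 2 ^ g) (by positivity)
      rw [Finset.mem_Icc]; constructor <;> linarith
  rw [cent_eq_sum]
  have hl2 : (1 : ℝ) / 2 ≤ Real.log 2 := by have := Real.log_two_gt_d9; linarith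
  have h1 : ∀ ω ∈ S, Real.logb 2 ((fib S Y ω).card / (fib S (fun ω => (X ω, Y ω)) ω).card) ≤
      2 * (l * (((fib S Y ω).card : ℝ) / (fib S (fun ω => (X ω, Y ω)) ω).card) +
        (1 - ((fib S (fun ω => (X ω, Y ω)) ω).card : ℝ) / (fib S Y ω).card) / l) := by
    intro ω hω
    have c1 := fib_card_pos (X := Y) hω
    have c2 := fib_card_pos (X := fun ω => (X ω, Y ω)) hω
    have hsub : ((fib S (fun ω => (X ω, Y ω)) ω).card : ℝ) ≤ (fib S Y ω).card := by
      exact_mod_cast Finset.card_le_card fun a ha => by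
        rw [mem_fib] at ha ⊢
        exact ⟨ha.1, (Prod.mk.inj ha.2).2⟩
    have hx : (1 : ℝ) ≤ (fib S Y ω).card / (fib S (fun ω => (X ω, Y ω)) ω).card := by
      rwa [one_le_div c2]
    have := log_le_weighted hx hl
    rw [one_div_div] at this
    have h0 := Real.log_nonneg hx
    rw [Real.logb, div_le_iff₀ (by linarith)]
    nlinarith
  refine (div_le_div_of_nonneg_right (Finset.sum_le_sum h1) hc.le).trans ?_
  rw [← Finset.mul_sum, Finset.sum_add_distrib, ← Finset.mul_sum, ← Finset.sum_div, defect,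
    div_le_iff₀ hc]
  push_cast at h0
  set E := ∑ ω ∈ S, (1 - ((fib S (fun ω => (X ω, Y ω)) ω).card : ℝ) / (fib S Y ω).card)
  have : 2 * (l * (2 ^ g + 1) + E / S.card / l) * S.card =
      2 * (l * ((2 ^ g + 1) * S.card) + E / l) := by field_simp
  rw [this]
  gcongr

lemma cent_level_le_log (B : Ω → ℤ) (v g : ℕ) :
    cent S (fun ω => B ω / 2 ^ v) (fun ω => B ω / 2 ^ (v + g)) ≤ g := by
  have hK : (1 : ℝ) ≤ 2 ^ g := one_le_pow₀ (by norm_num)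
  have : Real.logb 2 (2 ^ g) = (g : ℝ) := by
    rw [Real.logb_pow, Real.logb_self_eq_one (by norm_num), mul_one]
  rw [← this]
  refine cent_le_logb hK fun ω _ =>
    ⟨Finset.Ico (B ω / 2 ^ (v + g) * 2 ^ g) (B ω / 2 ^ (v + g) * 2 ^ g + 2 ^ g), ?_, fun a _ ha => ?_⟩
  · rw [Int.card_Ico, add_sub_cancel_left]
    have : (2 ^ g : ℤ).toNat = 2 ^ g := by
      rw [show (2 ^ g : ℤ) = ((2 ^ g : ℕ) : ℤ) by push_cast; rfl, Int.toNat_natCast]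
    rw [this]; push_cast; rfl
  · rw [ediv_pow_of_le (B a) (Nat.le_add_right v g), Nat.add_sub_cancel_left] at ha
    rw [← ha]
    have e1 := Int.emod_add_mul_ediv (B a / 2 ^ v) (2 ^ g)
    have p1 := Int.emod_nonneg (B a / 2 ^ v) (b := 2 ^ g) (by positivity)
    have p3 := Int.emod_lt_of_pos (B a / 2 ^ v) (b := 2 ^ g) (by positivity)
    rw [Finset.mem_Ico]; constructor <;> linarith

end Blocks

section Growth

lemma ent_div_anti {Ω : Type*} {S : Finset Ω} (X : Ω → ℤ) {v w : ℕ} (h : v ≤ w) :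
    ent S (fun ω => X ω / 2 ^ w) ≤ ent S (fun ω => X ω / 2 ^ v) := by
  have h1 := cent_div_pow (S := S) X h
  have h2 := cent_nonneg (S := S) (fun ω => X ω / 2 ^ v) (fun ω => X ω / 2 ^ w)
  linarith

lemma sum_sub_shift_le {H : ℕ → ℝ} (hH : Antitone H) (M μ : ℕ) :
    ∑ i ∈ Finset.range M, (H i - H (i + μ)) ≤ μ * (H 0 - H (M + μ)) := by
  have key : ∀ M : ℕ, ∑ i ∈ Finset.range M, (H i - H (i + μ)) =
      ∑ i ∈ Finset.range μ, H i - ∑ i ∈ Finset.range μ, H (M + i) := by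
    intro M
    induction M with
    | zero => simp
    | succ M ih =>
      rw [Finset.sum_range_succ, ih]
      have h1 := Finset.sum_range_succ (fun i => H (M + i)) μ
      have h2 := Finset.sum_range_succ' (fun i => H (M + i)) μ
      have h3 : ∑ i ∈ Finset.range μ, H (M + 1 + i) = ∑ i ∈ Finset.range μ, H (M + (i + 1)) :=
        Finset.sum_congr rfl fun i _ => by ring_nf
      simp only [add_zero] at h2
      rw [h3]
      linarith
  rw [key, ← Finset.sum_sub_distrib]
  refine (Finset.sum_le_card_nsmul _ _ (H 0 - H (M + μ)) fun i hi => ?_).trans_eq ?_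
  · have h1 := hH (Nat.zero_le i)
    have h2 := hH (Nat.add_le_add_left (Finset.mem_range.1 hi).le M)
    linarith
  · simp

set_option maxHeartbeats 1000000 in
lemma exists_growth_aux {α c : ℝ} (hα1 : α < 1) (hc : 0 < c) (g : ℕ) (hg : 0 < g) :
    ∃ ε > 0, ∃ m0 : ℕ, ∃ η₁ > 0, ∀ μ : ℕ, m0 ≤ g * μ → ∃ L0 : ℕ, ∀ L ≥ L0, ∀ (ΩA ΩB : Type)
      (SA : Finset ΩA) (SB : Finset ΩB) (A : ΩA → ℤ) (B : ΩB → ℤ), SA.Nonempty → SB.Nonempty →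
      (∀ b ∈ SB, 0 ≤ B b ∧ B b < 2 ^ (g * μ * L)) →
      (∀ i < μ * L, ∀ b ∈ SB, ∀ b' ∈ SB, Even (B b / 2 ^ (g * i) - B b' / 2 ^ (g * i))) →
      (∀ v, v + g * μ ≤ g * μ * L → (α - ε) * (g * μ : ℕ) ≤
        cent SA (fun a => A a / 2 ^ v) (fun a => A a / 2 ^ (v + g * μ))) →
      c * (g * μ * L : ℕ) ≤ ent SB B →
      0 < g * μ ∧ (α + η₁) * (g * μ * L : ℕ) + ent SA (fun a => A a / 2 ^ (g * μ * L)) - 2 ≤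
        ent (SA ×ˢ Fintype.piFinset fun _ : Fin (4 ^ (g * μ)) => SB)
          (fun p => A p.1 + ∑ j, B (p.2 j)) := by
  set l : ℝ := c * g / (16 * (2 ^ g + 1)) with hl
  have hg' : (0 : ℝ) < g := by exact_mod_cast hg
  have hl0 : 0 < l := by positivity
  set δ : ℝ := l * (c * g / 16) with hδ
  have hδ0 : 0 < δ := by positivity
  set C : ℝ := 3 + 2 ^ g - Real.logb 2 δ / 2 with hC
  have hα : 0 < 1 - α := by linarith
  set ε : ℝ := c * (1 - α) / 24 with hε
  have hε0 : 0 < ε := by positivity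
  refine ⟨ε, hε0, ⌈4 / ε + 2 * |C| / (1 - α)⌉₊, c * (1 - α) / 8, by positivity, fun μ hμ => ?_⟩
  set m := g * μ with hm
  have hm1 : 4 / ε + 2 * |C| / (1 - α) ≤ m := (Nat.le_ceil _).trans (by exact_mod_cast hμ)
  have hm2 : 4 ≤ ε * m := by
    have : 0 ≤ 2 * |C| / (1 - α) := by positivity
    have : 4 / ε ≤ m := by linarith
    rwa [div_le_iff₀' hε0] at this
  have hm3 : 2 * C ≤ (1 - α) * m := by
    have : 0 ≤ 4 / ε := by positivity
    have : 2 * |C| / (1 - α) ≤ m := by linarith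
    rw [div_le_iff₀' hα] at this
    linarith [le_abs_self C]
  have hm0' : (0 : ℝ) < m := by by_contra! h; nlinarith
  have hm0 : 0 < m := by exact_mod_cast hm0'
  have hμ0 : 0 < μ := Nat.pos_of_mul_pos_left hm0
  have hμ0' : (0 : ℝ) < μ := by exact_mod_cast hμ0
  refine ⟨max 1 ⌈1 / ε + 4 / c⌉₊, fun L hL ΩA ΩB SA SB A B hA hB hB0 hpar hblock hcB => ⟨hm0, ?_⟩⟩
  have hL1 : 1 ≤ L := (le_max_left _ _).trans hL
  have hL2 : 1 / ε + 4 / c ≤ L :=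
    (Nat.le_ceil _).trans (by exact_mod_cast (le_max_right _ _).trans hL)
  have hL3 : 1 ≤ ε * L := by
    have : 0 ≤ 4 / c := by positivity
    have : 1 / ε ≤ L := by linarith
    rwa [div_le_iff₀' hε0] at this
  have hL4 : 4 ≤ c * L := by
    have : 0 ≤ 1 / ε := by positivity
    have : 4 / c ≤ L := by linarith
    rwa [div_le_iff₀' hc] at this
  obtain ⟨L', rfl⟩ : ∃ L', L = L' + 1 := ⟨L - 1, by omega⟩
  set k := 4 ^ m with hk
  set P := Fintype.piFinset fun _ : Fin k => SB with hP
  have hPne : P.Nonempty := Fintype.piFinset_nonempty.2 fun _ => hB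
  set Sm : ΩA × (Fin k → ΩB) → ℤ := fun p => A p.1 + ∑ j, B (p.2 j) with hSm
  set H : ℕ → ℝ := fun i => ent (SA ×ˢ P) (fun p => Sm p / 2 ^ (g * i)) with hH
  have hHanti : Antitone H := fun i j hij => ent_div_anti Sm (Nat.mul_le_mul_left g hij)
  set M := μ * L' with hM
  set act : Finset ℕ := (Finset.range M).filter fun i => δ ≤ defect SB B (g * i) g with hact
  have hrange : ∀ i < M, g * i + m ≤ m * (L' + 1) := by
    intro i hi
    rw [hm, mul_assoc, ← mul_add]
    refine Nat.mul_le_mul_left g ?_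
    rw [mul_add, mul_one, ← hM]; omega
  -- entropy of `B` forces many active levels
  have hcount : c * m * (L' + 1) / (2 * g) ≤ act.card := by
    set h : ℕ → ℝ := fun i => ent SB (fun b => B b / 2 ^ (g * i)) with hh
    have t1 : ∑ i ∈ Finset.range (μ * (L' + 1)), (h i - h (i + 1)) = ent SB B := by
      rw [Finset.sum_range_sub']
      have : h (μ * (L' + 1)) = 0 := by
        rw [← ent_const (S := SB) (0 : ℤ)]
        refine ent_congr fun a ha b hb => ?_
        rw [← mul_assoc, ← hm, Int.ediv_eq_zero_of_lt (hB0 a ha).1 (hB0 a ha).2,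
          Int.ediv_eq_zero_of_lt (hB0 b hb).1 (hB0 b hb).2]
      rw [this]; simp [hh]
    have lev : ∀ i, h i - h (i + 1) =
        cent SB (fun ω => B ω / 2 ^ (g * i)) (fun ω => B ω / 2 ^ (g * i + g)) := by
      intro i
      rw [cent_div_pow B (Nat.le_add_right _ _)]; rfl
    have t2 : ∀ i, h i - h (i + 1) ≤ g := fun i => by rw [lev]; exact cent_level_le_log _ _ _
    have t3 : ∀ i, ¬ δ ≤ defect SB B (g * i) g → h i - h (i + 1) ≤ c * g / 4 := by
      intro i hi
      rw [lev]
      refine (cent_level_le hB B _ _ hl0).trans ?_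
      have e1 : defect SB B (g * i) g / l ≤ c * g / 16 := by
        rw [div_le_iff₀' hl0]; exact (not_le.1 hi).le
      have e2 : l * (2 ^ g + 1) = c * g / 16 := by rw [hl]; field_simp
      rw [e2]; linarith
    rw [mul_add μ L' 1, mul_one, ← hM, Finset.sum_range_add,
      ← Finset.sum_filter_add_sum_filter_not (Finset.range M)
        (fun i => δ ≤ defect SB B (g * i) g)] at t1
    have u1 := Finset.sum_le_card_nsmul act (fun i => h i - h (i + 1)) g fun i _ => t2 i
    have u2 := Finset.sum_le_card_nsmul
      ((Finset.range M).filter fun i => ¬ δ ≤ defect SB B (g * i) g)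
      (fun i => h i - h (i + 1)) (c * g / 4) fun i hi => t3 i (Finset.mem_filter.1 hi).2
    have u3 := Finset.sum_le_card_nsmul (Finset.range μ)
      (fun i => h (M + i) - h (M + i + 1)) g fun i _ => t2 _
    have u4 : (((Finset.range M).filter fun i => ¬ δ ≤ defect SB B (g * i) g).card : ℝ) ≤
        μ * (L' + 1) := by
      have := Finset.card_filter_le (Finset.range M) fun i => ¬ δ ≤ defect SB B (g * i) g
      rw [Finset.card_range] at this
      have h2 : M ≤ μ * (L' + 1) := by rw [hM]; gcongr; omega
      exact_mod_cast this.trans h2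
    rw [nsmul_eq_mul] at u1 u2 u3
    rw [Finset.card_range] at u3
    have u5 : (((Finset.range M).filter fun i => ¬ δ ≤ defect SB B (g * i) g).card : ℝ) *
        (c * g / 4) ≤ μ * (L' + 1) * (c * g / 4) := by gcongr
    have hmg : (m : ℝ) = g * μ := by rw [hm]; push_cast; rfl
    rw [div_le_iff₀ (by positivity)]
    push_cast at hcB hL4
    rw [hmg] at *
    nlinarith [mul_le_mul_of_nonneg_left hL4 (mul_pos hg' hμ0').le]
  have hw1 : ∀ i < M, (α - ε) * m - 4 ≤ H i - H (i + μ) := by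
    intro i hi
    refine (sub_le_sub_right (hblock (g * i) (hrange i hi)) 4).trans ?_
    refine (cent_block_add_ge hA hPne A (fun b => ∑ j, B (b j)) (Nat.le_add_right _ _)).trans_eq ?_
    rw [cent_div_pow _ (Nat.le_add_right _ _)]
    simp only [hH, hSm, mul_add, hm]
  have hw2 : ∀ i ∈ act, m - C ≤ H i - H (i + μ) := by
    intro i hi
    rw [hact, Finset.mem_filter, Finset.mem_range] at hi
    have hi' : i < μ * (L' + 1) := by rw [mul_add, ← hM]; omega
    have := cent_active_ge hA hB A B (g * i) g m (hpar i hi') hδ0 hi.2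
    rw [cent_div_pow (fun p : ΩA × (Fin (4 ^ m) → ΩB) => A p.1 + ∑ j, B (p.2 j))
      (Nat.le_add_right _ _)] at this
    simp only [hH, hSm, mul_add]
    rw [hC]
    linarith
  have hsum : M * ((α - ε) * m - 4) + act.card * ((1 - α) * m / 2) ≤
      ∑ i ∈ Finset.range M, (H i - H (i + μ)) := by
    have e1 : (act.card : ℝ) * ((1 - α) * m / 2) =
        ∑ i ∈ Finset.range M, if δ ≤ defect SB B (g * i) g then (1 - α) * m / 2 else 0 := by
      rw [← Finset.sum_filter, Finset.sum_const, nsmul_eq_mul]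
    have e2 : M * ((α - ε) * m - 4) = ∑ i ∈ Finset.range M, ((α - ε) * m - 4) := by
      rw [Finset.sum_const, Finset.card_range, nsmul_eq_mul]
    rw [e1, e2, ← Finset.sum_add_distrib]
    refine Finset.sum_le_sum fun i hi => ?_
    have hi' := Finset.mem_range.1 hi
    split_ifs with h
    · have := hw2 i (Finset.mem_filter.2 ⟨hi, h⟩)
      have : 0 ≤ ε * m := by positivity
      linarith
    · simpa using hw1 i hi'
  have hfin := hsum.trans (sum_sub_shift_le hHanti M μ)
  have hMμ : M + μ = μ * (L' + 1) := by rw [hM]; ring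
  have hH0 : H 0 = ent (SA ×ˢ P) Sm := by simp [hH]
  have hHr : ent SA (fun a => A a / 2 ^ (m * (L' + 1))) - 2 ≤ H (M + μ) := by
    have := ent_add_ge hA hPne A (fun b => ∑ j, B (b j)) (m * (L' + 1))
    refine this.trans_eq ?_
    simp only [hH, hSm]
    rw [hMμ, ← mul_assoc, ← hm]
  have hact2 : μ * (c * (1 - α) / 4 * (m * (L' + 1))) ≤ act.card * ((1 - α) * m / 2) := by
    have : (c * m * (L' + 1) / (2 * g)) * ((1 - α) * m / 2) ≤ act.card * ((1 - α) * m / 2) := by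
      gcongr
    refine le_trans (le_of_eq ?_) this
    have hmg : (m : ℝ) = g * μ := by rw [hm]; push_cast; rfl
    field_simp; rw [hmg]; ring
  have hM' : (M : ℝ) = μ * L' := by rw [hM]; push_cast; rfl
  rw [hM'] at hfin
  have hdiv : L' * ((α - ε) * m - 4) + c * (1 - α) / 4 * (m * (L' + 1)) ≤ H 0 - H (M + μ) := by
    refine le_of_mul_le_mul_left ?_ hμ0'
    linarith
  push_cast at hL3 ⊢
  have hc24 : c * (1 - α) = 24 * ε := by rw [hε]; ring
  have x1 : m * α ≤ m * (ε * (L' + 1)) := by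
    gcongr; linarith
  have x2 : (L' : ℝ) * 4 ≤ L' * (ε * m) := by gcongr
  have x3 : 0 ≤ ε * m := by positivity
  rw [hc24] at hdiv ⊢
  rw [← hH0]
  nlinarith

/-- Adding a variable with positive entropy to one with near-uniform block entropies `α < 1`
increases the entropy. -/
theorem exists_growth {α c : ℝ} (hα1 : α < 1) (hc : 0 < c) (g : ℕ) (hg : 0 < g) :
    ∃ ε > 0, ∃ m0 : ℕ, ∀ μ : ℕ, m0 ≤ g * μ → 0 < g * μ → ∃ η > 0, ∃ L0 : ℕ, ∀ L ≥ L0,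
      ∀ (ΩA ΩB : Type)
      (SA : Finset ΩA) (SB : Finset ΩB) (A : ΩA → ℤ) (B : ΩB → ℤ), SA.Nonempty → SB.Nonempty →
      (∀ b ∈ SB, 0 ≤ B b ∧ B b < 2 ^ (g * μ * L)) →
      (∀ i < μ * L, ∀ b ∈ SB, ∀ b' ∈ SB, Even (B b / 2 ^ (g * i) - B b' / 2 ^ (g * i))) →
      (∀ v, v + g * μ ≤ g * μ * L → (α - ε) * (g * μ : ℕ) ≤
        cent SA (fun a => A a / 2 ^ v) (fun a => A a / 2 ^ (v + g * μ))) →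
      (α - η) * (g * μ * L : ℕ) ≤ cent SA A (fun a => A a / 2 ^ (g * μ * L)) →
      c * (g * μ * L : ℕ) ≤ ent SB B →
      (α + η) * (g * μ * L : ℕ) ≤ cent (SA ×ˢ SB) (fun p => A p.1 + B p.2)
        (fun p => (A p.1 + B p.2) / 2 ^ (g * μ * L)) := by
  obtain ⟨ε, hε, m0, η₁, hη₁, H⟩ := exists_growth_aux hα1 hc g hg
  refine ⟨ε, hε, m0, fun μ hμ hm0 => ?_⟩
  obtain ⟨L0, H⟩ := H μ hμ
  set m := g * μ with hm
  have hm1 : (1 : ℝ) ≤ m := by exact_mod_cast hm0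
  set k := 4 ^ m with hk
  have hk1 : (1 : ℝ) ≤ k := by exact_mod_cast Nat.one_le_pow _ _ (by norm_num)
  refine ⟨η₁ / (4 * k), by positivity, max L0 ⌈8 * k / η₁⌉₊,
    fun L hL ΩA ΩB SA SB A B hA hB hB0 hpar hblock hA2 hcB => ?_⟩
  obtain ⟨_, h1⟩ := H L ((le_max_left _ _).trans hL) ΩA ΩB SA SB A B hA hB hB0 hpar hblock hcB
  have hL2 : 8 * k / η₁ ≤ L :=
    (Nat.le_ceil _).trans (by exact_mod_cast (le_max_right _ _).trans hL)
  set r := m * L with hr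
  have hr' : 8 * k ≤ η₁ * r := by
    rw [div_le_iff₀' hη₁] at hL2
    refine hL2.trans ?_
    rw [hr]; push_cast
    have : (0 : ℝ) ≤ L := by positivity
    gcongr
    nlinarith
  have h2 := ent_add_sum_le hA hB A B k
  have e0 : ∀ {Ω : Type} {S : Finset Ω} (X : Ω → ℤ), cent S X (fun a => X a / 2 ^ r) =
      ent S X - ent S (fun a => X a / 2 ^ r) := by
    intro Ω S X
    have := cent_div_pow (S := S) X (Nat.zero_le r)
    simpa using this
  rw [e0] at hA2 ⊢
  have h3 : ent (SA ×ˢ SB) (fun p => (A p.1 + B p.2) / 2 ^ r) ≤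
      ent SA (fun a => A a / 2 ^ r) + 2 := by
    rw [← ent_fst hB (fun a => A a / 2 ^ r)]
    refine ent_le_of_close _ _ 0 fun p hp => ?_
    have hb := hB0 p.2 (Finset.mem_product.1 hp).2
    have := ediv_add_sub (A p.1) (B p.2) (N := 2 ^ r) (by positivity)
    rwa [Int.ediv_eq_zero_of_lt hb.1 hb.2] at this
  set E := ent (SA ×ˢ SB) (fun p => A p.1 + B p.2)
  set EA := ent SA A
  set EA' := ent SA (fun a => A a / 2 ^ r)
  have h4 : (α + η₁) * r + EA' - 2 ≤ EA + k * (E - EA) := h1.trans h2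
  have hη : η₁ / (4 * k) * k = η₁ / 4 := by field_simp
  set η := η₁ / (4 * k) with hηd
  have hr0 : (0 : ℝ) ≤ r := by positivity
  -- multiply the goal by `k`
  have hk0 : (0 : ℝ) < k := by linarith
  have goal : k * ((α + η) * r) ≤ k * (E - EA' - 2) := by
    have a1 : (k - 1) * ((α - η) * r) ≤ (k - 1) * (EA - EA') := by
      gcongr
    have a2 : k * η * r = η₁ / 4 * r := by rw [mul_comm (k : ℝ), hη]
    have a3 : 0 ≤ η * r := by positivity
    nlinarith
  have := le_of_mul_le_mul_left goal hk0
  linarith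

end Growth

section Words

variable {W : Type*} (ψ : W → ℝ → ℝ)

lemma compWord_append (u v : List W) (x : ℝ) :
    compWord ψ (u ++ v) x = compWord ψ u (compWord ψ v x) := by
  induction u with
  | nil => rfl
  | cons a u ih => simp [compWord, ih]

variable {ψ} in
lemma mapsTo_compWord (h : ∀ a, MapsTo (ψ a) unitI unitI) (u : List W) :
    MapsTo (compWord ψ u) unitI unitI := by
  induction u with
  | nil => exact fun x hx => hx
  | cons a u ih => exact (h a).comp ih

variable [Fintype W]

variable (W) in
/-- The words of length `n`. -/
def words (n : ℕ) : Finset (List W) := (List.finite_length_eq W n).toFinset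

@[simp] lemma mem_words {n : ℕ} {u : List W} : u ∈ words W n ↔ u.length = n := by
  simp [words]

lemma words_nonempty [Nonempty W] (n : ℕ) : (words W n).Nonempty :=
  ⟨List.replicate n (Classical.arbitrary W), by simp⟩

lemma bijOn_append (a b : ℕ) :
    Set.BijOn (fun p : List W × List W => p.1 ++ p.2)
      ((words W a ×ˢ words W b : Finset _) : Set _) (words W (a + b) : Set (List W)) := by
  refine ⟨fun p hp => ?_, fun p hp q hq h => ?_, fun u hu => ?_⟩
  · simp at hp ⊢; omega
  · simp at hp hq
    have := List.append_inj h (by omega)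
    exact Prod.ext this.1 this.2
  · simp at hu
    exact ⟨(u.take a, u.drop a), by simp [hu], List.take_append_drop a u⟩

lemma bijOn_cons_words (n : ℕ) :
    Set.BijOn (fun p : W × List W => p.1 :: p.2)
      (((Finset.univ : Finset W) ×ˢ words W n : Finset _) : Set _)
      (words W (n + 1) : Set (List W)) := by
  refine ⟨fun p hp => ?_, fun p hp q hq h => ?_, fun u hu => ?_⟩
  · simp at hp ⊢; omega
  · exact Prod.ext (List.cons.inj h).1 (List.cons.inj h).2
  · simp at hu
    match u, hu with
    | a :: v, hu => exact ⟨(a, v), by simpa using hu, rfl⟩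

lemma card_words (n : ℕ) : (words W n).card = Fintype.card W ^ n := by
  induction n with
  | zero =>
    have : words W 0 = {[]} := by ext u; simp
    simp [this]
  | succ n ih =>
    have h := bijOn_cons_words (W := W) n
    rw [← Finset.card_nbij (fun p : W × List W => p.1 :: p.2)
      (fun p hp => h.mapsTo hp) h.injOn h.surjOn, Finset.card_product, ih, Finset.card_univ,
      pow_succ, mul_comm]

end Words

section Floor

variable {Ω γ : Type*} {S : Finset Ω}

lemma abs_floor_sub_le {x y d : ℝ} (h : |x - y| ≤ d) : (|⌊x⌋ - ⌊y⌋| : ℤ) ≤ ⌊d⌋₊ + 1 := by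
  have hd : 0 ≤ d := (abs_nonneg _).trans h
  have h1 := Int.floor_le x; have h2 := Int.lt_floor_add_one x
  have h3 := Int.floor_le y; have h4 := Int.lt_floor_add_one y
  have h5 := Nat.lt_floor_add_one d
  rw [abs_le] at h
  have a1 : ((⌊x⌋ - ⌊y⌋ : ℤ) : ℝ) < ((⌊d⌋₊ + 2 : ℤ) : ℝ) := by push_cast; linarith [h.2]
  have a2 : ((⌊y⌋ - ⌊x⌋ : ℤ) : ℝ) < ((⌊d⌋₊ + 2 : ℤ) : ℝ) := by push_cast; linarith [h.1]
  have b1 : ⌊x⌋ - ⌊y⌋ < (⌊d⌋₊ + 2 : ℤ) := by exact_mod_cast a1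
  have b2 : ⌊y⌋ - ⌊x⌋ < (⌊d⌋₊ + 2 : ℤ) := by exact_mod_cast a2
  rw [abs_le]; constructor <;> omega

lemma cent_floor_le {x : Ω → ℝ} {Y : Ω → γ} {d : ℝ} (hd : 0 ≤ d)
    (h : ∀ a ∈ S, ∀ b ∈ S, Y a = Y b → |x a - x b| ≤ d) :
    cent S (fun ω => ⌊x ω⌋) Y ≤ Real.logb 2 (2 * d + 3) := by
  refine (cent_int_le (⌊d⌋₊ + 1) fun a ha b hb hab => ?_).trans ?_
  · exact_mod_cast abs_floor_sub_le (h a ha b hb hab)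
  · have := Nat.floor_le hd
    refine Real.logb_le_logb_of_le (by norm_num) (by positivity) ?_
    push_cast; linarith

lemma abs_sub_lt_one_of_floor_eq {x y : ℝ} (h : ⌊x⌋ = ⌊y⌋) : |x - y| < 1 :=
  Int.abs_sub_lt_one_of_floor_eq_floor h

lemma ent_floor_le {x y : Ω → ℝ} {d : ℝ} (hd : 0 ≤ d) (h : ∀ a ∈ S, |x a - y a| ≤ d) :
    ent S (fun ω => ⌊x ω⌋) ≤ ent S (fun ω => ⌊y ω⌋) + Real.logb 2 (4 * d + 5) := by
  refine (ent_le_ent_add_cent _ (fun ω => ⌊y ω⌋)).trans ?_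
  have := cent_floor_le (S := S) (x := x) (Y := fun ω => ⌊y ω⌋) (d := 2 * d + 1) (by linarith)
    fun a ha b hb hab => by
      have h1 := abs_le.1 (h a ha); have h2 := abs_le.1 (h b hb)
      have h3 := abs_lt.1 (abs_sub_lt_one_of_floor_eq hab)
      rw [abs_le]; constructor <;> linarith [h1.1, h1.2, h2.1, h2.2, h3.1, h3.2]
  rw [show 2 * (2 * d + 1) + 3 = 4 * d + 5 by ring] at this
  linarith

lemma floor_div_pow (x : ℝ) (m : ℕ) : ⌊x⌋ / 2 ^ m = ⌊x / 2 ^ m⌋ := by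
  have := Int.floor_div_cast_of_nonneg (k := ℝ) (n := (2 : ℤ) ^ m) (by positivity) x
  push_cast at this
  exact this.symm

end Floor

section System

/-- Bi-Lipschitz bounds and bounded distortion for an iterated function system on `[0,1]`. -/
structure ConfSys {W : Type} (ψ : W → ℝ → ℝ) (t T : ℕ) (D : ℝ) : Prop where
  maps : ∀ a, MapsTo (ψ a) unitI unitI
  up : ∀ a, ∀ x ∈ unitI, ∀ y ∈ unitI, |ψ a x - ψ a y| ≤ (1 / 2) ^ t * |x - y|
  lo : ∀ a, ∀ x ∈ unitI, ∀ y ∈ unitI, (1 / 2) ^ T * |x - y| ≤ |ψ a x - ψ a y|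
  dist : ∀ w : List W, ∀ x ∈ unitI, ∀ y ∈ unitI,
    |compWord ψ w 0 - compWord ψ w 1| * |x - y| ≤ D * |compWord ψ w x - compWord ψ w y|
  dist_up : ∀ w : List W, ∀ x ∈ unitI, ∀ y ∈ unitI,
    |compWord ψ w x - compWord ψ w y| ≤ D * |compWord ψ w 0 - compWord ψ w 1| * |x - y|
  one_le_D : 1 ≤ D
  one_le_t : 1 ≤ t

variable {W : Type} {ψ : W → ℝ → ℝ} {t T : ℕ} {D : ℝ}

namespace ConfSys

variable (hS : ConfSys ψ t T D)

include hS

lemma mapsTo (w : List W) : MapsTo (compWord ψ w) unitI unitI := mapsTo_compWord hS.maps w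

lemma word_up (w : List W) {x y : ℝ} (hx : x ∈ unitI) (hy : y ∈ unitI) :
    |compWord ψ w x - compWord ψ w y| ≤ (1 / 2) ^ (t * w.length) * |x - y| := by
  induction w with
  | nil => simp [compWord]
  | cons a w ih =>
    refine (hS.up a _ (hS.mapsTo w hx) _ (hS.mapsTo w hy)).trans ?_
    rw [List.length_cons, mul_add, mul_one, pow_add, mul_comm ((1 / 2 : ℝ) ^ (t * w.length)),
      mul_assoc]
    gcongr

lemma word_lo (w : List W) {x y : ℝ} (hx : x ∈ unitI) (hy : y ∈ unitI) :
    (1 / 2) ^ (T * w.length) * |x - y| ≤ |compWord ψ w x - compWord ψ w y| := by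
  induction w with
  | nil => simp [compWord]
  | cons a w ih =>
    refine le_trans ?_ (hS.lo a _ (hS.mapsTo w hx) _ (hS.mapsTo w hy))
    rw [List.length_cons, mul_add, mul_one, pow_add, mul_comm ((1 / 2 : ℝ) ^ (T * w.length)),
      mul_assoc]
    gcongr

end ConfSys

lemma abs_sub_le_one_of_mem {x y : ℝ} (hx : x ∈ unitI) (hy : y ∈ unitI) : |x - y| ≤ 1 := by
  rw [unitI, Set.mem_Icc] at hx hy
  rw [abs_le]; constructor <;> linarith [hx.1, hx.2, hy.1, hy.2]

lemma zero_mem_unitI : (0 : ℝ) ∈ unitI := by simp [unitI]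
lemma one_mem_unitI : (1 : ℝ) ∈ unitI := by simp [unitI]

/-- The diameter of the image of `[0,1]` under the map of a word. -/
def rho (ψ : W → ℝ → ℝ) (w : List W) : ℝ := |compWord ψ w 0 - compWord ψ w 1|

namespace ConfSys

variable (hS : ConfSys ψ t T D)

include hS

lemma rho_le (w : List W) : rho ψ w ≤ (1 / 2) ^ w.length := by
  refine (hS.word_up w zero_mem_unitI one_mem_unitI).trans ?_
  norm_num
  exact pow_le_pow_of_le_one (by norm_num) (by norm_num)
    (Nat.le_mul_of_pos_left _ hS.one_le_t)

lemma rho_ge (w : List W) : (1 / 2) ^ (T * w.length) ≤ rho ψ w := by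
  have := hS.word_lo w zero_mem_unitI one_mem_unitI
  simpa [rho] using this

lemma rho_append (w : List W) (a : W) : (1 / 2) ^ T / D * rho ψ w ≤ rho ψ (w ++ [a]) := by
  have hD : 0 < D := by linarith [hS.one_le_D]
  have h1 := hS.dist w _ (hS.maps a zero_mem_unitI) _ (hS.maps a one_mem_unitI)
  have h2 := hS.lo a _ zero_mem_unitI _ one_mem_unitI
  have h3 : rho ψ (w ++ [a]) = |compWord ψ w (ψ a 0) - compWord ψ w (ψ a 1)| := by
    simp [rho, compWord_append, compWord]
  rw [h3, div_mul_eq_mul_div, div_le_iff₀' hD]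
  refine le_trans ?_ h1
  rw [mul_comm]
  simp only [zero_sub, abs_neg, abs_one, mul_one] at h2
  exact mul_le_mul_of_nonneg_left h2 (abs_nonneg _)

end ConfSys

variable [Fintype W]

/-- Entropy at scale `2^{-m}` of the orbit of `x₀` under the words of length `m`. -/
def hh (ψ : W → ℝ → ℝ) (x₀ : ℝ) (m : ℕ) : ℝ :=
  ent (words W m) (fun ω => ⌊2 ^ m * compWord ψ ω x₀⌋)

variable [Nonempty W]

namespace ConfSys

variable (hS : ConfSys ψ t T D)

include hS

/-- Cells at scale `2^{-m}` only depend on a prefix. -/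
lemma abs_ent_prefix {x₀ x₁ : ℝ} (h₀ : x₀ ∈ unitI) (h₁ : x₁ ∈ unitI) {n n' m : ℕ}
    (hm : m ≤ t * n) :
    |ent (words W (n + n')) (fun ω => ⌊2 ^ m * compWord ψ ω x₀⌋) -
      ent (words W n) (fun ω => ⌊2 ^ m * compWord ψ ω x₁⌋)| ≤ 4 := by
  rw [← ent_bij (bijOn_append n n') (fun ω => ⌊2 ^ m * compWord ψ ω x₀⌋),
    ← ent_fst (words_nonempty (W := W) n') (fun ω => ⌊2 ^ m * compWord ψ ω x₁⌋)]
  have key : ∀ p ∈ words W n ×ˢ words W n',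
      |2 ^ m * compWord ψ (p.1 ++ p.2) x₀ - 2 ^ m * compWord ψ p.1 x₁| ≤ 1 := by
    intro p hp
    have hp1 : p.1.length = n := by simpa using (Finset.mem_product.1 hp).1
    rw [compWord_append, ← mul_sub, abs_mul, abs_of_pos (by positivity)]
    have a1 := hS.word_up p.1 (hS.mapsTo p.2 h₀) h₁
    have a2 := abs_sub_le_one_of_mem (hS.mapsTo p.2 h₀) h₁
    calc _ ≤ 2 ^ m * ((1 / 2 : ℝ) ^ m * 1) := by
          gcongr
          refine a1.trans ?_
          rw [hp1]
          gcongr ?_ * ?_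
          exact pow_le_pow_of_le_one (by norm_num) (by norm_num) hm
      _ = 1 := by rw [mul_one, ← mul_pow]; norm_num
  have h9 : Real.logb 2 (4 * 1 + 5) ≤ 4 := by
    rw [Real.logb_le_iff_le_rpow (by norm_num) (by norm_num)]; norm_num
  have e1 := ent_floor_le zero_le_one key
  have e2 := ent_floor_le zero_le_one (S := words W n ×ˢ words W n')
    (x := fun p => 2 ^ m * compWord ψ p.1 x₁) (y := fun p => 2 ^ m * compWord ψ (p.1 ++ p.2) x₀)
    fun p hp => by rw [abs_sub_comm]; exact key p hp
  rw [abs_le]; constructor <;> linarith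

lemma abs_ent_sub_hh {x₀ : ℝ} (h₀ : x₀ ∈ unitI) {M m : ℕ} (hm : m ≤ M) :
    |ent (words W M) (fun ω => ⌊2 ^ m * compWord ψ ω x₀⌋) - hh ψ x₀ m| ≤ 4 := by
  have := hS.abs_ent_prefix h₀ h₀ (n := m) (n' := M - m) (m := m)
    (Nat.le_mul_of_pos_left _ hS.one_le_t)
  rwa [Nat.add_sub_cancel' hm] at this

lemma block_base {x₀ : ℝ} (h₀ : x₀ ∈ unitI) {m M : ℕ} (hM : m ≤ M) (w : List W) (e b : ℝ)
    (h1 : (1 / 2) ^ T / D * 2 ^ m ≤ |e| * rho ψ w) (h2 : |e| * rho ψ w ≤ 2 ^ m) :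
    hh ψ x₀ m - (4 + Real.logb 2 (2 * (D * D * 2 ^ T) + 3) + Real.logb 2 (2 * D + 3)) ≤
      cent (words W M) (fun ω => ⌊e * compWord ψ w (compWord ψ ω x₀) + b⌋)
        (fun ω => ⌊e * compWord ψ w (compWord ψ ω x₀) + b⌋ / 2 ^ m) := by
  have hD : 0 < D := by linarith [hS.one_le_D]
  set x : List W → ℝ := fun ω => e * compWord ψ w (compWord ψ ω x₀) + b with hx
  have a1 := (abs_le.1 (hS.abs_ent_sub_hh h₀ hM)).1
  have e0 : 0 < |e| * rho ψ w := lt_of_lt_of_le (by positivity) h1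
  have a2 : cent (words W M) (fun ω => ⌊2 ^ m * compWord ψ ω x₀⌋) (fun ω => ⌊x ω⌋) ≤
      Real.logb 2 (2 * (D * D * 2 ^ T) + 3) := by
    refine cent_floor_le (by positivity) fun u _ v _ huv => ?_
    have b1 := abs_sub_lt_one_of_floor_eq huv
    simp only [hx, add_sub_add_right_eq_sub] at b1
    rw [← mul_sub, abs_mul] at b1 ⊢
    rw [abs_of_pos (by positivity : (0 : ℝ) < 2 ^ m)]
    have b2 := hS.dist w _ (hS.mapsTo u h₀) _ (hS.mapsTo v h₀)
    change rho ψ w * _ ≤ _ at b2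
    refine le_of_mul_le_mul_left ?_ (by positivity : 0 < (1 / 2 : ℝ) ^ T / D)
    calc _ = (1 / 2) ^ T / D * 2 ^ m * |compWord ψ u x₀ - compWord ψ v x₀| := by ring
      _ ≤ |e| * rho ψ w * |compWord ψ u x₀ - compWord ψ v x₀| := by gcongr
      _ ≤ D * (|e| * |compWord ψ w (compWord ψ u x₀) - compWord ψ w (compWord ψ v x₀)|) := by
        have := mul_le_mul_of_nonneg_left b2 (abs_nonneg e)
        linarith
      _ ≤ D * 1 := by gcongr
      _ = _ := by
        rw [one_div, inv_pow]; field_simp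
  have a3 : ent (words W M) (fun ω => ⌊x ω⌋ / 2 ^ m) ≤ Real.logb 2 (2 * D + 3) := by
    simp only [floor_div_pow]
    refine le_trans ?_ (cent_floor_le (S := words W M) (x := fun ω => x ω / 2 ^ m)
      (Y := fun _ => ()) hD.le fun u _ v _ _ => ?_)
    · have := ent_le_ent_add_cent (S := words W M) (fun ω => ⌊x ω / 2 ^ m⌋) (fun _ => ())
      rwa [ent_const, zero_add] at this
    · simp only [hx]
      rw [← sub_div, add_sub_add_right_eq_sub, ← mul_sub, abs_div, abs_mul,
        abs_of_pos (by positivity : (0 : ℝ) < 2 ^ m), div_le_iff₀ (by positivity)]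
      have c1 := hS.dist_up w _ (hS.mapsTo u h₀) _ (hS.mapsTo v h₀)
      have c2 := abs_sub_le_one_of_mem (hS.mapsTo u h₀) (hS.mapsTo v h₀)
      have c3 : 0 ≤ rho ψ w := abs_nonneg _
      change _ ≤ D * rho ψ w * _ at c1
      calc _ ≤ |e| * (D * rho ψ w * 1) := by gcongr; exact c1.trans (by gcongr)
        _ = D * (|e| * rho ψ w) := by ring
        _ ≤ D * 2 ^ m := by gcongr
  have a4 : cent (words W M) (fun ω => ⌊x ω⌋) (fun ω => ⌊x ω⌋ / 2 ^ m) =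
      ent (words W M) (fun ω => ⌊x ω⌋) - ent (words W M) (fun ω => ⌊x ω⌋ / 2 ^ m) := by
    have := cent_div_pow (S := words W M) (fun ω => ⌊x ω⌋) (Nat.zero_le m)
    simpa using this
  have a5 := ent_le_ent_add_cent (S := words W M) (fun ω => ⌊2 ^ m * compWord ψ ω x₀⌋)
    (fun ω => ⌊x ω⌋)
  rw [a4]
  linarith

end ConfSys
end System

namespace ConfSys

variable {W : Type} {ψ : W → ℝ → ℝ} {t T : ℕ} {D : ℝ} [Fintype W] [Nonempty W]

/-- The additive error of block entropy estimates. -/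
def blockErr (T : ℕ) (D : ℝ) : ℝ :=
  4 + Real.logb 2 (2 * (D * D * 2 ^ T) + 3) + Real.logb 2 (2 * D + 3)

lemma block_ge_aux (hS : ConfSys ψ t T D) {x₀ : ℝ} (h₀ : x₀ ∈ unitI) (m k : ℕ) :
    ∀ (w : List W) (e b : ℝ), (1 / 2) ^ T / D * 2 ^ m ≤ |e| * rho ψ w →
      |e| ≤ 2 ^ m * 2 ^ (w.length + k) →
      hh ψ x₀ m - blockErr T D ≤
        cent (words W (m + k)) (fun ω => ⌊e * compWord ψ w (compWord ψ ω x₀) + b⌋)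
        (fun ω => ⌊e * compWord ψ w (compWord ψ ω x₀) + b⌋ / 2 ^ m) := by
  have hD : 0 < D := by linarith [hS.one_le_D]
  induction k with
  | zero =>
    intro w e b h1 h2
    refine hS.block_base h₀ le_rfl w e b h1 ?_
    calc |e| * rho ψ w ≤ 2 ^ m * 2 ^ (w.length + 0) * (1 / 2) ^ w.length :=
          mul_le_mul h2 (hS.rho_le w) (abs_nonneg _) (by positivity)
      _ = 2 ^ m := by rw [add_zero, mul_assoc, ← mul_pow]; norm_num
  | succ k ih =>
    intro w e b h1 h2
    by_cases h3 : |e| * rho ψ w ≤ 2 ^ m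
    · exact hS.block_base h₀ (by omega) w e b h1 h3
    push Not at h3
    set F : List W → ℤ := fun ω => ⌊e * compWord ψ w (compWord ψ ω x₀) + b⌋ with hF
    rw [← add_assoc, ← cent_bij (bijOn_cons_words (W := W) (m + k)) F (fun ω => F ω / 2 ^ m)]
    refine le_trans ?_ (cent_anti_right
      (Y' := fun p : W × List W => (p.1, F (p.1 :: p.2) / 2 ^ m)) (by simp +contextual))
    rw [cent_prod_fst_pair (words_nonempty _)]
    refine le_avg Finset.univ_nonempty fun a _ => ?_
    have := ih (w ++ [a]) e b ?_ ?_
    · simpa [compWord_append, compWord, hF] using this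
    · calc (1 / 2) ^ T / D * 2 ^ m ≤ (1 / 2) ^ T / D * (|e| * rho ψ w) := by gcongr
        _ = |e| * ((1 / 2) ^ T / D * rho ψ w) := by ring
        _ ≤ _ := by gcongr; exact hS.rho_append w a
    · simpa [add_assoc, add_comm 1 k] using h2

lemma block_ge (hS : ConfSys ψ t T D) {x₀ : ℝ} (h₀ : x₀ ∈ unitI) {m M : ℕ} (hM : m ≤ M)
    (w : List W) (e b : ℝ) (h1 : (1 / 2) ^ T / D * 2 ^ m ≤ |e| * rho ψ w)
    (h2 : |e| ≤ 2 ^ (w.length + M)) :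
    hh ψ x₀ m - blockErr T D ≤
      cent (words W M) (fun ω => ⌊e * compWord ψ w (compWord ψ ω x₀) + b⌋)
        (fun ω => ⌊e * compWord ψ w (compWord ψ ω x₀) + b⌋ / 2 ^ m) := by
  obtain ⟨k, rfl⟩ := Nat.exists_eq_add_of_le hM
  refine hS.block_ge_aux h₀ m k w e b h1 ?_
  rwa [← pow_add, show m + (w.length + k) = w.length + (m + k) by omega]

lemma hh_add_ge (hS : ConfSys ψ t T D) {x₀ : ℝ} (h₀ : x₀ ∈ unitI) (m n : ℕ) :
    hh ψ x₀ m + hh ψ x₀ n - (blockErr T D + 8) ≤ hh ψ x₀ (m + n) := by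
  have hD := hS.one_le_D
  have h := hS.block_ge h₀ (m := m) (M := m + n) (by omega) [] (2 ^ (m + n)) 0 ?_ ?_
  · simp only [compWord, id, add_zero] at h
    have h1 := cent_div_pow (S := words W (m + n)) (fun ω => ⌊2 ^ (m + n) * compWord ψ ω x₀⌋)
      (Nat.zero_le m)
    simp only [pow_zero, Int.ediv_one] at h1
    rw [h1] at h
    have h2 := (abs_le.1 (hS.abs_ent_sub_hh h₀ (m := n) (M := m + n) (by omega))).1
    have h3 : (fun ω => ⌊2 ^ (m + n) * compWord ψ ω x₀⌋ / 2 ^ m) =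
        fun ω => ⌊2 ^ n * compWord ψ ω x₀⌋ := by
      funext ω
      rw [floor_div_pow]
      congr 1
      rw [pow_add]; field_simp
    rw [h3] at h
    change _ ≤ hh ψ x₀ (m + n) - _ at h
    linarith
  · have : rho ψ [] = 1 := by simp [rho, compWord]
    rw [this, mul_one, abs_of_pos (by positivity), pow_add, mul_comm]
    gcongr
    rw [div_le_iff₀ (by linarith)]
    calc (1 / 2 : ℝ) ^ T ≤ 1 := pow_le_one₀ (by norm_num) (by norm_num)
      _ ≤ 2 ^ n * D := one_le_mul_of_one_le_of_one_le (one_le_pow₀ (by norm_num)) hD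
  · rw [abs_of_pos (by positivity)]; simp

omit [Nonempty W] in
lemma hh_nonneg (x₀ : ℝ) (m : ℕ) : 0 ≤ hh ψ x₀ m := ent_nonneg _

omit [Nonempty W] in
lemma hh_le (hS : ConfSys ψ t T D) {x₀ : ℝ} (h₀ : x₀ ∈ unitI) (m : ℕ) : hh ψ x₀ m ≤ m + 1 := by
  have h := ent_le_logb (S := words W m) (X := fun ω => ⌊(2 : ℝ) ^ m * compWord ψ ω x₀⌋)
    (Finset.Icc (0 : ℤ) (2 ^ m)) (fun ω _ => ?_) (K := (2 : ℝ) ^ (m + 1)) ?_ ?_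
  · rw [Real.logb_pow, Real.logb_self_eq_one (by norm_num)] at h
    push_cast at h
    rwa [mul_one] at h
  · have := hS.mapsTo ω h₀
    simp only [unitI, Set.mem_Icc] at this
    rw [Finset.mem_Icc]
    refine ⟨Int.floor_nonneg.2 (mul_nonneg (by positivity) this.1), ?_⟩
    have h5 : (2 ^ m * compWord ψ ω x₀) ≤ 2 ^ m := mul_le_of_le_one_right (by positivity) this.2
    have := (Int.floor_le (2 ^ m * compWord ψ ω x₀)).trans h5
    exact_mod_cast this
  · simp only [Int.card_Icc, sub_zero]
    have : ((2 : ℤ) ^ m + 1).toNat = 2 ^ m + 1 := by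
      rw [show ((2 : ℤ) ^ m + 1) = ((2 ^ m + 1 : ℕ) : ℤ) by push_cast; rfl]; rfl
    rw [this]
    have : (1 : ℝ) ≤ 2 ^ m := one_le_pow₀ (by norm_num)
    push_cast; rw [pow_succ]; linarith
  · exact one_le_pow₀ (by norm_num)

/-- The entropy dimension exists, and bounds the entropy at every scale. -/
lemma exists_entropy_rate (hS : ConfSys ψ t T D) {x₀ : ℝ} (h₀ : x₀ ∈ unitI) :
    ∃ α : ℝ, 0 ≤ α ∧ α ≤ 1 ∧ Tendsto (fun m : ℕ => hh ψ x₀ m / m) atTop (𝓝 α) ∧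
      ∀ m, hh ψ x₀ m ≤ α * m + (blockErr T D + 8) := by
  set C := blockErr T D + 8 with hC
  set u : ℕ → ℝ := fun m => C - hh ψ x₀ m with hu
  have hsub : Subadditive u := fun m n => by
    have := hS.hh_add_ge h₀ m n
    simp only [hu]; linarith
  have hle : ∀ n : ℕ, hh ψ x₀ n / n ≤ 1 + 1 / n := fun n => by
    rcases Nat.eq_zero_or_pos n with rfl | hn
    · simp
    · have hn' : (0 : ℝ) < n := by exact_mod_cast hn
      rw [div_le_iff₀ hn']
      have := hS.hh_le h₀ n
      field_simp; linarith
  have hC0 : 0 ≤ C := by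
    have hD := hS.one_le_D
    have a1 : 0 ≤ Real.logb 2 (2 * (D * D * 2 ^ T) + 3) := Real.logb_nonneg (by norm_num) (by
      have : 0 ≤ D * D * 2 ^ T := by positivity
      linarith)
    have a2 : 0 ≤ Real.logb 2 (2 * D + 3) := Real.logb_nonneg (by norm_num) (by linarith)
    rw [hC, blockErr]; linarith
  have hbdd : BddBelow (Set.range fun n => u n / n) := by
    refine ⟨-2, ?_⟩
    rintro _ ⟨n, rfl⟩
    have h1 : (1 : ℝ) / n ≤ 1 := by
      rcases Nat.eq_zero_or_pos n with rfl | hn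
      · simp
      · rw [div_le_one (by exact_mod_cast hn)]; exact_mod_cast hn
    have h2 : 0 ≤ C / n := by positivity
    simp only [hu, sub_div]
    linarith [hle n]
  have hlim := hsub.tendsto_lim hbdd
  have hlimC : Tendsto (fun n : ℕ => C / n) atTop (𝓝 0) := tendsto_const_div_atTop_nhds_zero_nat C
  have hlim1 : Tendsto (fun n : ℕ => (1 : ℝ) / n) atTop (𝓝 0) :=
    tendsto_const_div_atTop_nhds_zero_nat 1
  have hT : Tendsto (fun m : ℕ => hh ψ x₀ m / m) atTop (𝓝 (-hsub.lim)) := by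
    have := hlimC.sub hlim
    rw [zero_sub] at this
    refine this.congr fun n => ?_
    simp only [hu, sub_div]; ring
  refine ⟨-hsub.lim, ge_of_tendsto' hT fun n => ?_, ?_, hT, fun m => ?_⟩
  · exact div_nonneg (hh_nonneg _ _) (Nat.cast_nonneg _)
  · have := le_of_tendsto_of_tendsto' hT (hlim1.const_add 1) hle
    simpa using this
  · rcases Nat.eq_zero_or_pos m with rfl | hm
    · have : hh ψ x₀ 0 = 0 := by
        unfold hh
        rw [ent_congr (Y := fun _ => ())]
        · exact ent_const _
        · intro a ha b hb
          simp at ha hb; simp [ha, hb]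
      rw [this]; simpa using hC0
    · have hn' : (0 : ℝ) < m := by exact_mod_cast hm
      have := hsub.lim_le_div hbdd hm.ne'
      rw [le_div_iff₀ hn'] at this
      simp only [hu] at this
      linarith

end ConfSys

section EntropyChains

variable {Ω β γ δ : Type*} {S : Finset Ω}

lemma ent_of_injOn {X : Ω → β} (hX : Set.InjOn X S) (hS : S.Nonempty) :
    ent S X = Real.logb 2 S.card := by
  have hc : (0 : ℝ) < S.card := by exact_mod_cast hS.card_pos
  have h : ∀ ω ∈ S, Real.logb 2 (S.card / (fib S X ω).card) = Real.logb 2 S.card := by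
    intro ω hω
    have : fib S X ω = {ω} := by
      ext a
      rw [mem_fib, Finset.mem_singleton]
      exact ⟨fun h => hX h.1 hω h.2, fun h => by subst h; exact ⟨hω, rfl⟩⟩
    simp [this]
  unfold ent
  rw [Finset.sum_congr rfl h, Finset.sum_const, nsmul_eq_mul]
  field_simp

lemma ent_pair_le (X : Ω → β) (Y : Ω → γ) : ent S (fun ω => (X ω, Y ω)) ≤ ent S X + ent S Y := by
  have := cent_le_ent (S := S) X Y
  unfold cent at this
  linarith

lemma ent_le_cent_add (X : Ω → β) (Y : Ω → γ) : ent S X ≤ cent S X Y + ent S Y := by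
  unfold cent
  have := ent_mono (S := S) (X := fun ω => (X ω, Y ω)) (Y := X) (by simp +contextual)
  linarith

lemma cent_pi_le {p : ℕ} (Z : Fin p → Ω → β) (Y : Ω → γ) :
    cent S (fun ω i => Z i ω) Y ≤ ∑ i, cent S (Z i) Y := by
  induction p with
  | zero =>
    have : cent S (fun ω (i : Fin 0) => Z i ω) Y ≤ cent S (fun _ => ()) Y :=
      cent_mono_left fun a _ b _ _ _ => Subsingleton.elim _ _
    have h2 := cent_le_ent (S := S) (fun _ => ()) Y
    rw [ent_const] at h2
    simpa using this.trans h2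
  | succ p ih =>
    rw [Fin.sum_univ_succ]
    have h1 : cent S (fun ω i => Z i ω) Y ≤
        cent S (fun ω => ((fun i : Fin p => Z i.succ ω), Z 0 ω)) Y := by
      refine cent_mono_left fun a _ b _ h _ => ?_
      rw [Prod.mk.injEq] at h
      funext i
      refine Fin.cases h.2 (fun i => congrFun h.1 i) i
    rw [cent_chain] at h1
    have h2 : cent S (fun ω (i : Fin p) => Z i.succ ω) (fun ω => (Z 0 ω, Y ω)) ≤
        cent S (fun ω (i : Fin p) => Z i.succ ω) Y := cent_anti_right (by simp +contextual)
    linarith [ih fun i => Z i.succ]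

lemma cent_telescope (Z : ℕ → Ω → β) (Y : Ω → γ) (Q : ℕ) :
    cent S (Z Q) (fun ω => (Z 0 ω, Y ω)) ≤
      ∑ j ∈ Finset.range Q, cent S (Z (j + 1)) (fun ω => (Z j ω, Y ω)) := by
  induction Q with
  | zero =>
    have : cent S (Z 0) (fun ω => (Z 0 ω, Y ω)) ≤ cent S (fun _ => ()) (fun ω => (Z 0 ω, Y ω)) :=
      cent_mono_left fun a _ b _ _ h => (Prod.ext_iff.1 h).1
    have h2 := cent_le_ent (S := S) (fun _ => ()) (fun ω => (Z 0 ω, Y ω))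
    rw [ent_const] at h2
    simpa using this.trans h2
  | succ Q ih =>
    rw [Finset.sum_range_succ]
    have h1 := cent_le_add (S := S) (Z (Q + 1)) (Z Q) (fun ω => (Z 0 ω, Y ω))
    have h2 : cent S (Z (Q + 1)) (fun ω => (Z Q ω, (Z 0 ω, Y ω))) ≤
        cent S (Z (Q + 1)) (fun ω => (Z Q ω, Y ω)) := cent_anti_right (by simp +contextual)
    linarith

lemma ent_floor_scale_le (x : Ω → ℝ) (a b : ℕ) :
    ent S (fun ω => ⌊2 ^ (a + b) * x ω⌋) ≤ ent S (fun ω => ⌊2 ^ a * x ω⌋) + b := by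
  have h := cent_level_le_log (S := S) (fun ω => ⌊2 ^ (a + b) * x ω⌋) 0 b
  rw [zero_add, cent_div_pow _ (Nat.zero_le b)] at h
  simp only [pow_zero, Int.ediv_one] at h
  have h3 : (fun ω => ⌊2 ^ (a + b) * x ω⌋ / 2 ^ b) = fun ω => ⌊2 ^ a * x ω⌋ := by
    funext ω
    rw [floor_div_pow]
    congr 1
    rw [pow_add]; field_simp
  rw [h3] at h
  linarith

end EntropyChains

/-- Second order information on a system: `d u` plays the role of the derivative of the map of
the word `u`. -/
structure SmoothSys {W : Type} (ψ : W → ℝ → ℝ) (d : List W → ℝ → ℝ) (t T : ℕ) (K : ℝ) : Prop where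
  taylor : ∀ u, ∀ y ∈ unitI, ∀ z ∈ unitI,
    |compWord ψ u z - compWord ψ u y - d u y * (z - y)| ≤ K * (1 / 2) ^ (t * u.length) * |z - y| ^ 2
  dlip : ∀ u, ∀ x ∈ unitI, ∀ y ∈ unitI, |d u x - d u y| ≤ K * (1 / 2) ^ (t * u.length) * |x - y|
  dlo : ∀ u, ∀ x ∈ unitI, (1 / 2) ^ (T * u.length) ≤ |d u x|
  dup : ∀ u, ∀ x ∈ unitI, |d u x| ≤ (1 / 2) ^ (t * u.length)
  nonneg : 0 ≤ K

section Budget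

variable {W : Type} [Fintype W]

/-- The information on the image of `x` gained from scale `2^{-N}` to scale `2^{-(N+r)}` once the
derivative at `x` is known at scale `2^{-κ}`. -/
def gain (ψ : W → ℝ → ℝ) (d : List W → ℝ → ℝ) (n κ N r : ℕ) (x : ℝ) : ℝ :=
  cent (words W n) (fun f => ⌊2 ^ (N + r) * compWord ψ f x⌋)
    (fun f => (⌊2 ^ N * compWord ψ f x⌋, ⌊2 ^ κ * d f x⌋))

lemma gain_nonneg (ψ : W → ℝ → ℝ) (d : List W → ℝ → ℝ) (n κ N r : ℕ) (x : ℝ) :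
    0 ≤ gain ψ d n κ N r x := cent_nonneg _ _

lemma two_pow_mul_half_pow_le {a b : ℕ} (h : a ≤ b) : (2 : ℝ) ^ a * (1 / 2) ^ b ≤ 1 := by
  calc (2 : ℝ) ^ a * (1 / 2) ^ b ≤ 2 ^ b * (1 / 2) ^ b := by
        gcongr; norm_num
    _ = 1 := by rw [← mul_pow]; norm_num

variable {ψ : W → ℝ → ℝ} {d : List W → ℝ → ℝ} {t T : ℕ} {D K : ℝ}

/-- The derivative at a point of a cylinder almost determines it at any other point. -/
lemma SmoothSys.cent_deriv_le {γ : Type*} (hd : SmoothSys ψ d t T K) {n κ s : ℕ} {x y : ℝ}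
    (hx : x ∈ unitI) (hy : y ∈ unitI) (hxy : |x - y| ≤ (1 / 2) ^ s) (hκ : κ ≤ t * n + s)
    (Y : List W → γ) (hY : ∀ u v, Y u = Y v → ⌊2 ^ κ * d u y⌋ = ⌊2 ^ κ * d v y⌋) :
    cent (words W n) (fun f => ⌊2 ^ κ * d f x⌋) Y ≤ Real.logb 2 (2 * (1 + 2 * K) + 3) := by
  have hK := hd.nonneg
  have key : ∀ u ∈ words W n, |2 ^ κ * d u x - 2 ^ κ * d u y| ≤ K := by
    intro u hu
    rw [mem_words] at hu
    rw [← mul_sub, abs_mul, abs_of_pos (by positivity)]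
    calc _ ≤ 2 ^ κ * (K * (1 / 2) ^ (t * n) * (1 / 2) ^ s) := by
          gcongr
          refine (hd.dlip u x hx y hy).trans ?_
          rw [hu]
          gcongr
      _ = K * (2 ^ κ * (1 / 2) ^ (t * n + s)) := by rw [pow_add]; ring
      _ ≤ K * 1 := by gcongr; exact two_pow_mul_half_pow_le hκ
      _ = K := mul_one K
  refine cent_floor_le (by linarith) fun u hu v hv huv => ?_
  have h1 := abs_le.1 (key u hu)
  have h2 := abs_le.1 (key v hv)
  have h3 := abs_lt.1 (abs_sub_lt_one_of_floor_eq (hY u v huv))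
  rw [abs_le]; constructor <;> linarith [h1.1, h1.2, h2.1, h2.2, h3.1, h3.2]

/-- The image and derivative at a point of a cylinder almost determine the image of any other
point. -/
lemma SmoothSys.cent_image_le {γ : Type*} (hd : SmoothSys ψ d t T K) {n κ N s : ℕ} {x y : ℝ}
    (hx : x ∈ unitI) (hy : y ∈ unitI) (hxy : |x - y| ≤ (1 / 2) ^ s) (hN1 : N ≤ κ + s)
    (hN2 : N ≤ t * n + 2 * s)
    (Y : List W → γ) (hY : ∀ u v, Y u = Y v → ⌊2 ^ κ * d u y⌋ = ⌊2 ^ κ * d v y⌋)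
    (hY' : ∀ u v, Y u = Y v → ⌊2 ^ N * compWord ψ u y⌋ = ⌊2 ^ N * compWord ψ v y⌋) :
    cent (words W n) (fun f => ⌊2 ^ N * compWord ψ f x⌋) Y ≤
      Real.logb 2 (2 * (2 + 2 * K) + 3) := by
  have hK := hd.nonneg
  have key : ∀ u ∈ words W n, |2 ^ N * compWord ψ u x - 2 ^ N * compWord ψ u y -
      2 ^ N * d u y * (x - y)| ≤ K := by
    intro u hu
    rw [mem_words] at hu
    rw [mul_assoc, ← mul_sub, ← mul_sub, abs_mul, abs_of_pos (by positivity)]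
    calc _ ≤ 2 ^ N * (K * (1 / 2) ^ (t * n) * ((1 / 2) ^ s) ^ 2) := by
          gcongr
          refine (hd.taylor u y hy x hx).trans ?_
          rw [hu]
          gcongr
      _ = K * (2 ^ N * (1 / 2) ^ (t * n + 2 * s)) := by rw [pow_add, pow_mul' _ 2 s]; ring
      _ ≤ K * 1 := by gcongr; exact two_pow_mul_half_pow_le hN2
      _ = K := mul_one K
  refine cent_floor_le (by linarith) fun u hu v hv huv => ?_
  have h1 := abs_le.1 (key u hu)
  have h2 := abs_le.1 (key v hv)
  have h3 := abs_lt.1 (abs_sub_lt_one_of_floor_eq (hY' u v huv))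
  have h4 : |2 ^ N * d u y * (x - y) - 2 ^ N * d v y * (x - y)| ≤ 1 := by
    have h5 := (abs_sub_lt_one_of_floor_eq (hY u v huv)).le
    rw [← mul_sub, abs_mul, abs_of_pos (by positivity)] at h5
    rw [← sub_mul, ← mul_sub, abs_mul, abs_mul, abs_of_pos (by positivity : (0 : ℝ) < 2 ^ N)]
    refine le_of_mul_le_mul_left ?_ (by positivity : (0 : ℝ) < 2 ^ κ)
    calc 2 ^ κ * (2 ^ N * |d u y - d v y| * |x - y|)
        = (2 ^ κ * |d u y - d v y|) * (2 ^ N * |x - y|) := by ring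
      _ ≤ 1 * (2 ^ (κ + s) * (1 / 2) ^ s) := by
        gcongr
        norm_num
      _ = 2 ^ κ * 1 := by rw [pow_add, mul_assoc, ← mul_pow]; norm_num
  have h4 := abs_le.1 h4
  rw [abs_le]; constructor <;> linarith [h1.1, h1.2, h2.1, h2.2, h3.1, h3.2, h4.1, h4.2]

lemma SmoothSys.ent_deriv_le (hd : SmoothSys ψ d t T K) {x : ℝ} (hx : x ∈ unitI) (n b : ℕ) :
    ent (words W n) (fun f => ⌊2 ^ (t * n + b) * d f x⌋) ≤ b + Real.logb 2 7 := by
  refine (ent_floor_scale_le (fun f => d f x) _ _).trans ?_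
  have h1 := ent_le_cent_add (S := words W n) (fun f => ⌊2 ^ (t * n) * d f x⌋) (fun _ => ())
  rw [ent_const, add_zero] at h1
  have h2 := cent_floor_le (S := words W n) (x := fun f => 2 ^ (t * n) * d f x)
    (Y := fun _ => ()) (d := 2) (by norm_num) fun u hu v hv _ => by
      have key : ∀ w ∈ words W n, |2 ^ (t * n) * d w x| ≤ 1 := fun w hw => by
        rw [mem_words] at hw
        rw [abs_mul, abs_of_pos (by positivity)]
        refine le_trans ?_ (two_pow_mul_half_pow_le (le_refl (t * n)))
        gcongr
        simpa [hw] using hd.dup w x hx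
      have a1 := abs_le.1 (key u hu); have a2 := abs_le.1 (key v hv)
      rw [abs_le]; constructor <;> linarith [a1.1, a1.2, a2.1, a2.2]
  norm_num at h2
  linarith

variable [Nonempty W]

/-- The constant of the information budget. -/
def budgetErr (K : ℝ) : ℝ :=
  Real.logb 2 (2 * (1 + 2 * K) + 3) + Real.logb 2 (2 * (2 + 2 * K) + 3)

/-- Information budget: the words of length `n` are determined by the images of finitely many
points of a cylinder. -/
lemma budget (hS : ConfSys ψ t T D) (hd : SmoothSys ψ d t T K) {τ n p Q : ℕ} {x₀ : ℝ}
    (h₀ : x₀ ∈ unitI) (ht1 : 2 * τ ≤ t) (ht2 : T + τ ≤ 2 * t) (htT : t ≤ T)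
    {w : List W} (hw : w.length = n) (x : Fin p → ℝ) (hx : ∀ i, x i ∈ compWord ψ w '' unitI)
    (hinj : ∀ u ∈ words W n, ∀ v ∈ words W n,
      (∀ i, ⌊2 ^ ((T + 3 * τ) * n + Q * (τ * n)) * compWord ψ u (x i)⌋ =
        ⌊2 ^ ((T + 3 * τ) * n + Q * (τ * n)) * compWord ψ v (x i)⌋) → u = v) :
    n * Real.logb 2 (Fintype.card W) ≤ hh ψ x₀ (t * n) + (T - t + 5 * τ) * n +
      (8 + Real.logb 2 7 + p * budgetErr K) +
      ∑ i, ∑ j ∈ Finset.range Q,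
        gain ψ d n ((t + 2 * τ) * n) ((T + 3 * τ) * n + j * (τ * n)) (τ * n) (x i) := by
  set N : ℕ := (T + 3 * τ) * n with hN
  set κ : ℕ := (t + 2 * τ) * n with hκ
  set S := words W n
  set y := compWord ψ w x₀ with hy
  have hyI : y ∈ unitI := hS.mapsTo w h₀
  have hxI : ∀ i, x i ∈ unitI := fun i => by
    obtain ⟨z, hz, hzx⟩ := hx i
    rw [← hzx]; exact hS.mapsTo w hz
  have hxy : ∀ i, |x i - y| ≤ (1 / 2) ^ (t * n) := fun i => by
    obtain ⟨z, hz, hzx⟩ := hx i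
    have h1 := hS.word_up w hz h₀
    have h2 := abs_sub_le_one_of_mem hz h₀
    rw [← hzx, hy, ← hw]
    refine h1.trans ?_
    exact mul_le_of_le_one_right (by positivity) h2
  set Z : Fin p → ℕ → List W → ℤ := fun i j f => ⌊2 ^ (N + j * (τ * n)) * compWord ψ f (x i)⌋
  set Y : List W → ℤ × ℤ := fun f => (⌊2 ^ N * compWord ψ f y⌋, ⌊2 ^ κ * d f y⌋)
  have e1 : ent S (fun f i => Z i Q f) = n * Real.logb 2 (Fintype.card W) := by
    rw [ent_of_injOn _ (words_nonempty n), card_words]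
    · push_cast
      rw [Real.logb_pow]
    · intro u hu v hv huv
      exact hinj u hu v hv fun i => congrFun huv i
  have e2 := ent_le_cent_add (S := S) (fun f i => Z i Q f) Y
  have e3 := cent_pi_le (S := S) (fun i => Z i Q) Y
  have e4 : ∀ i, cent S (Z i Q) Y ≤ budgetErr K + ∑ j ∈ Finset.range Q,
      gain ψ d n κ (N + j * (τ * n)) (τ * n) (x i) := by
    intro i
    have a1 := cent_le_cond (S := S) (Z i Q) Y (fun f => (Z i 0 f, ⌊2 ^ κ * d f (x i)⌋))
    have a2 := cent_telescope (S := S) (Z i) (fun f => ⌊2 ^ κ * d f (x i)⌋) Q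
    have a3 := cent_chain (S := S) (Z i 0) (fun f => ⌊2 ^ κ * d f (x i)⌋) Y
    have a4 := hd.cent_deriv_le (n := n) (κ := κ) (hxI i) hyI (hxy i) (by nlinarith) Y
      fun u v h => (Prod.ext_iff.1 h).2
    have a5 := hd.cent_image_le (n := n) (κ := κ) (N := N) (hxI i) hyI (hxy i) (by nlinarith)
      (by nlinarith) (fun f => (⌊2 ^ κ * d f (x i)⌋, Y f))
      (fun u v h => (Prod.ext_iff.1 (Prod.ext_iff.1 h).2).2)
      (fun u v h => (Prod.ext_iff.1 (Prod.ext_iff.1 h).2).1)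
    have a6 : Z i 0 = fun f => ⌊2 ^ N * compWord ψ f (x i)⌋ := by
      funext f; simp [Z]
    have a7 : ∀ j, cent S (Z i (j + 1)) (fun f => (Z i j f, ⌊2 ^ κ * d f (x i)⌋)) =
        gain ψ d n κ (N + j * (τ * n)) (τ * n) (x i) := by
      intro j
      simp only [gain, Z, show N + (j + 1) * (τ * n) = N + j * (τ * n) + τ * n by ring]
      rfl
    simp only [a7] at a2
    rw [a6] at a1 a2 a3
    unfold budgetErr
    linarith
  have e5 := ent_pair_le (S := S) (fun f => ⌊2 ^ N * compWord ψ f y⌋) (fun f => ⌊2 ^ κ * d f y⌋)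
  have e6 := hd.ent_deriv_le hyI n (2 * τ * n)
  rw [← add_mul, ← hκ] at e6
  have e7 := ent_floor_scale_le (S := S) (fun f => compWord ψ f y) (t * n) ((T + 3 * τ - t) * n)
  rw [← add_mul, show t + (T + 3 * τ - t) = T + 3 * τ by omega, ← hN] at e7
  have e8 := (abs_le.1 (hS.abs_ent_prefix h₀ hyI (n := n) (n' := t * n) (m := t * n) le_rfl)).1
  have e9 := (abs_le.1 (hS.abs_ent_sub_hh h₀ (M := n + t * n) (m := t * n) (by omega))).2
  have e10 : ∑ i, cent S (Z i Q) Y ≤ p * budgetErr K + ∑ i, ∑ j ∈ Finset.range Q,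
      gain ψ d n κ (N + j * (τ * n)) (τ * n) (x i) := by
    refine (Finset.sum_le_sum fun i _ => e4 i).trans ?_
    rw [Finset.sum_add_distrib, Finset.sum_const, Finset.card_univ, Fintype.card_fin, nsmul_eq_mul]
  push_cast [Nat.cast_sub (show t ≤ T + 3 * τ by omega)] at e6 e7
  linarith

end Budget

section Fibers

variable {ΩA ΩB β γ δ : Type*} {SA : Finset ΩA} {SB : Finset ΩB}

lemma fib_prod_snd (I : ΩB → δ) (p : ΩA × ΩB) :
    fib (SA ×ˢ SB) (fun q => I q.2) p = SA ×ˢ fib SB I p.2 := by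
  ext q; simp [mem_fib]; tauto

lemma avg_le_cent_prod (hA : SA.Nonempty) (X : ΩA × ΩB → β) (Z : ΩA × ΩB → γ)
    (I : ΩB → δ) (f : ΩB → ℝ) (h : ∀ b ∈ SB, f b ≤ cent (SA ×ˢ fib SB I b) X Z) :
    (∑ b ∈ SB, f b) / SB.card ≤ cent (SA ×ˢ SB) X Z := by
  refine le_trans ?_ (cent_anti_right (Y' := fun q => (I q.2, Z q)) (by simp +contextual))
  rw [cent_pair_eq_avg]
  simp only [fib_prod_snd]
  have hA' : (0 : ℝ) < SA.card := by exact_mod_cast hA.card_pos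
  rw [Finset.sum_product]
  simp only [Finset.sum_const]
  rw [nsmul_eq_mul, Finset.card_product, Nat.cast_mul,
    mul_div_mul_left _ _ hA'.ne']
  gcongr with b hb
  exact h b hb

lemma ent_le_of_abs_sub_le {S : Finset ΩA} {X Y : ΩA → ℤ} {k : ℕ}
    (h : ∀ a ∈ S, |X a - Y a| ≤ k) : ent S X ≤ ent S Y + Real.logb 2 (4 * k + 1) := by
  refine (ent_le_ent_add_cent X Y).trans ?_
  have := cent_int_le (S := S) (X := X) (Y := Y) (2 * k) fun a ha b hb hab => by
    have h1 := abs_le.1 (h a ha); have h2 := abs_le.1 (h b hb)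
    rw [abs_le]; push_cast; constructor <;> omega
  push_cast at this
  rw [show (2 * (2 * (k : ℝ)) + 1) = 4 * k + 1 by ring] at this
  linarith

lemma abs_ediv_sub_le {x y : ℤ} {k : ℕ} (h : |x - y| ≤ k) (r : ℕ) :
    |x / 2 ^ r - y / 2 ^ r| ≤ k + 1 := by
  have h1 := ediv_add_sub y (x - y) (N := 2 ^ r) (by positivity)
  rw [show y + (x - y) = x by ring, Set.mem_Icc] at h1
  have h0 : (1 : ℤ) ≤ 2 ^ r := one_le_pow₀ (by norm_num)
  rw [abs_le] at h
  have h2 : (x - y) / 2 ^ r ≤ k := by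
    refine Int.ediv_le_of_le_mul (by positivity) ?_
    nlinarith
  have h3 : -(k : ℤ) ≤ (x - y) / 2 ^ r := by
    rw [Int.le_ediv_iff_mul_le (by positivity)]
    nlinarith
  rw [abs_le]; constructor <;> omega

lemma cent_scale_le_of_close {S : Finset ΩA} {X Y : ΩA → ℤ} {k : ℕ}
    (h : ∀ a ∈ S, |X a - Y a| ≤ k) (r : ℕ) :
    cent S Y (fun a => Y a / 2 ^ r) - 2 * Real.logb 2 (4 * (k + 1 : ℕ) + 1) ≤
      cent S X (fun a => X a / 2 ^ r) := by
  have e1 := cent_div_pow (S := S) X (Nat.zero_le r)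
  have e2 := cent_div_pow (S := S) Y (Nat.zero_le r)
  simp only [pow_zero, Int.ediv_one] at e1 e2
  have h1 := ent_le_of_abs_sub_le (S := S) (X := Y) (Y := X) (k := k + 1) fun a ha => by
    rw [abs_sub_comm]; exact (h a ha).trans (by push_cast; omega)
  have h2 := ent_le_of_abs_sub_le (S := S) (X := fun a => X a / 2 ^ r)
    (Y := fun a => Y a / 2 ^ r) (k := k + 1) fun a ha => by
    push_cast; exact abs_ediv_sub_le (h a ha) r
  linarith

lemma parity_ent_le {S : Finset ΩA} (Z : ΩA → ℤ) (n : ℕ) (g : ℕ) :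
    ent S (fun a (i : Fin n) => decide (Even (Z a / 2 ^ (g * i)))) ≤ n := by
  have h := ent_le_logb (S := S) (X := fun a (i : Fin n) => decide (Even (Z a / 2 ^ (g * i))))
    Finset.univ (fun _ _ => Finset.mem_univ _) (K := 2 ^ n) (by simp)
    (one_le_pow₀ (by norm_num))
  rwa [Real.logb_pow, Real.logb_self_eq_one (by norm_num), mul_one] at h

end Fibers

/-- Quantitative entropy growth under sums at a fixed scale; see `exists_growth`. -/
def Growth (α c ε η : ℝ) (g μ L : ℕ) : Prop :=
  ∀ (ΩA ΩB : Type)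
    (SA : Finset ΩA) (SB : Finset ΩB) (A : ΩA → ℤ) (B : ΩB → ℤ), SA.Nonempty → SB.Nonempty →
    (∀ b ∈ SB, 0 ≤ B b ∧ B b < 2 ^ (g * μ * L)) →
    (∀ i < μ * L, ∀ b ∈ SB, ∀ b' ∈ SB, Even (B b / 2 ^ (g * i) - B b' / 2 ^ (g * i))) →
    (∀ v, v + g * μ ≤ g * μ * L → (α - ε) * (g * μ : ℕ) ≤
      cent SA (fun a => A a / 2 ^ v) (fun a => A a / 2 ^ (v + g * μ))) →
    (α - η) * (g * μ * L : ℕ) ≤ cent SA A (fun a => A a / 2 ^ (g * μ * L)) →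
    c * (g * μ * L : ℕ) ≤ ent SB B →
    (α + η) * (g * μ * L : ℕ) ≤ cent (SA ×ˢ SB) (fun p => A p.1 + B p.2)
      (fun p => (A p.1 + B p.2) / 2 ^ (g * μ * L))

lemma Growth.linear {α c ε η ε' : ℝ} {g μ L : ℕ} (h : Growth α c ε η g μ L) (hc : 0 ≤ c)
    (hη : 0 ≤ η) (hε' : 0 ≤ ε')
    {ΩA ΩB : Type} {SA : Finset ΩA} {SB : Finset ΩB} (A : ΩA → ℤ) (B : ΩB → ℤ)
    (hA : SA.Nonempty) (hB : SB.Nonempty) (q : ℤ) (hBq : ∀ b ∈ SB, B b / 2 ^ (g * μ * L) = q)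
    (hpar : ∀ i < μ * L, ∀ b ∈ SB, ∀ b' ∈ SB,
      (Even (B b / 2 ^ (g * i)) ↔ Even (B b' / 2 ^ (g * i))))
    (h1 : ∀ v, v + g * μ ≤ g * μ * L → (α - ε) * (g * μ : ℕ) ≤
      cent SA (fun a => A a / 2 ^ v) (fun a => A a / 2 ^ (v + g * μ)))
    (h2 : (α - η) * (g * μ * L : ℕ) ≤ cent SA A (fun a => A a / 2 ^ (g * μ * L)))
    (h3 : (α - ε') * (g * μ * L : ℕ) + 4 ≤ cent SA A (fun a => A a / 2 ^ (g * μ * L))) :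
    (α - ε') * (g * μ * L : ℕ) + η * (ent SB B - c * (g * μ * L : ℕ)) ≤
      cent (SA ×ˢ SB) (fun p => A p.1 + B p.2)
        (fun p => (A p.1 + B p.2) / 2 ^ (g * μ * L)) := by
  set r := g * μ * L with hr
  set B' : ΩB → ℤ := fun b => B b - q * 2 ^ r with hB'
  have hr0 : (0 : ℝ) ≤ (r : ℕ) := Nat.cast_nonneg _
  have hent : ent SB B = ent SB B' := ent_congr fun a _ b _ => by simp [hB']
  have hrange : ∀ b ∈ SB, 0 ≤ B' b ∧ B' b < 2 ^ r := fun b hb => by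
    have e1 := Int.emod_add_mul_ediv (B b) (2 ^ r)
    rw [hBq b hb] at e1
    have e2 := Int.emod_nonneg (B b) (by positivity : (2 : ℤ) ^ r ≠ 0)
    have e3 := Int.emod_lt_of_pos (B b) (by positivity : (0 : ℤ) < 2 ^ r)
    have : B' b = B b % 2 ^ r := by simp only [hB']; linarith
    rw [this]; exact ⟨e2, e3⟩
  rcases le_total (c * r) (ent SB B) with hcase | hcase
  · have hle : ent SB B' ≤ r := by
      have := ent_le_logb (S := SB) (X := B') (Finset.Ico 0 (2 ^ r))
        (fun b hb => Finset.mem_Ico.2 (hrange b hb)) (K := 2 ^ r)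
        (by
          rw [Int.card_Ico, sub_zero, show (2 : ℤ) ^ r = ((2 ^ r : ℕ) : ℤ) by push_cast; rfl,
            Int.toNat_natCast]
          simp)
        (one_le_pow₀ (by norm_num))
      rwa [Real.logb_pow, Real.logb_self_eq_one (by norm_num), mul_one] at this
    have hmain := h ΩA ΩB SA SB A B' hA hB hrange ?_ h1 h2 (hent ▸ hcase)
    · have : cent (SA ×ˢ SB) (fun p => A p.1 + B p.2) (fun p => (A p.1 + B p.2) / 2 ^ r) =
          cent (SA ×ˢ SB) (fun p => A p.1 + B' p.2) (fun p => (A p.1 + B' p.2) / 2 ^ r) := by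
        refine cent_congr (fun a _ b _ => ?_) (fun a _ b _ => ?_)
        · simp only [hB']; constructor <;> intro h <;> linarith
        · have e : ∀ p : ΩA × ΩB, (A p.1 + B p.2) / 2 ^ r = (A p.1 + B' p.2) / 2 ^ r + q := by
            intro p
            rw [← Int.add_mul_ediv_right _ _ (by positivity : (2 : ℤ) ^ r ≠ 0)]
            congr 1; simp only [hB']; ring
          simp [e]
      rw [this]
      refine le_trans ?_ hmain
      rw [hent]
      have : η * (ent SB B' - c * r) ≤ η * r := by
        gcongr
        nlinarith
      nlinarith
    · intro i hi b hb b' hb'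
      have hgi : g * i ≤ r := by rw [hr, mul_assoc]; gcongr
      have e : ∀ x : ΩB, B' x / 2 ^ (g * i) = B x / 2 ^ (g * i) - q * 2 ^ (r - g * i) := by
        intro x
        simp only [hB']
        rw [show q * 2 ^ r = q * 2 ^ (r - g * i) * 2 ^ (g * i) by
          rw [mul_assoc, ← pow_add, Nat.sub_add_cancel hgi],
          Int.sub_mul_ediv_right _ _ (by positivity : (2 : ℤ) ^ (g * i) ≠ 0)]
      rw [e, e, sub_sub_sub_cancel_right, Int.even_sub]
      exact hpar i hi b hb b' hb'
  · have := cent_block_add_ge hA hB A B (Nat.zero_le r)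
    simp only [pow_zero, Int.ediv_one] at this
    nlinarith [mul_nonneg hη (sub_nonneg.2 hcase)]

variable {W : Type} [Fintype W] [Nonempty W] {ψ : W → ℝ → ℝ} {d : List W → ℝ → ℝ} {t T : ℕ}
  {D K : ℝ}

/-- The error made by linearising at one point of a cylinder. -/
def linErr (K : ℝ) : ℝ := 2 * Real.logb 2 (4 * (⌊K + 1⌋₊ + 2 + 1 : ℕ) + 1)

lemma linear_block_ge (hS : ConfSys ψ t T D) {x₀ : ℝ} (h₀ : x₀ ∈ unitI) {n N P r : ℕ} {w : List W}
    {a xw : ℝ} (hT : 1 ≤ T) (ha1 : (1 / 2) ^ (T * n) ≤ |a|) (ha2 : |a| ≤ 1)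
    (hN3 : T * (n + w.length) ≤ N) (hN4 : N + r ≤ w.length + P) {v m : ℕ} (hv : v + m ≤ r) :
    hh ψ x₀ m - ConfSys.blockErr T D ≤ cent (words W P)
      (fun ω => ⌊2 ^ (N + r) * (a * (compWord ψ w (compWord ψ ω x₀) - xw))⌋ / 2 ^ v)
      (fun ω => ⌊2 ^ (N + r) * (a * (compWord ψ w (compWord ψ ω x₀) - xw))⌋ / 2 ^ (v + m)) := by
  have hD := hS.one_le_D
  set e : ℝ := a * 2 ^ (N + r - v) with he
  have hpow : (2 : ℝ) ^ (N + r) = 2 ^ (N + r - v) * 2 ^ v := by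
    rw [← pow_add, Nat.sub_add_cancel (by omega)]
  have h1 : (fun ω : List W =>
      ⌊2 ^ (N + r) * (a * (compWord ψ w (compWord ψ ω x₀) - xw))⌋ / 2 ^ v) =
      fun ω => ⌊e * compWord ψ w (compWord ψ ω x₀) + -(e * xw)⌋ := by
    funext ω
    rw [floor_div_pow, hpow]
    congr 1
    rw [he]; field_simp; ring
  have h2 : (fun ω : List W =>
      ⌊2 ^ (N + r) * (a * (compWord ψ w (compWord ψ ω x₀) - xw))⌋ / 2 ^ (v + m)) =
      fun ω => ⌊e * compWord ψ w (compWord ψ ω x₀) + -(e * xw)⌋ / 2 ^ m := by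
    funext ω
    rw [ediv_pow_of_le _ (Nat.le_add_right v m), Nat.add_sub_cancel_left]
    exact congrArg (fun z : ℤ => z / 2 ^ m) (congrFun h1 ω)
  rw [h1, h2]
  have hwN : w.length ≤ N := by nlinarith
  refine hS.block_ge h₀ (by omega) w e _ ?_ ?_
  · rw [he, abs_mul, abs_of_pos (by positivity : (0 : ℝ) < 2 ^ (N + r - v))]
    have hrho := hS.rho_ge w
    calc (1 / 2 : ℝ) ^ T / D * 2 ^ m ≤ 1 * 2 ^ m := by
          gcongr
          rw [div_le_one (by linarith)]
          exact (pow_le_one₀ (by norm_num) (by norm_num)).trans hD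
      _ = 2 ^ (T * (n + w.length) + m) * (1 / 2) ^ (T * n) * (1 / 2) ^ (T * w.length) := by
          rw [mul_add, pow_add, pow_add]
          have : ∀ k : ℕ, (1 / 2 : ℝ) ^ k = (2 ^ k)⁻¹ := fun k => by rw [one_div, inv_pow]
          rw [this, this]; field_simp
      _ ≤ 2 ^ (N + r - v) * |a| * rho ψ w := by
          gcongr
          · norm_num
          · omega
      _ = _ := by ring
  · rw [he, abs_mul, abs_of_pos (by positivity : (0 : ℝ) < 2 ^ (N + r - v))]
    calc |a| * 2 ^ (N + r - v) ≤ 1 * 2 ^ (w.length + P) := by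
          gcongr
          · norm_num
          · omega
      _ = _ := one_mul _

/-- Entropy gained at one scale by the images of a cylinder. -/
lemma prefix_bound (hS : ConfSys ψ t T D) (hd : SmoothSys ψ d t T K) {x₀ : ℝ} (h₀ : x₀ ∈ unitI)
    {n κ N P r g μ L : ℕ} {w : List W} {xw : ℝ} (hxw : xw ∈ compWord ψ w '' unitI)
    {α c ε ε' η : ℝ} (hr : r = g * μ * L) (hG : Growth α c ε η g μ L) (hc : 0 ≤ c) (hη : 0 ≤ η)
    (hε' : 0 ≤ ε') (hT : 1 ≤ T)
    (hN1 : N + r ≤ κ + t * w.length) (hN2 : N + r ≤ t * n + 2 * (t * w.length))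
    (hN3 : T * (n + w.length) ≤ N) (hN4 : N + r ≤ w.length + P)
    (b1 : (α - ε) * (g * μ : ℕ) ≤ hh ψ x₀ (g * μ) - ConfSys.blockErr T D)
    (b2 : (α - η) * r ≤ hh ψ x₀ r - ConfSys.blockErr T D)
    (b3 : (α - ε') * r + 4 ≤ hh ψ x₀ r - ConfSys.blockErr T D) :
    (α - ε') * r + η * (gain ψ d n κ N r xw - (μ * L : ℕ) - c * r) - linErr K ≤
      cent (words W P ×ˢ words W n)
        (fun p => ⌊2 ^ (N + r) * compWord ψ p.2 (compWord ψ w (compWord ψ p.1 x₀))⌋)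
        (fun p => ⌊2 ^ (N + r) * compWord ψ p.2 (compWord ψ w (compWord ψ p.1 x₀))⌋ / 2 ^ r) := by
  set S := words W n with hSdef
  have hK := hd.nonneg
  obtain ⟨y₁, hy₁, hxy⟩ := hxw
  have hxI : xw ∈ unitI := hxy ▸ hS.mapsTo w hy₁
  set B : List W → ℤ := fun f => ⌊2 ^ (N + r) * compWord ψ f xw⌋ with hB
  set Y : List W → ℤ × ℤ := fun f => (B f / 2 ^ r, ⌊2 ^ κ * d f xw⌋) with hY
  set par : List W → Fin (μ * L) → Bool := fun f i => decide (Even (B f / 2 ^ (g * i))) with hpar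
  set I : List W → (Fin (μ * L) → Bool) × (ℤ × ℤ) := fun f => (par f, Y f) with hI
  have hgain : gain ψ d n κ N r xw = cent S B Y := by
    have : (fun f => ⌊2 ^ N * compWord ψ f xw⌋) = fun f => B f / 2 ^ r := by
      funext f
      rw [hB]; dsimp only
      rw [floor_div_pow]
      congr 1
      rw [pow_add]; field_simp
    unfold gain
    simp only [hY, ← congrFun this]
    rfl
  have hinfo : gain ψ d n κ N r xw - (μ * L : ℕ) ≤ (∑ f ∈ S, ent (fib S I f) B) / S.card := by
    rw [← cent_eq_avg, hgain]
    have h1 := cent_le_add (S := S) B par Y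
    have h2 := cent_le_ent (S := S) par Y
    have h3 := parity_ent_le (S := S) B (μ * L) g
    linarith
  have hSne : S.Nonempty := words_nonempty n
  have hScard : (0 : ℝ) < S.card := by exact_mod_cast hSne.card_pos
  have hmain := avg_le_cent_prod (SA := words W P) (SB := S) (words_nonempty P)
    (fun p => ⌊2 ^ (N + r) * compWord ψ p.2 (compWord ψ w (compWord ψ p.1 x₀))⌋)
    (fun p => ⌊2 ^ (N + r) * compWord ψ p.2 (compWord ψ w (compWord ψ p.1 x₀))⌋ / 2 ^ r) I
    (fun f => (α - ε') * r + η * (ent (fib S I f) B - c * r) - linErr K) ?_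
  · refine le_trans ?_ hmain
    have hsum : ∑ f ∈ S, ((α - ε') * r + η * (ent (fib S I f) B - c * r) - linErr K) =
        S.card * ((α - ε') * r - η * (c * r) - linErr K) + η * ∑ f ∈ S, ent (fib S I f) B := by
      rw [Finset.mul_sum, ← nsmul_eq_mul, ← Finset.sum_const, ← Finset.sum_add_distrib]
      exact Finset.sum_congr rfl fun f _ => by ring
    rw [hsum, le_div_iff₀ hScard]
    rw [le_div_iff₀ hScard] at hinfo
    nlinarith [mul_le_mul_of_nonneg_left hinfo hη]
  · intro f₀ hf₀
    set a := d f₀ xw with ha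
    set A : List W → ℤ := fun ω => ⌊2 ^ (N + r) * (a * (compWord ψ w (compWord ψ ω x₀) - xw))⌋
      with hA
    have hf₀n : f₀.length = n := mem_words.1 hf₀
    have ha1 : (1 / 2) ^ (T * n) ≤ |a| := hf₀n ▸ hd.dlo f₀ xw hxI
    have ha2 : |a| ≤ 1 := (hd.dup f₀ xw hxI).trans (pow_le_one₀ (by norm_num) (by norm_num))
    have hblock : ∀ v m, v + m ≤ r → hh ψ x₀ m - ConfSys.blockErr T D ≤ cent (words W P)
        (fun ω => A ω / 2 ^ v) (fun ω => A ω / 2 ^ (v + m)) := fun v m hv =>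
      linear_block_ge hS h₀ hT ha1 ha2 hN3 hN4 hv
    have hbr := hblock 0 r (by omega)
    simp only [pow_zero, Int.ediv_one, zero_add] at hbr
    have hfibI : ∀ b ∈ fib S I f₀, I b = I f₀ := fun b hb => (mem_fib.1 hb).2
    have hlin := hG.linear hc hη hε' (SA := words W P) (SB := fib S I f₀) A B (words_nonempty P)
      ⟨f₀, self_mem_fib hf₀⟩ (B f₀ / 2 ^ r) (fun b hb => ?_) (fun i hi b hb b' hb' => ?_)
      (fun v hv => b1.trans (hblock v _ (hr ▸ hv))) (by rw [← hr]; exact b2.trans hbr)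
      (by rw [← hr]; exact b3.trans hbr)
    · rw [← hr] at hlin
      have hclose := cent_scale_le_of_close (S := words W P ×ˢ fib S I f₀)
        (X := fun p => ⌊2 ^ (N + r) * compWord ψ p.2 (compWord ψ w (compWord ψ p.1 x₀))⌋)
        (Y := fun p => A p.1 + B p.2) (k := ⌊K + 1⌋₊ + 2) (fun p hp => ?_) r
      · unfold linErr
        linarith
      · have hp2 := (Finset.mem_product.1 hp).2
        have hp2n : p.2.length = n := mem_words.1 (fib_subset hp2)
        set z := compWord ψ w (compWord ψ p.1 x₀) with hz
        have hzI : z ∈ unitI := hS.mapsTo w (hS.mapsTo p.1 h₀)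
        have hzx : |z - xw| ≤ (1 / 2) ^ (t * w.length) := by
          rw [hz, ← hxy]
          refine (hS.word_up w (hS.mapsTo p.1 h₀) hy₁).trans ?_
          exact mul_le_of_le_one_right (by positivity)
            (abs_sub_le_one_of_mem (hS.mapsTo p.1 h₀) hy₁)
        have c1 : |2 ^ (N + r) * compWord ψ p.2 z - 2 ^ (N + r) * compWord ψ p.2 xw -
            2 ^ (N + r) * (d p.2 xw * (z - xw))| ≤ K := by
          rw [← mul_sub, ← mul_sub, abs_mul, abs_of_pos (by positivity)]
          calc _ ≤ 2 ^ (N + r) * (K * (1 / 2) ^ (t * n) * ((1 / 2) ^ (t * w.length)) ^ 2) := by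
                gcongr
                refine (hd.taylor p.2 xw hxI z hzI).trans ?_
                rw [hp2n]
                gcongr
            _ = K * (2 ^ (N + r) * (1 / 2) ^ (t * n + 2 * (t * w.length))) := by
                rw [pow_add (1 / 2 : ℝ), pow_mul' _ 2 (t * w.length)]; ring
            _ ≤ K * 1 := by gcongr; exact two_pow_mul_half_pow_le hN2
            _ = K := mul_one K
        have c2 : |2 ^ (N + r) * (d p.2 xw * (z - xw)) - 2 ^ (N + r) * (a * (z - xw))| ≤ 1 := by
          have e0 := hfibI p.2 hp2
          have e1 : ⌊2 ^ κ * d p.2 xw⌋ = ⌊2 ^ κ * a⌋ :=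
            (Prod.ext_iff.1 (Prod.ext_iff.1 e0).2).2
          have e2 := (abs_sub_lt_one_of_floor_eq e1).le
          rw [← mul_sub, abs_mul, abs_of_pos (by positivity)] at e2
          rw [← mul_sub, ← sub_mul, abs_mul, abs_mul,
            abs_of_pos (by positivity : (0 : ℝ) < 2 ^ (N + r))]
          refine le_of_mul_le_mul_left ?_ (by positivity : (0 : ℝ) < 2 ^ κ)
          calc 2 ^ κ * (2 ^ (N + r) * (|d p.2 xw - a| * |z - xw|))
              = (2 ^ κ * |d p.2 xw - a|) * (2 ^ (N + r) * |z - xw|) := by ring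
            _ ≤ 1 * (2 ^ (κ + t * w.length) * (1 / 2) ^ (t * w.length)) := by
              gcongr
              norm_num
            _ = 2 ^ κ * 1 := by rw [pow_add, mul_assoc, ← mul_pow]; norm_num
        have c3 : |2 ^ (N + r) * compWord ψ p.2 z - (2 ^ (N + r) * (a * (z - xw)) +
            2 ^ (N + r) * compWord ψ p.2 xw)| ≤ K + 1 := by
          have c1 := abs_le.1 c1; have c2 := abs_le.1 c2
          rw [abs_le]; constructor <;> linarith [c1.1, c1.2, c2.1, c2.2]
        have c4 := abs_le.1 (abs_floor_sub_le c3)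
        have c5 := Int.le_floor_add (2 ^ (N + r) * (a * (z - xw))) (2 ^ (N + r) * compWord ψ p.2 xw)
        have c6 := Int.le_floor_add_floor (2 ^ (N + r) * (a * (z - xw)))
          (2 ^ (N + r) * compWord ψ p.2 xw)
        simp only [hA, hB, ← hz]
        rw [abs_le]
        push_cast
        constructor <;> omega
    · rw [← hr]
      exact (Prod.ext_iff.1 (Prod.ext_iff.1 (hfibI b hb)).2).1
    · have e1 := congrFun (Prod.ext_iff.1 (hfibI b hb)).1 ⟨i, hi⟩
      have e2 := congrFun (Prod.ext_iff.1 (hfibI b' hb')).1 ⟨i, hi⟩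
      have := e1.trans e2.symm
      simpa [hI, hpar] using this

section WordSums

variable {W : Type} [Fintype W]

lemma sum_words_add (a b : ℕ) (F : List W → ℝ) :
    ∑ ω ∈ words W (a + b), F ω = ∑ u ∈ words W a, ∑ v ∈ words W b, F (u ++ v) := by
  have h := bijOn_append (W := W) a b
  rw [← Finset.sum_product']
  exact (Finset.sum_nbij (M := ℝ) (s := words W a ×ˢ words W b) (t := words W (a + b))
    (f := fun p => F (p.1 ++ p.2)) (g := F) (fun p : List W × List W => p.1 ++ p.2)
    (fun p hp => h.mapsTo hp) h.injOn h.surjOn fun _ _ => rfl).symm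

lemma bijOn_append_swap (n l P : ℕ) :
    Set.BijOn (fun p : List W × (List W × List W) => p.2.2 ++ (p.1 ++ p.2.1))
      ((words W l ×ˢ (words W P ×ˢ words W n) : Finset _) : Set _)
      (words W (n + (l + P)) : Set (List W)) := by
  refine ⟨fun p hp => ?_, fun p hp q hq h => ?_, fun u hu => ?_⟩
  · simp at hp ⊢; omega
  · simp at hp hq
    have h1 := List.append_inj h (by omega)
    have h2 := List.append_inj h1.2 (by omega)
    exact Prod.ext h2.1 (Prod.ext h2.2 h1.1)
  · simp at hu
    refine ⟨((u.drop n).take l, ((u.drop n).drop l, u.take n)), by simp [hu]; omega, ?_⟩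
    simp only [List.take_append_drop]

end WordSums

section Assembly

variable {W : Type} [Fintype W] [Nonempty W] {ψ : W → ℝ → ℝ} {d : List W → ℝ → ℝ} {t T : ℕ}
  {D K : ℝ}

lemma exists_scale {p Q n k M' : ℕ} (hp : 0 < p) (hQ : 0 < Q) {R : ℝ} (x₀ : ℝ)
    (G : ℕ → ℝ → ℝ) (hG : ∀ j x, 0 ≤ G j x) (v : Fin p → List W) (hv : ∀ i, (v i).length = k)
    (h : ∀ w ∈ words W n, ∀ σ ∈ words W M', R ≤ ∑ i, ∑ j ∈ Finset.range Q,
      G j (compWord ψ w (compWord ψ (v i) (compWord ψ σ x₀)))) :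
    ∃ j < Q, (Fintype.card W : ℝ) ^ (n + M') * (R / (p * Q)) ≤
      ∑ ω ∈ words W (n + (k + M')), G j (compWord ψ ω x₀) := by
  have hp' : (0 : ℝ) < p := by exact_mod_cast hp
  have hQ' : (0 : ℝ) < Q := by exact_mod_cast hQ
  have key : (Fintype.card W : ℝ) ^ (n + M') * (R / p) ≤
      ∑ j ∈ Finset.range Q, ∑ ω ∈ words W (n + (k + M')), G j (compWord ψ ω x₀) := by
    rw [Finset.sum_comm, sum_words_add]
    have : ∀ w ∈ words W n, (Fintype.card W : ℝ) ^ M' * (R / p) ≤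
        ∑ u ∈ words W (k + M'), ∑ j ∈ Finset.range Q, G j (compWord ψ (w ++ u) x₀) := by
      intro w hw
      rw [sum_words_add, Finset.sum_comm]
      have h2 : ∀ σ ∈ words W M', R / p ≤
          ∑ u ∈ words W k, ∑ j ∈ Finset.range Q, G j (compWord ψ (w ++ (u ++ σ)) x₀) := by
        intro σ hσ
        obtain ⟨i, hi⟩ : ∃ i, R / p ≤ ∑ j ∈ Finset.range Q,
            G j (compWord ψ w (compWord ψ (v i) (compWord ψ σ x₀))) := by
          by_contra! hcon
          have : Nonempty (Fin p) := ⟨⟨0, hp⟩⟩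
          have := Finset.sum_lt_sum_of_nonempty (Finset.univ_nonempty (α := Fin p))
            fun i _ => hcon i
          rw [Finset.sum_const, Finset.card_univ, Fintype.card_fin, nsmul_eq_mul,
            mul_div_cancel₀ _ hp'.ne'] at this
          linarith [h w hw σ hσ]
        refine hi.trans ?_
        simp only [← compWord_append]
        exact Finset.single_le_sum
          (f := fun u => ∑ j ∈ Finset.range Q, G j (compWord ψ (w ++ (u ++ σ)) x₀))
          (fun u _ => Finset.sum_nonneg fun j _ => hG j _) (mem_words.2 (hv i))
      have := Finset.sum_le_sum h2
      rwa [Finset.sum_const, nsmul_eq_mul, card_words, Nat.cast_pow] at this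
    have := Finset.sum_le_sum this
    rw [Finset.sum_const, nsmul_eq_mul, card_words, Nat.cast_pow] at this
    rwa [pow_add, mul_assoc]
  by_contra! hcon
  have := Finset.sum_lt_sum_of_nonempty (s := Finset.range Q)
    ⟨0, Finset.mem_range.2 hQ⟩ fun j hj => hcon j (Finset.mem_range.1 hj)
  rw [Finset.sum_const, Finset.card_range, nsmul_eq_mul] at this
  have e : (Q : ℝ) * ((Fintype.card W : ℝ) ^ (n + M') * (R / (p * Q))) =
      (Fintype.card W : ℝ) ^ (n + M') * (R / p) := by field_simp
  linarith

lemma scale_bound (hS : ConfSys ψ t T D) (hd : SmoothSys ψ d t T K) {x₀ : ℝ} (h₀ : x₀ ∈ unitI)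
    {n κ N P r g μ L l : ℕ} {α c ε ε' η G : ℝ} (hr : r = g * μ * L)
    (hG : Growth α c ε η g μ L) (hc : 0 ≤ c) (hη : 0 ≤ η)
    (hε' : 0 ≤ ε') (hT : 1 ≤ T)
    (hN1 : N + r ≤ κ + t * l) (hN2 : N + r ≤ t * n + 2 * (t * l))
    (hN3 : T * (n + l) ≤ N) (hN4 : N + r ≤ l + P)
    (b1 : (α - ε) * (g * μ : ℕ) ≤ hh ψ x₀ (g * μ) - ConfSys.blockErr T D)
    (b2 : (α - η) * r ≤ hh ψ x₀ r - ConfSys.blockErr T D)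
    (b3 : (α - ε') * r + 4 ≤ hh ψ x₀ r - ConfSys.blockErr T D)
    (hsum : (Fintype.card W : ℝ) ^ (l + P) * G ≤
      ∑ ω ∈ words W (l + P), gain ψ d n κ N r (compWord ψ ω x₀)) :
    (α - ε') * r + η * (G - (μ * L : ℕ) - c * r) - linErr K ≤
      hh ψ x₀ (N + r) - hh ψ x₀ N + 8 := by
  have hW : (0 : ℝ) < Fintype.card W := by exact_mod_cast Fintype.card_pos
  set F : List W → ℤ := fun ω => ⌊2 ^ (N + r) * compWord ψ ω x₀⌋ with hF
  have hup : cent (words W (n + (l + P))) F (fun ω => F ω / 2 ^ r) ≤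
      hh ψ x₀ (N + r) - hh ψ x₀ N + 8 := by
    have h1 := cent_div_pow (S := words W (n + (l + P))) F (Nat.zero_le r)
    simp only [pow_zero, Int.ediv_one] at h1
    have h2 : (fun ω => F ω / 2 ^ r) = fun ω => ⌊2 ^ N * compWord ψ ω x₀⌋ := by
      funext ω
      rw [hF]; dsimp only
      rw [floor_div_pow]
      congr 1
      rw [pow_add]; field_simp
    have h3 := (abs_le.1 (hS.abs_ent_sub_hh h₀ (m := N + r) (M := n + (l + P)) (by omega))).2
    have h4 := (abs_le.1 (hS.abs_ent_sub_hh h₀ (m := N) (M := n + (l + P)) (by omega))).1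
    rw [h1, h2]
    linarith
  refine le_trans ?_ hup
  rw [← cent_bij (bijOn_append_swap (W := W) n l P) F (fun ω => F ω / 2 ^ r)]
  refine le_trans ?_ (cent_anti_right (Y' := fun p : List W × (List W × List W) =>
    (p.1, F (p.2.2 ++ (p.1 ++ p.2.1)) / 2 ^ r)) (by simp +contextual))
  rw [cent_prod_fst_pair ((words_nonempty _).product (words_nonempty _))]
  choose! σ hσ hmax using fun w (_ : w ∈ words W l) =>
    Finset.exists_max_image (words W P) (fun σ => gain ψ d n κ N r (compWord ψ (w ++ σ) x₀))
      (words_nonempty P)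
  have havg : (Fintype.card W : ℝ) ^ l * G ≤
      ∑ w ∈ words W l, gain ψ d n κ N r (compWord ψ (w ++ σ w) x₀) := by
    rw [sum_words_add] at hsum
    have : ∀ w ∈ words W l, ∑ v ∈ words W P, gain ψ d n κ N r (compWord ψ (w ++ v) x₀) ≤
        (Fintype.card W : ℝ) ^ P * gain ψ d n κ N r (compWord ψ (w ++ σ w) x₀) := by
      intro w hw
      have := Finset.sum_le_sum (hmax w hw)
      rwa [Finset.sum_const, nsmul_eq_mul, card_words, Nat.cast_pow] at this
    have := hsum.trans (Finset.sum_le_sum this)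
    rw [← Finset.mul_sum, pow_add, mul_comm ((Fintype.card W : ℝ) ^ l), mul_assoc] at this
    exact le_of_mul_le_mul_left this (by positivity)
  have hcard : ((words W l).card : ℝ) = (Fintype.card W : ℝ) ^ l := by
    rw [card_words, Nat.cast_pow]
  rw [hcard, le_div_iff₀ (by positivity)]
  have hpre : ∀ w ∈ words W l, (α - ε') * r + η * (gain ψ d n κ N r (compWord ψ (w ++ σ w) x₀) -
      (μ * L : ℕ) - c * r) - linErr K ≤ cent (words W P ×ˢ words W n)
        (fun p => F (p.2 ++ (w ++ p.1))) (fun p => F (p.2 ++ (w ++ p.1)) / 2 ^ r) := by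
    intro w hw
    have hwl := mem_words.1 hw
    have := prefix_bound hS hd h₀ (P := P) (w := w) (xw := compWord ψ (w ++ σ w) x₀)
      ⟨compWord ψ (σ w) x₀, hS.mapsTo _ h₀, by rw [compWord_append]⟩ hr hG hc hη hε' hT
      (n := n) (N := N) (κ := κ)
      (by rw [hwl]; exact hN1) (by rw [hwl]; exact hN2) (by rw [hwl]; exact hN3)
      (by rw [hwl]; exact hN4) b1 b2 b3
    simpa only [hF, compWord_append] using this
  refine le_trans ?_ (Finset.sum_le_sum hpre)
  have hs : ∑ w ∈ words W l, ((α - ε') * r + η * (gain ψ d n κ N r (compWord ψ (w ++ σ w) x₀) -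
      (μ * L : ℕ) - c * r) - linErr K) = (Fintype.card W : ℝ) ^ l * ((α - ε') * r +
      η * (- (μ * L : ℕ) - c * r) - linErr K) +
      η * ∑ w ∈ words W l, gain ψ d n κ N r (compWord ψ (w ++ σ w) x₀) := by
    rw [Finset.mul_sum, ← hcard, ← nsmul_eq_mul, ← Finset.sum_const, ← Finset.sum_add_distrib]
    exact Finset.sum_congr rfl fun f _ => by ring
  rw [hs]
  nlinarith [mul_le_mul_of_nonneg_left havg hη]

end Assembly

section Dimension

variable {W : Type} [Fintype W] [Nonempty W] {ψ : W → ℝ → ℝ} {d : List W → ℝ → ℝ} {t T : ℕ}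
  {D K : ℝ}

omit [Nonempty W] in
lemma eventually_rate_le {ψ : W → ℝ → ℝ} {x₀ α : ℝ}
    (hα : Tendsto (fun m : ℕ => hh ψ x₀ m / m) atTop (𝓝 α)) {ε : ℝ} (hε : 0 < ε) (C : ℝ) :
    ∃ M : ℕ, ∀ m ≥ M, (α - ε) * m ≤ hh ψ x₀ m - C := by
  have h1 : ∀ᶠ m : ℕ in atTop, α - ε / 2 < hh ψ x₀ m / m :=
    hα.eventually (lt_mem_nhds (by linarith))
  have h2 : ∀ᶠ m : ℕ in atTop, C / (ε / 2) < m :=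
    tendsto_natCast_atTop_atTop.eventually_gt_atTop _
  obtain ⟨M, hM⟩ := eventually_atTop.1 ((h1.and h2).and (eventually_gt_atTop 0))
  refine ⟨M, fun m hm => ?_⟩
  obtain ⟨⟨h3, h4⟩, h5⟩ := hM m hm
  have h5' : (0 : ℝ) < m := by exact_mod_cast h5
  rw [lt_div_iff₀ h5'] at h3
  rw [div_lt_iff₀ (by positivity)] at h4
  nlinarith

lemma prefix_length_bounds {t T τ n j Q N l : ℕ} (htT : t ≤ T) (hT : 1 ≤ T) (hτ : 1 ≤ τ)
    (hn : t ≤ n) (hj : j < Q) (hQ2 : (T - t) * (T + 3 * τ + Q * τ) ≤ (τ - 1) * T)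
    (hN : N = (T + 3 * τ) * n + j * (τ * n)) (hl : l = N / T - n) :
    N + τ * n ≤ (t + 2 * τ) * n + t * l ∧ N + τ * n ≤ t * n + 2 * (t * l) ∧
      T * (n + l) ≤ N := by
  have h1 : n ≤ N / T := by
    rw [Nat.le_div_iff_mul_le (by omega), hN]
    nlinarith [Nat.zero_le (τ * n), Nat.zero_le (j * (τ * n))]
  have h2 : l + n = N / T := by omega
  have h3 : T * (l + n) ≤ N := by rw [h2]; exact Nat.mul_div_le N T
  have h4 : N < T * (l + n) + T := by
    rw [h2]; have := Nat.lt_mul_div_succ N (show 0 < T by omega)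
    rwa [mul_add, mul_one] at this
  have h5 : (T - t) * N ≤ (τ - 1) * T * n := by
    calc (T - t) * N ≤ (T - t) * ((T + 3 * τ + Q * τ) * n) := by
          gcongr
          rw [hN]
          have : j * (τ * n) ≤ Q * (τ * n) := by gcongr
          nlinarith
      _ ≤ _ := by rw [← mul_assoc]; gcongr
  have h6 : (T + 3 * τ) * n ≤ N := by rw [hN]; omega
  have hT0 : (0 : ℤ) < T := by exact_mod_cast hT
  have htT' : (t : ℤ) ≤ T := by exact_mod_cast htT
  have hn' : (t : ℤ) ≤ n := by exact_mod_cast hn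
  have e1 := mul_nonneg (mul_nonneg hT0.le (sub_nonneg.2 htT')) (Int.natCast_nonneg n)
  have e2 := mul_nonneg hT0.le (sub_nonneg.2 hn')
  have e3 : (0 : ℤ) ≤ t := Int.natCast_nonneg t
  clear hN hl hQ2 h2 hn
  zify [htT, hτ] at *
  refine ⟨?_, ?_, by linarith⟩
  · refine le_of_mul_le_mul_left ?_ hT0
    nlinarith [mul_le_mul_of_nonneg_left h4.le e3]
  · refine le_of_mul_le_mul_left ?_ hT0
    nlinarith [mul_le_mul_of_nonneg_left h4.le e3, mul_le_mul_of_nonneg_left h6 hT0.le]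

lemma sum_gain_ge (hS : ConfSys ψ t T D) (hd : SmoothSys ψ d t T K) {x₀ α C₀ : ℝ}
    (h₀ : x₀ ∈ unitI) (hup : ∀ m, hh ψ x₀ m ≤ α * m + C₀) {τ qs p Q n : ℕ} (hτ : 1 ≤ τ)
    (ht1 : 2 * τ ≤ t) (ht2 : T + τ ≤ 2 * t) (htT : t ≤ T) (htp : qs + 1 ≤ t * p)
    (hQ1 : qs + 1 ≤ T + 3 * τ + Q * τ) (v : Fin p → List W) (C : ℝ)
    (hint : ∀ u ∈ words W n, ∀ u' ∈ words W n, ∀ w ∈ words W n, ∀ y ∈ unitI, ∀ δ : ℝ, 0 ≤ δ →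
      (∀ i, |compWord ψ u (compWord ψ w (compWord ψ (v i) y)) -
        compWord ψ u' (compWord ψ w (compWord ψ (v i) y))| ≤ δ) →
      ∀ z ∈ unitI, |compWord ψ u (compWord ψ w z) - compWord ψ u' (compWord ψ w z)| ≤
        C * (δ + (1 / 2) ^ (t * n * p)))
    (hcard : α * t + (T - t) + 6 * τ ≤ Real.logb 2 (Fintype.card W))
    (hsepn : ∀ u ∈ words W n, ∀ u' ∈ words W n, u ≠ u' → ∀ w ∈ words W n, ∃ z ∈ unitI,
      (1 / 2) ^ (qs * n) ≤ |compWord ψ u (compWord ψ w z) - compWord ψ u' (compWord ψ w z)|)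
    (M : ℕ) (hC : 2 * C < n)
    (hC₁ : 2 * (C₀ + (8 + Real.logb 2 7 + p * budgetErr K)) ≤ n) :
    ∀ w ∈ words W n, ∀ σ ∈ words W M, (((τ * n : ℕ) : ℝ) / 2 : ℝ) ≤
      ∑ i, ∑ j ∈ Finset.range Q,
        gain ψ d n ((t + 2 * τ) * n) ((T + 3 * τ) * n + j * (τ * n)) (τ * n)
        (compWord ψ w (compWord ψ (v i) (compWord ψ σ x₀))) := by
  have hτ' : (1 : ℝ) ≤ τ := by exact_mod_cast hτ
  intro w hw σ _
  have hσ := hS.mapsTo σ h₀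
  have hb := budget hS hd (τ := τ) (n := n) (p := p) (Q := Q) h₀ ht1 ht2 htT (mem_words.1 hw)
    (fun i => compWord ψ w (compWord ψ (v i) (compWord ψ σ x₀)))
    (fun i => ⟨_, hS.mapsTo _ hσ, rfl⟩) ?_
  · have h1 := hup (t * n)
    have h2 : n * (α * t + (T - t) + 6 * τ) ≤ n * Real.logb 2 (Fintype.card W) := by gcongr
    have hn0 : (n : ℝ) ≤ τ * n := le_mul_of_one_le_left (by positivity) hτ'
    push_cast at h1 ⊢
    linarith
  · intro u hu u' hu' heq
    by_contra hne
    obtain ⟨z, hz, hz2⟩ := hsepn u hu u' hu' hne w hw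
    have h1 := hint u hu u' hu' w hw _ hσ ((1 / 2) ^ ((T + 3 * τ + Q * τ) * n)) (by positivity) (fun i => ?_)
      z hz
    · have hCn : 2 * C < 2 ^ n := by
        have : (n : ℝ) < 2 ^ n := by exact_mod_cast Nat.lt_two_pow_self
        linarith
      have e1 : ((1 : ℝ) / 2) ^ ((T + 3 * τ + Q * τ) * n) ≤ (1 / 2) ^ (qs * n + n) :=
        pow_le_pow_of_le_one (by norm_num) (by norm_num) (by nlinarith)
      have e2 : ((1 : ℝ) / 2) ^ (t * n * p) ≤ (1 / 2) ^ (qs * n + n) :=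
        pow_le_pow_of_le_one (by norm_num) (by norm_num) (by nlinarith)
      have e3 : (2 : ℝ) ^ n * (1 / 2) ^ (qs * n + n) = (1 / 2) ^ (qs * n) := by
        rw [pow_add, mul_left_comm, ← mul_pow]; norm_num
      have e4 : (0 : ℝ) < (1 / 2) ^ (qs * n + n) := by positivity
      have e5 : (0 : ℝ) < (1 / 2) ^ ((T + 3 * τ + Q * τ) * n) := by positivity
      have e6 : (0 : ℝ) < (1 / 2) ^ (t * n * p) := by positivity
      have h2 := hz2.trans h1
      rw [← e3] at h2
      rcases le_or_gt C 0 with hC | hC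
      · have : C * ((1 / 2) ^ ((T + 3 * τ + Q * τ) * n) + (1 / 2) ^ (t * n * p)) ≤ 0 :=
          mul_nonpos_of_nonpos_of_nonneg hC (by positivity)
        have : (0 : ℝ) < 2 ^ n * (1 / 2) ^ (qs * n + n) := by positivity
        linarith
      · nlinarith [mul_le_mul_of_nonneg_left e1 hC.le, mul_le_mul_of_nonneg_left e2 hC.le]
    · have h2 := (Int.abs_sub_lt_one_of_floor_eq_floor (heq i)).le
      have e : (T + 3 * τ) * n + Q * (τ * n) = (T + 3 * τ + Q * τ) * n := by ring
      rw [e, ← mul_sub, abs_mul, abs_of_pos (by positivity)] at h2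
      rw [one_div, inv_pow, ← one_div, le_div_iff₀ (by positivity)]
      linarith

set_option maxHeartbeats 1000000 in
theorem card_lt_of_rate_lt_one (hS : ConfSys ψ t T D) (hd : SmoothSys ψ d t T K) {x₀ α C₀ : ℝ}
    (h₀ : x₀ ∈ unitI) (hα1 : α < 1) (hα : Tendsto (fun m : ℕ => hh ψ x₀ m / m) atTop (𝓝 α))
    (hup : ∀ m, hh ψ x₀ m ≤ α * m + C₀) {τ qs p Q k : ℕ} (hτ : 1 ≤ τ) (ht1 : 2 * τ ≤ t)
    (ht2 : T + τ ≤ 2 * t) (htT : t ≤ T) (hp : 0 < p) (hQ : 0 < Q) (htp : qs + 1 ≤ t * p)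
    (hQ1 : qs + 1 ≤ T + 3 * τ + Q * τ) (hQ2 : (T - t) * (T + 3 * τ + Q * τ) ≤ (τ - 1) * T)
    (v : Fin p → List W) (hv : ∀ i, (v i).length = k) (C : ℝ)
    (hint : ∀ n, ∀ u ∈ words W n, ∀ u' ∈ words W n, ∀ w ∈ words W n, ∀ y ∈ unitI, ∀ δ : ℝ, 0 ≤ δ →
      (∀ i, |compWord ψ u (compWord ψ w (compWord ψ (v i) y)) -
        compWord ψ u' (compWord ψ w (compWord ψ (v i) y))| ≤ δ) →
      ∀ z ∈ unitI, |compWord ψ u (compWord ψ w z) - compWord ψ u' (compWord ψ w z)| ≤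
        C * (δ + (1 / 2) ^ (t * n * p)))
    (hsep : ∀ m > 0, ∀ N, ∃ n ≥ N, m ∣ n ∧ ∀ u ∈ words W n, ∀ u' ∈ words W n, u ≠ u' →
      ∀ w ∈ words W n, ∃ z ∈ unitI,
        (1 / 2) ^ (qs * n) ≤ |compWord ψ u (compWord ψ w z) - compWord ψ u' (compWord ψ w z)|) :
    Real.logb 2 (Fintype.card W) < α * t + (T - t) + 6 * τ := by
  by_contra! hcon
  have hW : (0 : ℝ) < Fintype.card W := by exact_mod_cast Fintype.card_pos
  have hp' : (0 : ℝ) < p := by exact_mod_cast hp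
  have hQ' : (0 : ℝ) < Q := by exact_mod_cast hQ
  have hτ' : (1 : ℝ) ≤ τ := by exact_mod_cast hτ
  have hC₀ : 0 ≤ C₀ := by simpa using (ConfSys.hh_nonneg x₀ 0).trans (hup 0)
  set c : ℝ := 1 / (8 * p * Q * (Fintype.card W : ℝ) ^ k) with hc
  have hc0 : 0 < c := by positivity
  set g : ℕ := ⌈1 / c⌉₊ with hg
  have hg0 : 0 < g := Nat.ceil_pos.2 (by positivity)
  have hgc : 1 ≤ g * c := by
    have := Nat.le_ceil (1 / c)
    rwa [div_le_iff₀ hc0] at this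
  obtain ⟨ε, hε, m0, H⟩ := exists_growth hα1 hc0 g hg0
  obtain ⟨M1, hM1⟩ := eventually_rate_le hα hε (ConfSys.blockErr T D)
  set μ : ℕ := m0 + M1 + 1 with hμ
  have hμ1 : μ ≤ g * μ := Nat.le_mul_of_pos_left _ hg0
  obtain ⟨η, hη, L0, H⟩ := H μ (by omega) (by omega)
  set κ₀ : ℕ := T + 3 * τ + Q * τ with hκ₀
  have hκ₀' : (0 : ℝ) < κ₀ := by
    have : 0 < κ₀ := by omega
    exact_mod_cast this
  have hηc : 0 < η * c := by positivity
  obtain ⟨M2, hM2⟩ := eventually_rate_le hα hη (ConfSys.blockErr T D)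
  obtain ⟨M3, hM3⟩ := eventually_rate_le hα (ε := η * c / 2) (by positivity)
    (ConfSys.blockErr T D + 4)
  obtain ⟨M4, hM4⟩ := eventually_rate_le hα (ε := η * c / (2 * κ₀)) (by positivity) 0
  set C₁ : ℝ := 8 + Real.logb 2 7 + p * budgetErr K with hC₁
  obtain ⟨M5, hM5⟩ := exists_nat_gt (2 * C)
  obtain ⟨M6, hM6⟩ := exists_nat_gt (2 * (C₀ + C₁))
  obtain ⟨M7, hM7⟩ := exists_nat_gt ((linErr K + C₀ + 8) / (η * c))
  obtain ⟨n, hn, ⟨n', hn'⟩, hsepn⟩ := hsep (g * μ) (by omega)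
    (g * μ * L0 + T + M2 + M3 + M4 + M5 + M6 + M7 + 1)
  have hn1 : n ≤ τ * n := Nat.le_mul_of_pos_left _ hτ
  have hL : L0 ≤ τ * n' := by
    refine le_trans ?_ (Nat.le_mul_of_pos_left _ hτ)
    refine le_of_mul_le_mul_left (a := g * μ) ?_ (by omega)
    rw [← hn']; omega
  have hr : τ * n = g * μ * (τ * n') := by rw [hn']; ring
  have hrR : (n : ℝ) ≤ ((τ * n : ℕ) : ℝ) := by exact_mod_cast hn1
  set r : ℕ := τ * n with hr_def
  have hnM5 : (M5 : ℝ) ≤ n := by exact_mod_cast (by omega : M5 ≤ n)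
  have hnM6 : (M6 : ℝ) ≤ n := by exact_mod_cast (by omega : M6 ≤ n)
  have hnM7 : (M7 : ℝ) ≤ n := by exact_mod_cast (by omega : M7 ≤ n)
  have hsum := sum_gain_ge hS hd h₀ hup hτ ht1 ht2 htT htp hQ1 v C (hint n) hcon hsepn
    (κ₀ * n) (by linarith) (by linarith)
  obtain ⟨j, hj, hjs⟩ := exists_scale hp hQ x₀
    (fun j x => gain ψ d n ((t + 2 * τ) * n) ((T + 3 * τ) * n + j * r) r x)
    (fun _ _ => gain_nonneg _ _ _ _ _ _ _) v hv hsum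
  set N : ℕ := (T + 3 * τ) * n + j * r with hN
  set l : ℕ := N / T - n with hl
  obtain ⟨hN1, hN2, hN3⟩ := prefix_length_bounds htT (by omega) hτ (by omega) hj hQ2 hN hl
  have hNr : N + r ≤ κ₀ * n := by
    have : (j + 1) * r ≤ Q * r := by gcongr; omega
    have e : κ₀ * n = (T + 3 * τ) * n + Q * r := by rw [hκ₀, hr_def]; ring
    rw [e, hN]; linarith
  have hlN : l ≤ N := (Nat.sub_le _ _).trans (Nat.div_le_self _ _)
  have hNn : n ≤ N := by
    rw [hN]
    have : n ≤ (T + 3 * τ) * n := Nat.le_mul_of_pos_left _ (by omega)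
    omega
  obtain ⟨P, hP⟩ : ∃ P, n + (k + κ₀ * n) = l + P := ⟨n + (k + κ₀ * n) - l, by omega⟩
  have hrW : (0 : ℝ) ≤ r := by positivity
  have key := scale_bound hS hd h₀ (P := P) (G := 4 * c * r) (ε' := η * c / 2) hr (H _ hL) hc0.le
    hη.le (by positivity) (by omega) hN1 hN2 hN3 (by omega) (hM1 _ (by omega))
    (hM2 _ (by omega)) (by have := hM3 r (by omega); linarith) ?_
  · have h1 := hup (N + r)
    have h2 := hM4 N (by omega)
    have h3 : ((μ * (τ * n') : ℕ) : ℝ) ≤ c * r := by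
      have : (r : ℝ) = g * (μ * (τ * n') : ℕ) := by rw [hr]; push_cast; ring
      have h0 : (0 : ℝ) ≤ (μ * (τ * n') : ℕ) := by positivity
      rw [this]; nlinarith
    have h4 : η * c / (2 * κ₀) * N ≤ η * c / 2 * r := by
      have : (N : ℝ) ≤ κ₀ * n := by exact_mod_cast (by omega : N ≤ κ₀ * n)
      calc η * c / (2 * κ₀) * N ≤ η * c / (2 * κ₀) * (κ₀ * n) := by gcongr
        _ = η * c / 2 * n := by field_simp
        _ ≤ _ := by gcongr
    have h5 : linErr K + C₀ + 8 < η * c * r := by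
      rw [div_lt_iff₀ hηc] at hM7
      have h7 := mul_le_mul_of_nonneg_right (hnM7.trans hrR) hηc.le
      linarith
    rw [Nat.cast_add] at h1
    have h6 := mul_le_mul_of_nonneg_left h3 hη.le
    linarith
  · rw [hP] at hjs
    refine le_trans (le_of_eq ?_) hjs
    rw [← hP, hc]
    rw [show n + (k + κ₀ * n) = n + κ₀ * n + k by ring, pow_add _ _ k]
    field_simp
    ring

end Dimension

section Analysis

lemma convex_unitI : Convex ℝ unitI := convex_Icc 0 1
lemma isCompact_unitI : IsCompact unitI := isCompact_Icc

lemma uIcc_subset_unitI {x y : ℝ} (hx : x ∈ unitI) (hy : y ∈ unitI) : uIcc x y ⊆ unitI :=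
  convex_unitI.ordConnected.uIcc_subset hx hy

lemma exists_mvt_uIcc {f : ℝ → ℝ} (hf : ∀ x ∈ unitI, DifferentiableAt ℝ f x) {x y : ℝ}
    (hx : x ∈ unitI) (hy : y ∈ unitI) : ∃ ξ ∈ uIcc x y, f x - f y = deriv f ξ * (x - y) := by
  wlog hxy : y ≤ x generalizing x y
  · obtain ⟨ξ, hξ, h⟩ := this hy hx (le_of_not_ge hxy)
    exact ⟨ξ, uIcc_comm y x ▸ hξ, by linarith⟩
  rcases hxy.eq_or_lt with rfl | hlt
  · exact ⟨y, left_mem_uIcc, by simp⟩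
  · have hsub : Icc y x ⊆ unitI := by rw [← uIcc_of_le hxy]; exact uIcc_subset_unitI hy hx
    obtain ⟨ξ, hξ, h⟩ := exists_deriv_eq_slope f hlt
      (fun z hz => (hf z (hsub hz)).continuousAt.continuousWithinAt)
      (fun z hz => (hf z (hsub (Ioo_subset_Icc_self hz))).differentiableWithinAt)
    refine ⟨ξ, by rw [uIcc_of_ge hxy]; exact Ioo_subset_Icc_self hξ, ?_⟩
    rw [h, div_mul_cancel₀ _ (by linarith)]

lemma exists_mvt {f : ℝ → ℝ} (hf : ∀ x ∈ unitI, DifferentiableAt ℝ f x) {x y : ℝ}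
    (hx : x ∈ unitI) (hy : y ∈ unitI) : ∃ ξ ∈ unitI, f x - f y = deriv f ξ * (x - y) := by
  obtain ⟨ξ, hξ, h⟩ := exists_mvt_uIcc hf hx hy
  exact ⟨ξ, uIcc_subset_unitI hx hy hξ, h⟩

lemma mul_pos_of_ne_zero_on {f : ℝ → ℝ} (hf : ContinuousOn f unitI) (h0 : ∀ x ∈ unitI, f x ≠ 0)
    {x y : ℝ} (hx : x ∈ unitI) (hy : y ∈ unitI) : 0 < f x * f y := by
  by_contra! hcon
  have hz : (0 : ℝ) ∈ uIcc (f x) (f y) := by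
    rw [mem_uIcc]
    rcases mul_nonpos_iff.1 hcon with h | h
    · exact Or.inr ⟨h.2, h.1⟩
    · exact Or.inl h
  obtain ⟨z, hz, hz0⟩ := intermediate_value_uIcc (hf.mono (uIcc_subset_unitI hx hy)) hz
  exact h0 z (uIcc_subset_unitI hx hy hz) hz0

variable {Λ : Type} {φ : Λ → ℝ → ℝ}

lemma analyticOnNhd_compWord (hanal : ∀ i, AnalyticOnNhd ℝ (φ i) unitI)
    (hmaps : ∀ i, MapsTo (φ i) unitI unitI) (u : List Λ) :
    AnalyticOnNhd ℝ (compWord φ u) unitI := by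
  induction u with
  | nil => exact analyticOnNhd_id
  | cons i u ih =>
    exact fun x hx => (hanal i _ (mapsTo_compWord hmaps u hx)).comp (ih x hx)

lemma compWord_append_eq_comp (u v : List Λ) :
    compWord φ (u ++ v) = compWord φ u ∘ compWord φ v :=
  funext fun x => compWord_append _ u v x

lemma deriv_compWord_append (hanal : ∀ i, AnalyticOnNhd ℝ (φ i) unitI)
    (hmaps : ∀ i, MapsTo (φ i) unitI unitI) (u v : List Λ) {x : ℝ} (hx : x ∈ unitI) :
    deriv (compWord φ (u ++ v)) x =
      deriv (compWord φ u) (compWord φ v x) * deriv (compWord φ v) x := by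
  rw [compWord_append_eq_comp]
  exact deriv_comp x
    (analyticOnNhd_compWord hanal hmaps u _ (mapsTo_compWord hmaps v hx)).differentiableAt
    (analyticOnNhd_compWord hanal hmaps v x hx).differentiableAt

lemma deriv_compWord_cons (hanal : ∀ i, AnalyticOnNhd ℝ (φ i) unitI)
    (hmaps : ∀ i, MapsTo (φ i) unitI unitI) (i : Λ) (u : List Λ) {x : ℝ} (hx : x ∈ unitI) :
    deriv (compWord φ (i :: u)) x = deriv (φ i) (compWord φ u x) * deriv (compWord φ u) x :=
  deriv_compWord_append hanal hmaps [i] u hx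

lemma deriv_compWord_nil (x : ℝ) : deriv (compWord φ []) x = 1 := deriv_id x

/-- An analytic system of contractions of `[0,1]` with uniform bounds and bounded distortion. -/
structure AnSys (φ : Λ → ℝ → ℝ) (b lam K : ℝ) : Prop where
  an : ∀ i, AnalyticOnNhd ℝ (φ i) unitI
  maps : ∀ i, MapsTo (φ i) unitI unitI
  pos : 0 < b
  lt_one : lam < 1
  lo : ∀ i, ∀ x ∈ unitI, b ≤ |deriv (φ i) x|
  hi : ∀ i, ∀ x ∈ unitI, |deriv (φ i) x| ≤ lam
  nonneg : 0 ≤ K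
  dist : ∀ u, ∀ x ∈ unitI, ∀ y ∈ unitI,
    |deriv (compWord φ u) x - deriv (compWord φ u) y| ≤ K * |deriv (compWord φ u) y| * |x - y|

lemma exists_bounds_finite {ι : Type} [Finite ι] {f : ι → ℝ → ℝ}
    (hf : ∀ i, ContinuousOn (f i) unitI) : ∃ C, 0 ≤ C ∧ ∀ i, ∀ x ∈ unitI, |f i x| ≤ C := by
  have := Fintype.ofFinite ι
  choose C hC using fun i => isCompact_unitI.exists_bound_of_continuousOn (hf i)
  refine ⟨∑ i, |C i|, Finset.sum_nonneg fun i _ => abs_nonneg _, fun i x hx => ?_⟩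
  refine ((hC i x hx).trans (le_abs_self _)).trans ?_
  exact Finset.single_le_sum (f := fun i => |C i|) (fun i _ => abs_nonneg _) (Finset.mem_univ i)

lemma word_abs_deriv_ne_zero (hanal : ∀ i, AnalyticOnNhd ℝ (φ i) unitI)
    (hmaps : ∀ i, MapsTo (φ i) unitI unitI) (h0 : ∀ i, ∀ x ∈ unitI, deriv (φ i) x ≠ 0)
    (u : List Λ) {x : ℝ} (hx : x ∈ unitI) : deriv (compWord φ u) x ≠ 0 := by
  induction u with
  | nil => rw [deriv_compWord_nil]; exact one_ne_zero
  | cons i u ih =>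
    rw [deriv_compWord_cons hanal hmaps i u hx]
    exact mul_ne_zero (h0 i _ (mapsTo_compWord hmaps u hx)) ih

lemma abs_compWord_sub_le {lam : ℝ} (hanal : ∀ i, AnalyticOnNhd ℝ (φ i) unitI)
    (hmaps : ∀ i, MapsTo (φ i) unitI unitI) (hi : ∀ i, ∀ x ∈ unitI, |deriv (φ i) x| ≤ lam)
    (hlam : 0 ≤ lam) (u : List Λ) {x y : ℝ} (hx : x ∈ unitI) (hy : y ∈ unitI) :
    |compWord φ u x - compWord φ u y| ≤ lam ^ u.length * |x - y| := by
  induction u with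
  | nil => simp [compWord]
  | cons i u ih =>
    obtain ⟨ξ, hξ, h⟩ := exists_mvt (fun z hz => (hanal i z hz).differentiableAt)
      (mapsTo_compWord hmaps u hx) (mapsTo_compWord hmaps u hy)
    simp only [compWord, Function.comp_apply, List.length_cons]
    rw [h, abs_mul, pow_succ', mul_assoc]
    exact mul_le_mul (hi i ξ hξ) ih (abs_nonneg _) hlam

theorem exists_anSys [Finite Λ] [Nonempty Λ] (hanal : ∀ i, AnalyticOnNhd ℝ (φ i) unitI)
    (hmaps : ∀ i, MapsTo (φ i) unitI unitI)
    (hderiv : ∀ i, ∀ x ∈ unitI, 0 < |deriv (φ i) x| ∧ |deriv (φ i) x| < 1) :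
    ∃ b lam K, AnSys φ b lam K := by
  have hcont : ∀ i, ContinuousOn (fun x => deriv (φ i) x) unitI :=
    fun i => (hanal i).deriv.continuousOn
  have h0 : ∀ i, ∀ x ∈ unitI, deriv (φ i) x ≠ 0 := fun i x hx => abs_pos.1 (hderiv i x hx).1
  have hne : unitI.Nonempty := ⟨0, zero_mem_unitI⟩
  choose p hp hpmax using fun i => isCompact_unitI.exists_isMaxOn hne (hcont i).abs
  choose q hq hqmin using fun i => isCompact_unitI.exists_isMinOn hne (hcont i).abs
  obtain ⟨i₁, h1⟩ := Finite.exists_max fun i => |deriv (φ i) (p i)|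
  obtain ⟨i₂, h2⟩ := Finite.exists_min fun i => |deriv (φ i) (q i)|
  set lam := |deriv (φ i₁) (p i₁)| with hlam
  set b := |deriv (φ i₂) (q i₂)| with hb
  have hhi : ∀ i, ∀ x ∈ unitI, |deriv (φ i) x| ≤ lam := fun i x hx => (hpmax i hx).trans (h1 i)
  have hlo : ∀ i, ∀ x ∈ unitI, b ≤ |deriv (φ i) x| := fun i x hx => (h2 i).trans (hqmin i hx)
  have hlam1 : lam < 1 := (hderiv _ _ (hp _)).2
  have hlam0 : 0 ≤ lam := abs_nonneg _
  obtain ⟨L, hL0, hL⟩ := exists_bounds_finite (ι := Λ)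
    (f := fun i x => deriv (deriv (φ i)) x / deriv (φ i) x)
    (fun i => (hanal i).deriv.deriv.continuousOn.div (hcont i) (h0 i))
  have hlog : ∀ i, ∀ x ∈ unitI, ∀ y ∈ unitI,
      |Real.log (deriv (φ i) x) - Real.log (deriv (φ i) y)| ≤ L * |x - y| := by
    intro i x hx y hy
    have hd : ∀ z ∈ unitI, HasDerivAt (fun x => Real.log (deriv (φ i) x))
        (deriv (deriv (φ i)) z / deriv (φ i) z) z := fun z hz =>
      ((hanal i).deriv z hz).differentiableAt.hasDerivAt.log (h0 i z hz)
    obtain ⟨ξ, hξ, h⟩ := exists_mvt (fun z hz => (hd z hz).differentiableAt) hx hy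
    rw [h, abs_mul, (hd ξ hξ).deriv]
    exact mul_le_mul_of_nonneg_right (hL i ξ hξ) (abs_nonneg _)
  set K₀ := L / (1 - lam) with hK₀
  have hK₀0 : 0 ≤ K₀ := div_nonneg hL0 (by linarith)
  have hw0 : ∀ u, ∀ x ∈ unitI, deriv (compWord φ u) x ≠ 0 :=
    fun u x hx => word_abs_deriv_ne_zero hanal hmaps h0 u hx
  have hwlog : ∀ u : List Λ, ∀ x ∈ unitI, ∀ y ∈ unitI,
      |Real.log (deriv (compWord φ u) x) - Real.log (deriv (compWord φ u) y)| ≤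
        K₀ * (1 - lam ^ u.length) * |x - y| := by
    intro u
    induction u with
    | nil => intro x _ y _; simp [deriv_compWord_nil]
    | cons i u ih =>
      intro x hx y hy
      have hux := mapsTo_compWord hmaps u hx
      have huy := mapsTo_compWord hmaps u hy
      rw [deriv_compWord_cons hanal hmaps i u hx, deriv_compWord_cons hanal hmaps i u hy,
        Real.log_mul (h0 i _ hux) (hw0 u x hx), Real.log_mul (h0 i _ huy) (hw0 u y hy)]
      have e1 := hlog i _ hux _ huy
      have e2 := ih x hx y hy
      have e3 := abs_compWord_sub_le hanal hmaps hhi hlam0 u hx hy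
      have e4 := mul_le_mul_of_nonneg_left e3 hL0
      have e5 : L = K₀ * (1 - lam) := by rw [hK₀, div_mul_cancel₀]; linarith
      calc _ = |(Real.log (deriv (φ i) (compWord φ u x)) -
            Real.log (deriv (φ i) (compWord φ u y))) +
            (Real.log (deriv (compWord φ u) x) - Real.log (deriv (compWord φ u) y))| := by
            congr 1; ring
        _ ≤ L * (lam ^ u.length * |x - y|) + K₀ * (1 - lam ^ u.length) * |x - y| :=
            (abs_add_le _ _).trans (add_le_add (e1.trans e4) e2)
        _ = _ := by rw [e5, List.length_cons, pow_succ]; ring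
  refine ⟨b, lam, K₀ * Real.exp (2 * K₀), hanal, hmaps, (hderiv _ _ (hq _)).1, hlam1, hlo, hhi,
    by positivity, fun u x hx y hy => ?_⟩
  set M := K₀ * |x - y| with hM
  have hM0 : 0 ≤ M := by positivity
  have hMK : M ≤ K₀ := mul_le_of_le_one_right hK₀0 (abs_sub_le_one_of_mem hx hy)
  have hlogM : |Real.log (deriv (compWord φ u) x) - Real.log (deriv (compWord φ u) y)| ≤ M := by
    refine (hwlog u x hx y hy).trans ?_
    refine mul_le_mul_of_nonneg_right ?_ (abs_nonneg _)
    exact mul_le_of_le_one_right hK₀0 (by linarith [pow_nonneg hlam0 u.length])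
  rw [← Real.log_abs (deriv (compWord φ u) x), ← Real.log_abs (deriv (compWord φ u) y),
    abs_le] at hlogM
  have hsign := mul_pos_of_ne_zero_on (analyticOnNhd_compWord hanal hmaps u).deriv.continuousOn
    (hw0 u) hx hy
  have hpx := abs_pos.2 (hw0 u x hx)
  have hpy := abs_pos.2 (hw0 u y hy)
  set P := |deriv (compWord φ u) x| with hP
  set R := |deriv (compWord φ u) y| with hR
  have habs : |deriv (compWord φ u) x - deriv (compWord φ u) y| = |P - R| := by
    rcases pos_and_pos_or_neg_and_neg_of_mul_pos hsign with h | h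
    · rw [hP, hR, abs_of_pos h.1, abs_of_pos h.2]
    · rw [hP, hR, abs_of_neg h.1, abs_of_neg h.2, ← abs_neg]; congr 1; ring
  have hPR : P ≤ R * Real.exp M := by
    rw [← Real.log_le_log_iff hpx (by positivity), Real.log_mul hpy.ne' (Real.exp_ne_zero _),
      Real.log_exp]
    linarith [hlogM.2]
  have hRP : R ≤ P * Real.exp M := by
    rw [← Real.log_le_log_iff hpy (by positivity), Real.log_mul hpx.ne' (Real.exp_ne_zero _),
      Real.log_exp]
    linarith [hlogM.1]
  have hexp : Real.exp M - 1 ≤ M * Real.exp M := by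
    have h1 := Real.add_one_le_exp (-M)
    have h2 : Real.exp (-M) * Real.exp M = 1 := by rw [← Real.exp_add]; simp
    nlinarith [Real.exp_pos M]
  have hexp1 : 1 ≤ Real.exp M := Real.one_le_exp hM0
  have hexp2 : Real.exp M * Real.exp M ≤ Real.exp (2 * K₀) := by
    rw [← Real.exp_add]; exact Real.exp_le_exp.2 (by linarith)
  have h5 : R * (M * Real.exp M * Real.exp M) ≤ R * (M * Real.exp (2 * K₀)) := by
    rw [mul_assoc M]; gcongr
  have h6 : R * (M * Real.exp M) ≤ R * (M * Real.exp M * Real.exp M) := by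
    refine mul_le_mul_of_nonneg_left ?_ hpy.le
    exact le_mul_of_one_le_right (by positivity) hexp1
  have h7 : K₀ * Real.exp (2 * K₀) * R * |x - y| = R * (M * Real.exp (2 * K₀)) := by
    rw [hM]; ring
  rw [habs, h7, abs_le]
  constructor
  · have : R - P ≤ P * (M * Real.exp M) := by
      have := mul_le_mul_of_nonneg_left hexp hpx.le
      linarith
    have h8 : P * (M * Real.exp M) ≤ R * Real.exp M * (M * Real.exp M) := by gcongr
    linarith
  · have := mul_le_mul_of_nonneg_left hexp hpy.le
    linarith

end Analysis

section Systems

variable {Λ : Type} {φ : Λ → ℝ → ℝ} {b lam K : ℝ}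

namespace AnSys

variable (hA : AnSys φ b lam K)

include hA

lemma an_word (u : List Λ) : AnalyticOnNhd ℝ (compWord φ u) unitI :=
  analyticOnNhd_compWord hA.an hA.maps u

lemma mapsTo (u : List Λ) : MapsTo (compWord φ u) unitI unitI := mapsTo_compWord hA.maps u

lemma differentiableAt (u : List Λ) : ∀ x ∈ unitI, DifferentiableAt ℝ (compWord φ u) x :=
  fun x hx => (hA.an_word u x hx).differentiableAt

lemma pow_le_abs_deriv (u : List Λ) {x : ℝ} (hx : x ∈ unitI) :
    b ^ u.length ≤ |deriv (compWord φ u) x| := by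
  induction u with
  | nil => simp [deriv_compWord_nil]
  | cons i u ih =>
    rw [deriv_compWord_cons hA.an hA.maps i u hx, abs_mul, List.length_cons, pow_succ']
    exact mul_le_mul (hA.lo i _ (hA.mapsTo u hx)) ih (pow_nonneg hA.pos.le _) (abs_nonneg _)

lemma abs_deriv_pos (u : List Λ) {x : ℝ} (hx : x ∈ unitI) : 0 < |deriv (compWord φ u) x| :=
  (pow_pos hA.pos _).trans_le (hA.pow_le_abs_deriv u hx)

lemma abs_deriv_le_pow (u : List Λ) {x : ℝ} (hx : x ∈ unitI) :
    |deriv (compWord φ u) x| ≤ lam ^ u.length := by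
  induction u with
  | nil => simp [deriv_compWord_nil]
  | cons i u ih =>
    rw [deriv_compWord_cons hA.an hA.maps i u hx, abs_mul, List.length_cons, pow_succ']
    have h := hA.hi i _ (hA.mapsTo u hx)
    exact mul_le_mul h ih (abs_nonneg _) ((abs_nonneg _).trans h)

lemma abs_deriv_le (u : List Λ) {x y : ℝ} (hx : x ∈ unitI) (hy : y ∈ unitI) :
    |deriv (compWord φ u) x| ≤ (1 + K) * |deriv (compWord φ u) y| := by
  have h := hA.dist u x hx y hy
  have h1 := abs_sub_abs_le_abs_sub (deriv (compWord φ u) x) (deriv (compWord φ u) y)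
  have h2 : K * |deriv (compWord φ u) y| * |x - y| ≤ K * |deriv (compWord φ u) y| :=
    mul_le_of_le_one_right (mul_nonneg hA.nonneg (abs_nonneg _)) (abs_sub_le_one_of_mem hx hy)
  linarith

lemma abs_sub_le (u : List Λ) {x y z : ℝ} (hx : x ∈ unitI) (hy : y ∈ unitI) (hz : z ∈ unitI) :
    |compWord φ u x - compWord φ u y| ≤ (1 + K) * |deriv (compWord φ u) z| * |x - y| := by
  obtain ⟨ξ, hξ, h⟩ := exists_mvt (hA.differentiableAt u) hx hy
  rw [h, abs_mul]
  exact mul_le_mul_of_nonneg_right (hA.abs_deriv_le u hξ hz) (abs_nonneg _)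

lemma le_abs_sub (u : List Λ) {x y z : ℝ} (hx : x ∈ unitI) (hy : y ∈ unitI) (hz : z ∈ unitI) :
    |deriv (compWord φ u) z| * |x - y| ≤ (1 + K) * |compWord φ u x - compWord φ u y| := by
  obtain ⟨ξ, hξ, h⟩ := exists_mvt (hA.differentiableAt u) hx hy
  rw [h, abs_mul, ← mul_assoc]
  exact mul_le_mul_of_nonneg_right (hA.abs_deriv_le u hz hξ) (abs_nonneg _)

lemma taylor_le (u : List Λ) {y z : ℝ} (hy : y ∈ unitI) (hz : z ∈ unitI) :
    |compWord φ u z - compWord φ u y - deriv (compWord φ u) y * (z - y)| ≤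
      K * |deriv (compWord φ u) y| * |z - y| ^ 2 := by
  obtain ⟨ξ, hξ, h⟩ := exists_mvt_uIcc (hA.differentiableAt u) hz hy
  have hξy : |ξ - y| ≤ |z - y| := by
    rw [abs_sub_comm ξ, abs_sub_comm z]; exact abs_sub_right_of_mem_uIcc hξ
  rw [h, ← sub_mul, abs_mul, pow_two, ← mul_assoc]
  refine mul_le_mul_of_nonneg_right ?_ (abs_nonneg _)
  exact (hA.dist u ξ (uIcc_subset_unitI hz hy hξ) y hy).trans
    (mul_le_mul_of_nonneg_left hξy (mul_nonneg hA.nonneg (abs_nonneg _)))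

end AnSys

variable {W : Type} {wd : W → List Λ}

lemma compWord_flatMap (U : List W) :
    compWord (fun a => compWord φ (wd a)) U = compWord φ (U.flatMap wd) := by
  induction U with
  | nil => rfl
  | cons a U ih => rw [List.flatMap_cons, compWord_append_eq_comp, ← ih]; rfl

variable {t T : ℕ}

lemma AnSys.flat_bounds (hA : AnSys φ b lam K)
    (hlo : ∀ a, ∀ x ∈ unitI, (1 / 2) ^ T ≤ |deriv (compWord φ (wd a)) x|)
    (hhi : ∀ a, ∀ x ∈ unitI, |deriv (compWord φ (wd a)) x| ≤ (1 / 2) ^ t) (U : List W) {x : ℝ}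
    (hx : x ∈ unitI) : (1 / 2) ^ (T * U.length) ≤ |deriv (compWord φ (U.flatMap wd)) x| ∧
      |deriv (compWord φ (U.flatMap wd)) x| ≤ (1 / 2) ^ (t * U.length) := by
  induction U with
  | nil => simp [deriv_compWord_nil]
  | cons a U ih =>
    rw [List.flatMap_cons, deriv_compWord_append hA.an hA.maps _ _ hx, abs_mul, List.length_cons,
      mul_add_one, mul_add_one, add_comm, add_comm (t * _), pow_add, pow_add]
    have hx' := hA.mapsTo (U.flatMap wd) hx
    exact ⟨mul_le_mul (hlo a _ hx') ih.1 (by positivity) (abs_nonneg _),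
      mul_le_mul (hhi a _ hx') ih.2 (abs_nonneg _) (by positivity)⟩

lemma AnSys.confSys (hA : AnSys φ b lam K) (ht : 1 ≤ t)
    (hlo : ∀ a, ∀ x ∈ unitI, (1 / 2) ^ T ≤ |deriv (compWord φ (wd a)) x|)
    (hhi : ∀ a, ∀ x ∈ unitI, |deriv (compWord φ (wd a)) x| ≤ (1 / 2) ^ t) :
    ConfSys (fun a => compWord φ (wd a)) t T ((1 + K) * (1 + K)) where
  maps a := hA.mapsTo (wd a)
  up a x hx y hy := by
    obtain ⟨ξ, hξ, h⟩ := exists_mvt (hA.differentiableAt (wd a)) hx hy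
    rw [h, abs_mul]
    exact mul_le_mul_of_nonneg_right (hhi a ξ hξ) (abs_nonneg _)
  lo a x hx y hy := by
    obtain ⟨ξ, hξ, h⟩ := exists_mvt (hA.differentiableAt (wd a)) hx hy
    rw [h, abs_mul]
    exact mul_le_mul_of_nonneg_right (hlo a ξ hξ) (abs_nonneg _)
  dist U x hx y hy := by
    rw [compWord_flatMap]
    have h1 := hA.abs_sub_le (U.flatMap wd) zero_mem_unitI one_mem_unitI hx
    have h2 := hA.le_abs_sub (U.flatMap wd) hx hy hx
    have hK := hA.nonneg
    norm_num at h1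
    calc _ ≤ (1 + K) * |deriv (compWord φ (U.flatMap wd)) x| * |x - y| := by gcongr
      _ ≤ _ := by rw [mul_assoc, mul_assoc]; gcongr
  dist_up U x hx y hy := by
    rw [compWord_flatMap]
    have h1 := hA.le_abs_sub (U.flatMap wd) zero_mem_unitI one_mem_unitI hx
    have h2 := hA.abs_sub_le (U.flatMap wd) hx hy hx
    have hK := hA.nonneg
    norm_num at h1
    refine h2.trans (mul_le_mul_of_nonneg_right ?_ (abs_nonneg _))
    rw [mul_assoc]; gcongr
  one_le_D := by nlinarith [hA.nonneg]
  one_le_t := ht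

lemma AnSys.smoothSys (hA : AnSys φ b lam K)
    (hlo : ∀ a, ∀ x ∈ unitI, (1 / 2) ^ T ≤ |deriv (compWord φ (wd a)) x|)
    (hhi : ∀ a, ∀ x ∈ unitI, |deriv (compWord φ (wd a)) x| ≤ (1 / 2) ^ t) :
    SmoothSys (fun a => compWord φ (wd a))
      (fun U => deriv (compWord (fun a => compWord φ (wd a)) U)) t T K where
  taylor U y hy z hz := by
    rw [compWord_flatMap]
    refine (hA.taylor_le _ hy hz).trans (mul_le_mul_of_nonneg_right ?_ (by positivity))
    exact mul_le_mul_of_nonneg_left (hA.flat_bounds hlo hhi U hy).2 hA.nonneg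
  dlip U x hx y hy := by
    simp only [compWord_flatMap]
    refine (hA.dist _ x hx y hy).trans (mul_le_mul_of_nonneg_right ?_ (by positivity))
    exact mul_le_mul_of_nonneg_left (hA.flat_bounds hlo hhi U hy).2 hA.nonneg
  dlo U x hx := by rw [compWord_flatMap]; exact (hA.flat_bounds hlo hhi U hx).1
  dup U x hx := by rw [compWord_flatMap]; exact (hA.flat_bounds hlo hhi U hx).2
  nonneg := hA.nonneg

end Systems

section DerivativeBounds

/-- The derivatives up to order `p` are bounded on `[0,1]`, uniformly over the family. -/
def BddDer {ι : Type} (p : ℕ) (F : ι → ℝ → ℝ) : Prop :=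
  ∃ C, 0 ≤ C ∧ ∀ i, ∀ j ≤ p, ∀ x ∈ unitI, |iteratedDeriv j (F i) x| ≤ C

variable {ι κ : Type} {p : ℕ} {F : ι → ℝ → ℝ} {G : κ → ℝ → ℝ}

lemma BddDer.mono {q : ℕ} (h : BddDer p F) (hq : q ≤ p) : BddDer q F := by
  obtain ⟨C, hC, h⟩ := h
  exact ⟨C, hC, fun i j hj => h i j (hj.trans hq)⟩

lemma BddDer.deriv_family (h : BddDer (p + 1) F) : BddDer p fun i => deriv (F i) := by
  obtain ⟨C, hC, h⟩ := h
  exact ⟨C, hC, fun i j hj x hx => by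
    rw [← iteratedDeriv_succ']; exact h i (j + 1) (by omega) x hx⟩

lemma BddDer.of_deriv (h0 : BddDer 0 F) (h : BddDer p fun i => deriv (F i)) :
    BddDer (p + 1) F := by
  obtain ⟨C, hC, h⟩ := h
  obtain ⟨C', hC', h0⟩ := h0
  refine ⟨max C C', hC.trans (le_max_left _ _), fun i j hj x hx => ?_⟩
  rcases j with _ | j
  · exact (h0 i 0 le_rfl x hx).trans (le_max_right _ _)
  · rw [iteratedDeriv_succ']
    exact (h i j (by omega) x hx).trans (le_max_left _ _)

lemma BddDer.congr {F' : ι → ℝ → ℝ} (h : BddDer p F)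
    (hF : ∀ i, ∀ x ∈ unitI, F i =ᶠ[𝓝 x] F' i) : BddDer p F' := by
  obtain ⟨C, hC, h⟩ := h
  exact ⟨C, hC, fun i j hj x hx => by
    rw [← (hF i x hx).iteratedDeriv_eq]; exact h i j hj x hx⟩

lemma BddDer.mul {G : ι → ℝ → ℝ} (hF : ∀ i, AnalyticOnNhd ℝ (F i) unitI)
    (hG : ∀ i, AnalyticOnNhd ℝ (G i) unitI) (h : BddDer p F) (h' : BddDer p G) :
    BddDer p fun i => F i * G i := by
  obtain ⟨C, hC, h⟩ := h
  obtain ⟨C', hC', h'⟩ := h'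
  refine ⟨2 ^ p * (C * C'), by positivity, fun i j hj x hx => ?_⟩
  rw [iteratedDeriv_mul (hF i x hx).contDiffAt (hG i x hx).contDiffAt]
  refine (Finset.abs_sum_le_sum_abs _ _).trans ?_
  have : ∀ k ∈ Finset.range (j + 1), |(j.choose k : ℝ) * iteratedDeriv k (F i) x *
      iteratedDeriv (j - k) (G i) x| ≤ j.choose k * (C * C') := by
    intro k hk
    rw [Finset.mem_range] at hk
    rw [abs_mul, abs_mul, Nat.abs_cast, mul_assoc]
    exact mul_le_mul_of_nonneg_left (mul_le_mul (h i k (by omega) x hx)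
      (h' i (j - k) (by omega) x hx) (abs_nonneg _) hC) (Nat.cast_nonneg _)
  refine (Finset.sum_le_sum this).trans ?_
  rw [← Finset.sum_mul, ← Nat.cast_sum, Nat.sum_range_choose]
  push_cast
  exact mul_le_mul_of_nonneg_right (pow_le_pow_right₀ (by norm_num) hj) (by positivity)

lemma eventuallyEq_deriv_comp {g f : ℝ → ℝ} {x : ℝ} (hf : AnalyticAt ℝ f x)
    (hg : AnalyticAt ℝ g (f x)) :
    (fun y => deriv g (f y)) * deriv f =ᶠ[𝓝 x] deriv (g ∘ f) := by
  filter_upwards [hf.eventually_analyticAt, hf.continuousAt.eventually hg.eventually_analyticAt]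
    with y h1 h2
  exact (deriv_comp y h2.differentiableAt h1.differentiableAt).symm

lemma BddDer.comp (hF : ∀ i, AnalyticOnNhd ℝ (F i) unitI)
    (hG : ∀ k, AnalyticOnNhd ℝ (G k) unitI) (hmaps : ∀ i, MapsTo (F i) unitI unitI)
    (h : BddDer p F) (h' : BddDer p G) :
    BddDer p fun q : κ × ι => G q.1 ∘ F q.2 := by
  induction p generalizing G with
  | zero =>
    obtain ⟨C, hC, h'⟩ := h'
    exact ⟨C, hC, fun q j hj x hx => by
      obtain rfl := Nat.le_zero.1 hj
      simpa using h' q.1 0 le_rfl _ (hmaps q.2 hx)⟩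
  | succ p ih =>
    refine BddDer.of_deriv ?_ ?_
    · obtain ⟨C, hC, h'⟩ := h'
      exact ⟨C, hC, fun q j hj x hx => by
        obtain rfl := Nat.le_zero.1 hj
        simpa using h' q.1 0 (by omega) _ (hmaps q.2 hx)⟩
    · have h1 := ih (fun k => (hG k).deriv) (h.mono (by omega)) h'.deriv_family
      have h2 : BddDer p fun q : κ × ι => deriv (F q.2) := by
        obtain ⟨C, hC, h⟩ := h.deriv_family
        exact ⟨C, hC, fun q => h q.2⟩
      refine (BddDer.mul (fun q x hx => ?_) (fun q => (hF q.2).deriv) h1 h2).congr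
        fun q x hx => ?_
      · exact ((hG q.1).deriv _ (hmaps q.2 hx)).comp (hF q.2 x hx)
      · exact eventuallyEq_deriv_comp (hF q.2 x hx) (hG q.1 _ (hmaps q.2 hx))

lemma bddDer_of_finite [Finite κ] (hG : ∀ k, AnalyticOnNhd ℝ (G k) unitI) (p : ℕ) :
    BddDer p G := by
  induction p generalizing G with
  | zero =>
    obtain ⟨C, hC, h⟩ := exists_bounds_finite fun k => (hG k).continuousOn
    exact ⟨C, hC, fun k j hj x hx => by obtain rfl := Nat.le_zero.1 hj; simpa using h k x hx⟩
  | succ p ih => exact BddDer.of_deriv ((ih hG).mono (Nat.zero_le p)) (ih fun k => (hG k).deriv)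

variable {Λ : Type} {φ : Λ → ℝ → ℝ} {b lam K : ℝ}

theorem AnSys.bddDer [Finite Λ] [Nonempty Λ] (hA : AnSys φ b lam K) (p : ℕ) :
    BddDer p fun u : List Λ => compWord φ u := by
  have hlam : 0 ≤ lam := (abs_nonneg _).trans (hA.hi (Classical.arbitrary Λ) 0 zero_mem_unitI)
  induction p with
  | zero =>
    refine ⟨1, zero_le_one, fun u j hj x hx => ?_⟩
    obtain rfl := Nat.le_zero.1 hj
    have := hA.mapsTo u hx
    simp only [unitI, Set.mem_Icc] at this
    rw [iteratedDeriv_zero, abs_of_nonneg this.1]; exact this.2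
  | succ p ih =>
    obtain ⟨C', hC', h'⟩ := BddDer.comp (G := fun i => deriv (φ i)) (fun u => hA.an_word u)
      (fun i => (hA.an i).deriv) (fun u => hA.mapsTo u) ih
      (bddDer_of_finite (fun i => (hA.an i).deriv) p)
    obtain ⟨C, hC, h⟩ := ih
    set E : ℝ := 2 ^ p * (C' * C) with hE
    have h1 : 0 < 1 - lam := by linarith [hA.lt_one]
    set B : ℝ := 1 + E / (1 - lam) with hB
    have hE0 : 0 ≤ E := by positivity
    have hB0 : 1 ≤ B := by rw [hB]; linarith [div_nonneg hE0 h1.le]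
    have hBE : lam * B + E ≤ B := by
      have : E / (1 - lam) * (1 - lam) = E := div_mul_cancel₀ _ h1.ne'
      rw [hB]; nlinarith
    have key : ∀ u : List Λ, ∀ x ∈ unitI, |iteratedDeriv (p + 1) (compWord φ u) x| ≤ B := by
      intro u
      induction u with
      | nil =>
        intro x _
        have : deriv (compWord φ ([] : List Λ)) = fun _ => (1 : ℝ) :=
          funext fun x => deriv_compWord_nil x
        rw [iteratedDeriv_succ', this, iteratedDeriv_const]
        split_ifs <;> simp <;> linarith
      | cons i u ihu =>
        intro x hx
        have hxu := hA.mapsTo u hx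
        have e0 : iteratedDeriv p (deriv (compWord φ (i :: u))) x =
            iteratedDeriv p ((fun y => deriv (φ i) (compWord φ u y)) * deriv (compWord φ u)) x :=
          ((eventuallyEq_deriv_comp (hA.an_word u x hx) (hA.an i _ hxu)).iteratedDeriv_eq p).symm
        have a1 : AnalyticAt ℝ (fun y => deriv (φ i) (compWord φ u y)) x :=
          ((hA.an i).deriv _ hxu).comp (hA.an_word u x hx)
        rw [iteratedDeriv_succ', e0, iteratedDeriv_mul a1.contDiffAt
            ((hA.an_word u).deriv x hx).contDiffAt, Finset.sum_range_succ']
        simp only [Nat.choose_zero_right, Nat.cast_one, one_mul, iteratedDeriv_zero, Nat.sub_zero]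
        rw [← iteratedDeriv_succ']
        have e1 : |deriv (φ i) (compWord φ u x) * iteratedDeriv (p + 1) (compWord φ u) x| ≤
            lam * B := by
          rw [abs_mul]
          exact mul_le_mul (hA.hi i _ hxu) (ihu x hx) (abs_nonneg _) hlam
        have e2 : ∀ k ∈ Finset.range p, |(p.choose (k + 1) : ℝ) *
            iteratedDeriv (k + 1) (fun y => deriv (φ i) (compWord φ u y)) x *
            iteratedDeriv (p - (k + 1)) (deriv (compWord φ u)) x| ≤
            p.choose (k + 1) * (C' * C) := by
          intro k hk
          rw [Finset.mem_range] at hk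
          rw [abs_mul, abs_mul, Nat.abs_cast, mul_assoc, ← iteratedDeriv_succ']
          exact mul_le_mul_of_nonneg_left (mul_le_mul (h' (i, u) (k + 1) (by omega) x hx)
            (h u _ (by omega) x hx) (abs_nonneg _) hC') (Nat.cast_nonneg _)
        have e3 : ∑ k ∈ Finset.range p, (p.choose (k + 1) : ℝ) * (C' * C) ≤ E := by
          rw [← Finset.sum_mul, hE]
          refine mul_le_mul_of_nonneg_right ?_ (by positivity)
          have := Nat.sum_range_choose p
          rw [Finset.sum_range_succ'] at this
          have h2 : ∑ k ∈ Finset.range p, p.choose (k + 1) ≤ 2 ^ p := by omega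
          exact_mod_cast h2
        refine (abs_add_le _ _).trans ?_
        have e4 := ((Finset.abs_sum_le_sum_abs _ _).trans (Finset.sum_le_sum e2)).trans e3
        linarith
    refine ⟨max C B, hC.trans (le_max_left _ _), fun u j hj x hx => ?_⟩
    rcases hj.lt_or_eq with hj | rfl
    · exact (h u j (by omega) x hx).trans (le_max_left _ _)
    · exact (key u x hx).trans (le_max_right _ _)

end DerivativeBounds

section Interpolation

lemma abs_le_of_taylor {f : ℝ → ℝ} (hf : AnalyticOnNhd ℝ f unitI) {p : ℕ} {C a ρ : ℝ}
    (hC : ∀ x ∈ unitI, |iteratedDeriv (p + 1) f x| ≤ C) (ha : a ∈ unitI) (ha1 : a < 1) :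
    ∃ P : Polynomial ℝ, P.degree < (p + 1 : ℕ) ∧ ∀ x ∈ unitI, a ≤ x → x ≤ a + ρ →
      |f x - P.eval x| ≤ C * ρ ^ (p + 1) := by
  have hsub : Icc a 1 ⊆ unitI := Icc_subset_Icc_left ha.1
  have hC0 : 0 ≤ C := (abs_nonneg _).trans (hC a ha)
  refine ⟨∑ k ∈ Finset.range (p + 1), Polynomial.C (((k.factorial : ℝ))⁻¹ *
    iteratedDerivWithin k f (Icc a 1) a) * (Polynomial.X - Polynomial.C a) ^ k, ?_, ?_⟩
  · rw [← Polynomial.mem_degreeLT]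
    refine Submodule.sum_mem _ fun k hk => ?_
    rw [Polynomial.mem_degreeLT]
    rw [← Polynomial.smul_eq_C_mul]
    refine (Polynomial.degree_smul_le _ _).trans_lt ?_
    rw [Polynomial.degree_pow, Polynomial.degree_X_sub_C, nsmul_one]
    exact_mod_cast Finset.mem_range.1 hk
  · intro x hx hax hxρ
    have h := taylor_mean_remainder_bound (f := f) (a := a) (b := 1) (C := C) (x := x) (n := p)
      ha1.le (fun y hy => (hf y (hsub hy)).contDiffAt.contDiffWithinAt) ⟨hax, hx.2⟩ ?_
    · rw [taylor_within_apply] at h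
      rw [Polynomial.eval_finsetSum]
      have e : ∀ k ∈ Finset.range (p + 1), (((k.factorial : ℝ))⁻¹ * (x - a) ^ k) •
          iteratedDerivWithin k f (Icc a 1) a = Polynomial.eval x (Polynomial.C
          (((k.factorial : ℝ))⁻¹ * iteratedDerivWithin k f (Icc a 1) a) *
          (Polynomial.X - Polynomial.C a) ^ k) := by
        intro k _
        simp only [smul_eq_mul, Polynomial.eval_mul, Polynomial.eval_C, Polynomial.eval_pow,
          Polynomial.eval_sub, Polynomial.eval_X]
        ring
      rw [Finset.sum_congr rfl e, Real.norm_eq_abs] at h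
      refine h.trans ((div_le_self (mul_nonneg hC0 (pow_nonneg (by linarith) _)) ?_).trans ?_)
      · exact_mod_cast Nat.one_le_iff_ne_zero.2 p.factorial_ne_zero
      · exact mul_le_mul_of_nonneg_left (pow_le_pow_left₀ (by linarith) (by linarith) _) hC0
    · intro y hy
      have := iteratedDerivWithin_eq_iteratedDeriv (n := p + 1) (uniqueDiffOn_Icc ha1)
        (hf y (hsub hy)).contDiffAt hy
      rw [this]
      exact hC y (hsub hy)

lemma abs_eval_le_of_nodes {p : ℕ} {P : Polynomial ℝ} (hP : P.degree < (p + 1 : ℕ))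
    (x : Fin (p + 1) → ℝ) {z ρ E δ : ℝ} (hρ : 0 < ρ) (hz : ∀ i, |z - x i| ≤ ρ)
    (hsep : ∀ i j, i ≠ j → ρ ≤ E * |x i - x j|) (hδ : ∀ i, |P.eval (x i)| ≤ δ) (hE : 0 ≤ E) :
    |P.eval z| ≤ (p + 1) * E ^ p * δ := by
  have hδ0 : 0 ≤ δ := (abs_nonneg _).trans (hδ 0)
  have hpos : ∀ i j, i ≠ j → 0 < |x i - x j| := fun i j hij =>
    pos_of_mul_pos_right (hρ.trans_le (hsep i j hij)) hE
  have hinj : Function.Injective x := fun i j hij => by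
    by_contra hne
    have := hpos i j hne
    rw [hij, sub_self, abs_zero] at this
    exact lt_irrefl _ this
  have h := Lagrange.eq_interpolate (s := Finset.univ) (v := x) (f := P) hinj.injOn (by simpa using hP)
  rw [h, Lagrange.interpolate_apply, Polynomial.eval_finsetSum]
  refine (Finset.abs_sum_le_sum_abs _ _).trans ?_
  have hb : ∀ i ∈ (Finset.univ : Finset (Fin (p + 1))), |Polynomial.eval z
      (Polynomial.C (P.eval (x i)) * Lagrange.basis Finset.univ x i)| ≤ δ * E ^ p := by
    intro i _
    rw [Polynomial.eval_mul, Polynomial.eval_C, abs_mul]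
    refine mul_le_mul (hδ i) ?_ (abs_nonneg _) hδ0
    rw [Lagrange.basis, Polynomial.eval_prod, Finset.abs_prod]
    have hf : ∀ j ∈ Finset.univ.erase i,
        |Polynomial.eval z (Lagrange.basisDivisor (x i) (x j))| ≤ E := by
      intro j hj
      have hij := hpos i j (Finset.ne_of_mem_erase hj).symm
      rw [Lagrange.basisDivisor, Polynomial.eval_mul, Polynomial.eval_C, Polynomial.eval_sub,
        Polynomial.eval_X, Polynomial.eval_C, abs_mul, abs_inv, inv_mul_le_iff₀ hij]
      have := hsep i j (Finset.ne_of_mem_erase hj).symm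
      linarith [hz j]
    refine (Finset.prod_le_prod (fun _ _ => abs_nonneg _) hf).trans ?_
    rw [Finset.prod_const, Finset.card_erase_of_mem (Finset.mem_univ i)]
    simp
  refine (Finset.sum_le_sum hb).trans (le_of_eq ?_)
  rw [Finset.sum_const, Finset.card_univ, Fintype.card_fin, nsmul_eq_mul]
  push_cast; ring

lemma abs_le_of_nodes {f : ℝ → ℝ} (hf : AnalyticOnNhd ℝ f unitI) {p : ℕ} {C a ρ E δ z : ℝ}
    (hC : ∀ x ∈ unitI, |iteratedDeriv (p + 1) f x| ≤ C) (ha : a ∈ unitI) (hρ : 0 < ρ)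
    (x : Fin (p + 1) → ℝ) (hx : ∀ i, x i ∈ unitI ∧ a ≤ x i ∧ x i ≤ a + ρ) (hE : 0 ≤ E)
    (hsep : ∀ i j, i ≠ j → ρ ≤ E * |x i - x j|) (hδ : ∀ i, |f (x i)| ≤ δ)
    (hz : z ∈ unitI) (haz : a ≤ z) (hzρ : z ≤ a + ρ) :
    |f z| ≤ ((p + 1) * E ^ p + 1) * (δ + C * ρ ^ (p + 1)) := by
  have hC0 : 0 ≤ C := (abs_nonneg _).trans (hC a ha)
  have hδ0 : 0 ≤ δ := (abs_nonneg _).trans (hδ 0)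
  have hCρ : 0 ≤ C * ρ ^ (p + 1) := by positivity
  have hM : 0 ≤ (p + 1) * E ^ p := by positivity
  rcases ha.2.lt_or_eq with ha1 | ha1
  · obtain ⟨P, hP, h⟩ := abs_le_of_taylor (ρ := ρ) hf hC ha ha1
    have h1 : ∀ i, |P.eval (x i)| ≤ δ + C * ρ ^ (p + 1) := fun i => by
      have h2 := h (x i) (hx i).1 (hx i).2.1 (hx i).2.2
      have h3 := hδ i
      rw [abs_le] at *
      constructor <;> linarith [h2.1, h2.2, h3.1, h3.2]
    have h2 := abs_eval_le_of_nodes hP x (z := z) hρ (fun i => by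
      rw [abs_le]; constructor <;> linarith [(hx i).2.1, (hx i).2.2]) hsep h1 hE
    have h3 := h z hz haz hzρ
    have h4 : |f z| ≤ |f z - P.eval z| + |P.eval z| := by
      have := abs_add_le (f z - P.eval z) (P.eval z)
      rwa [sub_add_cancel] at this
    nlinarith
  · have e1 : z = x 0 := by
      have h1 := hz.2; have h2 := (hx 0).1.2; have h3 := (hx 0).2.1
      linarith
    rw [e1]
    have := hδ 0
    nlinarith [mul_nonneg hM (add_nonneg hδ0 hCρ)]

end Interpolation

section Hints

variable {Λ W : Type} {φ : Λ → ℝ → ℝ} {b lam K : ℝ} {wd : W → List Λ}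

lemma AnSys.abs_sub_le_of_nodes [Finite Λ] [Nonempty Λ] (hA : AnSys φ b lam K) (p : ℕ) {d : ℝ}
    (hd : 0 < d) : ∃ C, 0 ≤ C ∧ ∀ u u' w : List Λ, ∀ x : Fin (p + 1) → ℝ, (∀ i, x i ∈ unitI) →
      (∀ i j, i ≠ j → d ≤ |x i - x j|) → ∀ δ,
      (∀ i, |compWord φ u (compWord φ w (x i)) - compWord φ u' (compWord φ w (x i))| ≤ δ) →
      ∀ z ∈ unitI, |compWord φ u (compWord φ w z) - compWord φ u' (compWord φ w z)| ≤
        C * (δ + |deriv (compWord φ w) 0| ^ (p + 1)) := by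
  obtain ⟨B, hB, h⟩ := hA.bddDer (p + 1)
  have hK := hA.nonneg
  set E : ℝ := (1 + K) ^ 2 / d with hE
  set M : ℝ := (p + 1) * E ^ p + 1 with hM
  have hE0 : 0 ≤ E := by positivity
  have hM0 : 0 ≤ M := by positivity
  have hL0 : 0 ≤ 2 * B * (1 + K) ^ (p + 1) := by positivity
  refine ⟨M * (1 + 2 * B * (1 + K) ^ (p + 1)), by positivity, ?_⟩
  intro u u' w x hx hsep δ hδ z hz
  have hδ0 : 0 ≤ δ := (abs_nonneg _).trans (hδ 0)
  set c : ℝ := |deriv (compWord φ w) 0| with hc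
  have hc0 : 0 < c := hA.abs_deriv_pos w zero_mem_unitI
  obtain ⟨m, hm, hmin⟩ := isCompact_unitI.exists_isMinOn ⟨0, zero_mem_unitI⟩
    (hA.an_word w).continuousOn
  have hup : ∀ y ∈ unitI, compWord φ w y ≤ compWord φ w m + (1 + K) * c := fun y hy => by
    have h1 := hA.abs_sub_le w hy hm zero_mem_unitI
    have h2 : (1 + K) * c * |y - m| ≤ (1 + K) * c :=
      mul_le_of_le_one_right (by positivity) (abs_sub_le_one_of_mem hy hm)
    linarith [le_abs_self (compWord φ w y - compWord φ w m)]
  have han : AnalyticOnNhd ℝ (compWord φ u - compWord φ u') unitI :=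
    (hA.an_word u).sub (hA.an_word u')
  have key := abs_le_of_nodes han (p := p) (C := 2 * B) (a := compWord φ w m)
    (ρ := (1 + K) * c) (E := E) (δ := δ) (z := compWord φ w z) (fun y hy => by
      rw [iteratedDeriv_sub (hA.an_word u y hy).contDiffAt (hA.an_word u' y hy).contDiffAt]
      have h1 := h u (p + 1) le_rfl y hy
      have h2 := h u' (p + 1) le_rfl y hy
      exact (abs_sub _ _).trans (by linarith)) (hA.mapsTo w hm) (by positivity)
    (fun i => compWord φ w (x i))
    (fun i => ⟨hA.mapsTo w (hx i), hmin (hx i), hup _ (hx i)⟩) hE0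
    (fun i j hij => by
      have h1 := hA.le_abs_sub w (hx i) (hx j) zero_mem_unitI
      have h2 : c * d ≤ (1 + K) * |compWord φ w (x i) - compWord φ w (x j)| :=
        (mul_le_mul_of_nonneg_left (hsep i j hij) hc0.le).trans h1
      rw [hE, div_mul_eq_mul_div, le_div_iff₀ hd]
      nlinarith)
    hδ (hA.mapsTo w hz) (hmin hz) (hup z hz)
  refine key.trans ?_
  rw [← hM, mul_assoc M]
  refine mul_le_mul_of_nonneg_left ?_ hM0
  rw [mul_pow]
  have : 0 ≤ c ^ (p + 1) := by positivity
  nlinarith [mul_nonneg hL0 hδ0]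

/-- The words `α^i β^(p-i)` send every point to a family of separated points. -/
lemma AnSys.exists_nodes (hA : AnSys φ b lam K) {α β : W} {d : ℝ} (hd : 0 < d)
    (hαβ : ∀ x ∈ unitI, ∀ y ∈ unitI,
      d ≤ |compWord φ (wd α) x - compWord φ (wd β) y|) (p : ℕ) :
    ∃ v : Fin (p + 1) → List W, (∀ i, (v i).length = p) ∧ ∃ d', 0 < d' ∧ ∀ y ∈ unitI,
      ∀ i j, i ≠ j → d' ≤ |compWord φ ((v i).flatMap wd) y - compWord φ ((v j).flatMap wd) y| := by
  have hK := hA.nonneg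
  set g : ℕ → List Λ := fun i => (List.replicate i α).flatMap wd with hg
  set v : Fin (p + 1) → List W := fun i => List.replicate i α ++ List.replicate (p - i) β with hv
  have hpos : ∀ i, 0 < |deriv (compWord φ (g i)) 0| := fun i => hA.abs_deriv_pos _ zero_mem_unitI
  obtain ⟨i₀, -, hi₀⟩ := Finset.exists_min_image (Finset.range (p + 1))
    (fun i => |deriv (compWord φ (g i)) 0|) ⟨0, by simp⟩
  set c := |deriv (compWord φ (g i₀)) 0| with hc
  have hc0 : 0 < c := hpos i₀
  refine ⟨v, fun i => by simp [hv]; omega, c * d / (1 + K), by positivity, ?_⟩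
  have main : ∀ y ∈ unitI, ∀ i j : Fin (p + 1), i < j → c * d / (1 + K) ≤
      |compWord φ ((v i).flatMap wd) y - compWord φ ((v j).flatMap wd) y| := by
    intro y hy i j hij
    have hij' : (i : ℕ) < j := hij
    have hjp : (j : ℕ) ≤ p := by omega
    have e1 : v i = List.replicate i α ++ (β :: List.replicate (p - i - 1) β) := by
      rw [← List.replicate_succ, show p - i - 1 + 1 = p - (i : ℕ) by omega]
    have e2 : v j = List.replicate i α ++
        (α :: (List.replicate (j - i - 1) α ++ List.replicate (p - j) β)) := by
      rw [← List.cons_append, ← List.replicate_succ, ← List.append_assoc, ← List.replicate_add,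
        show i + (j - i - 1 + 1) = (j : ℕ) by omega]
    rw [e1, e2, List.flatMap_append, List.flatMap_append, List.flatMap_cons, List.flatMap_cons,
      List.flatMap_append]
    simp only [compWord_append_eq_comp, Function.comp_apply]
    set y1 := compWord φ ((List.replicate (p - i - 1) β).flatMap wd) y
    set y2 := compWord φ ((List.replicate (j - i - 1) α).flatMap wd)
      (compWord φ ((List.replicate (p - j) β).flatMap wd) y)
    have hy1 : y1 ∈ unitI := hA.mapsTo _ hy
    have hy2 : y2 ∈ unitI := hA.mapsTo _ (hA.mapsTo _ hy)
    have h1 := hA.le_abs_sub (g i) (hA.mapsTo (wd β) hy1) (hA.mapsTo (wd α) hy2) zero_mem_unitI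
    have h2 := hαβ y2 hy2 y1 hy1
    rw [abs_sub_comm] at h2
    have h3 : c ≤ |deriv (compWord φ (g i)) 0| := hi₀ i (by simp; omega)
    rw [div_le_iff₀ (by linarith), mul_comm _ (1 + K)]
    refine le_trans ?_ h1
    exact mul_le_mul h3 h2 hd.le (abs_nonneg _)
  intro y hy i j hij
  rcases lt_or_gt_of_ne hij with h | h
  · exact main y hy i j h
  · rw [abs_sub_comm]; exact main y hy j i h

theorem AnSys.exists_hint [Finite Λ] [Nonempty Λ] [Fintype W] (hA : AnSys φ b lam K) {t T : ℕ}
    (hlo : ∀ a, ∀ x ∈ unitI, (1 / 2) ^ T ≤ |deriv (compWord φ (wd a)) x|)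
    (hhi : ∀ a, ∀ x ∈ unitI, |deriv (compWord φ (wd a)) x| ≤ (1 / 2) ^ t) {α β : W} {d : ℝ}
    (hd : 0 < d) (hαβ : ∀ x ∈ unitI, ∀ y ∈ unitI,
      d ≤ |compWord φ (wd α) x - compWord φ (wd β) y|) (p : ℕ) :
    ∃ v : Fin (p + 1) → List W, (∀ i, (v i).length = p) ∧ ∃ C : ℝ,
      ∀ n, ∀ u ∈ words W n, ∀ u' ∈ words W n, ∀ w ∈ words W n, ∀ y ∈ unitI, ∀ δ, 0 ≤ δ →
      (∀ i, |compWord (fun a => compWord φ (wd a)) u (compWord (fun a => compWord φ (wd a)) w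
          (compWord (fun a => compWord φ (wd a)) (v i) y)) -
        compWord (fun a => compWord φ (wd a)) u' (compWord (fun a => compWord φ (wd a)) w
          (compWord (fun a => compWord φ (wd a)) (v i) y))| ≤ δ) →
      ∀ z ∈ unitI, |compWord (fun a => compWord φ (wd a)) u
          (compWord (fun a => compWord φ (wd a)) w z) -
        compWord (fun a => compWord φ (wd a)) u'
          (compWord (fun a => compWord φ (wd a)) w z)| ≤
        C * (δ + (1 / 2) ^ (t * n * (p + 1))) := by
  obtain ⟨v, hv, d', hd', hsep⟩ := hA.exists_nodes hd hαβ p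
  obtain ⟨C, hC, h⟩ := hA.abs_sub_le_of_nodes p hd'
  refine ⟨v, hv, C, fun n u hu u' hu' w hw y hy δ hδ hi z hz => ?_⟩
  simp only [compWord_flatMap] at hi ⊢
  refine (h _ _ _ (fun i => compWord φ ((v i).flatMap wd) y) (fun i => hA.mapsTo _ hy)
    (hsep y hy) δ hi z hz).trans ?_
  refine mul_le_mul_of_nonneg_left ?_ hC
  have := (hA.flat_bounds hlo hhi w zero_mem_unitI).2
  rw [mem_words.1 hw] at this
  rw [pow_mul]
  gcongr

end Hints

section LowerBound

lemma exists_mem_iInter_image {G : Type} (f : G → ℝ → ℝ) {K : Set ℝ} (hK : IsCompact K)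
    (hne : K.Nonempty) (hcont : ∀ g, ContinuousOn (f g) K) (hmaps : ∀ g, MapsTo (f g) K K)
    (ω : ℕ → G) :
    ∃ x, ∀ n, x ∈ compWord f (List.ofFn fun i : Fin n => ω i) '' K := by
  have hm : ∀ u : List G, MapsTo (compWord f u) K K ∧ ContinuousOn (compWord f u) K := by
    intro u
    induction u with
    | nil => exact ⟨mapsTo_id K, continuousOn_id⟩
    | cons g u ih => exact ⟨(hmaps g).comp ih.1, (hcont g).comp ih.2 ih.1⟩
  have hc : ∀ n, IsCompact (compWord f (List.ofFn fun i : Fin n => ω i) '' K) :=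
    fun n => hK.image_of_continuousOn (hm _).2
  obtain ⟨x, hx⟩ := IsCompact.nonempty_iInter_of_sequence_nonempty_isCompact_isClosed
    (fun n => compWord f (List.ofFn fun i : Fin n => ω i) '' K) (fun n => by
      rintro _ ⟨y, hy, rfl⟩
      rw [List.ofFn_succ', List.concat_eq_append]
      refine ⟨f (ω n) y, hmaps _ hy, ?_⟩
      simp [compWord_append, compWord]) (fun n => hne.image _) (hc 0) (fun n => (hc n).isClosed)
  exact ⟨x, fun n => mem_iInter.1 hx n⟩

/-- A separated system of `N` maps contracting by at most `r` has dimension at least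
`log N / log (1 / r)`. -/
theorem le_dimH_of_separated {N : ℕ} (hN : 1 < N) (f : Fin N → ℝ → ℝ) {K : Set ℝ}
    (hK : IsCompact K) (hne : K.Nonempty) (hcont : ∀ g, ContinuousOn (f g) K)
    (hmaps : ∀ g, MapsTo (f g) K K) {r δ : ℝ} (hr : 0 < r) (hr1 : r < 1) (hδ : 0 < δ)
    (hlo : ∀ g, ∀ x ∈ K, ∀ y ∈ K, r * |x - y| ≤ |f g x - f g y|)
    (hsep : ∀ g g', g ≠ g' → ∀ x ∈ K, ∀ y ∈ K, δ ≤ |f g x - f g' y|) :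
    ENNReal.ofReal (Real.log N / Real.log (1 / r)) ≤ dimH K := by
  have hN0 : (1 : ℝ) < N := by exact_mod_cast hN
  have hlN : 0 < Real.log N := Real.log_pos hN0
  have hlr : 0 < Real.log (1 / r) := Real.log_pos (by rw [lt_div_iff₀ hr]; linarith)
  set β := Real.log N / Real.log (1 / r) with hβ
  have hβ0 : 0 < β := div_pos hlN hlr
  have hrβ : r ^ β = (N : ℝ)⁻¹ := by
    rw [Real.rpow_def_of_pos hr, hβ]
    have : Real.log r = - Real.log (1 / r) := by rw [one_div, Real.log_inv, neg_neg]
    rw [this, neg_mul, mul_div_cancel₀ _ hlr.ne', Real.exp_neg, Real.exp_log (by linarith)]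
  have hlow : ∀ u : List (Fin N), ∀ x ∈ K, ∀ y ∈ K, compWord f u x ∈ K ∧ compWord f u y ∈ K ∧
      r ^ u.length * |x - y| ≤ |compWord f u x - compWord f u y| := by
    intro u
    induction u with
    | nil => intro x hx y hy; exact ⟨hx, hy, by simp [compWord]⟩
    | cons g u ih =>
      intro x hx y hy
      obtain ⟨h1, h2, h3⟩ := ih x hx y hy
      refine ⟨hmaps g h1, hmaps g h2, le_trans ?_ (hlo g _ h1 _ h2)⟩
      rw [List.length_cons, pow_succ', mul_assoc]
      exact mul_le_mul_of_nonneg_left h3 hr.le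
  choose π hπ using exists_mem_iInter_image f hK hne hcont hmaps
  have hπK : ∀ ω, π ω ∈ K := fun ω => by
    obtain ⟨x, hx, h⟩ := hπ ω 0
    rw [← h]; exact hx
  have hdist : ∀ ω ω' n, (∀ i < n, ω i = ω' i) → ω n ≠ ω' n → r ^ n * δ ≤ |π ω - π ω'| := by
    intro ω ω' n heq hne'
    have e : (List.ofFn fun i : Fin n => ω i) = List.ofFn fun i : Fin n => ω' i := by
      congr 1; exact funext fun i => heq i i.2
    obtain ⟨x, hx, h⟩ := hπ ω (n + 1)
    obtain ⟨y, hy, h'⟩ := hπ ω' (n + 1)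
    rw [List.ofFn_succ', List.concat_eq_append, compWord_append] at h h'
    have h2 := (hlow (List.ofFn fun i : Fin n => ω i) _ (hmaps (ω n) hx) _
      (hmaps (ω' n) hy)).2.2
    have h3 := hsep _ _ hne' x hx y hy
    rw [List.length_ofFn] at h2
    have h4 : |π ω - π ω'| = |compWord f (List.ofFn fun i : Fin n => ω i) (f (ω n) x) -
        compWord f (List.ofFn fun i : Fin n => ω i) (f (ω' n) y)| := by
      rw [← h, ← h']; simp only [Fin.val_castSucc, Fin.val_last, compWord, Function.comp_apply, id]; rw [e]
    rw [h4]
    exact (mul_le_mul_of_nonneg_left h3 (pow_nonneg hr.le _)).trans h2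
  have hhold : ∀ ω ω', |Real.ofDigits ω - Real.ofDigits ω'| ≤
      (δ ^ β)⁻¹ * |π ω - π ω'| ^ β := by
    intro ω ω'
    by_cases hω : ω = ω'
    · rw [hω, sub_self, abs_zero]; positivity
    · have hex : ∃ n, ω n ≠ ω' n := by
        by_contra! h
        exact hω (funext h)
      classical
      have h1 := hdist ω ω' (Nat.find hex) (fun i hi => not_not.1 (Nat.find_min hex hi))
        (Nat.find_spec hex)
      have h2 := Real.abs_ofDigits_sub_ofDigits_le (x := ω) (y := ω') (n := Nat.find hex)
        (fun i hi => not_not.1 (Nat.find_min hex hi))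
      set n := Nat.find hex
      refine h2.trans ?_
      have h3 := Real.rpow_le_rpow (by positivity) h1 hβ0.le
      rw [Real.mul_rpow (by positivity) hδ.le, ← Real.rpow_natCast, ← Real.rpow_mul hr.le,
        mul_comm (n : ℝ), Real.rpow_mul hr.le, hrβ, Real.rpow_natCast, inv_pow] at h3
      rw [le_inv_mul_iff₀ (by positivity)]
      linarith
  have hinj : ∀ ω ω', π ω = π ω' → ω = ω' := by
    intro ω ω' h
    by_contra hω
    have hex : ∃ n, ω n ≠ ω' n := by
      by_contra! h
      exact hω (funext h)
    classical
    have h1 := hdist ω ω' (Nat.find hex) (fun i hi => not_not.1 (Nat.find_min hex hi))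
      (Nat.find_spec hex)
    rw [h, sub_self, abs_zero] at h1
    have : 0 < r ^ Nat.find hex * δ := by positivity
    linarith
  have : Nonempty (ℕ → Fin N) := ⟨fun _ => ⟨0, by omega⟩⟩
  set F : ℝ → ℝ := fun x => Real.ofDigits (Function.invFun π x) with hF
  have hFπ : ∀ ω, F (π ω) = Real.ofDigits ω := fun ω => by
    rw [hF]; simp only [Function.leftInverse_invFun (fun a b h => hinj a b h) ω]
  have hH : HolderOnWith (Real.toNNReal (δ ^ β)⁻¹) (Real.toNNReal β) F (range π) := by
    rintro _ ⟨ω, rfl⟩ _ ⟨ω', rfl⟩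
    rw [hFπ, hFπ, edist_dist, edist_dist, Real.dist_eq, Real.dist_eq, Real.coe_toNNReal _ hβ0.le,
      ENNReal.ofReal_rpow_of_nonneg (abs_nonneg _) hβ0.le]
    change _ ≤ ENNReal.ofReal _ * _
    rw [← ENNReal.ofReal_mul (by positivity)]
    exact ENNReal.ofReal_le_ofReal (hhold ω ω')
  have h1 := hH.dimH_image_le (by simpa using hβ0)
  have h2 : Icc (0 : ℝ) 1 ⊆ F '' range π := by
    intro y hy
    obtain ⟨ω, -, h⟩ := Real.ofDigits_SurjOn hN hy
    exact ⟨π ω, ⟨ω, rfl⟩, by rw [hFπ, h]⟩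
  have h3 : (1 : ENNReal) ≤ dimH (F '' range π) := by
    have := Real.dimH_of_nonempty_interior (E := ℝ) (s := Icc (0 : ℝ) 1) (by simp)
    rw [Module.finrank_self, Nat.cast_one] at this
    rw [← this]
    exact dimH_mono h2
  have h4 : dimH (range π) ≤ dimH K := dimH_mono (range_subset_iff.2 hπK)
  have h5 := h3.trans (h1.trans (ENNReal.div_le_div_right h4 _))
  rw [ENNReal.le_div_iff_mul_le (Or.inl (by simpa using hβ0)) (Or.inl (by simp)), one_mul] at h5
  exact h5

variable {W : Type} [Fintype W] [Nonempty W] {ψ : W → ℝ → ℝ} {t T : ℕ} {D : ℝ}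

lemma ConfSys.exists_separated_words (hS : ConfSys ψ t T D) {x₀ : ℝ} (h₀ : x₀ ∈ unitI) (l : ℕ) :
    ∃ G : Finset (List W), (∀ u ∈ G, u.length = l) ∧ hh ψ x₀ (t * l) ≤ Real.logb 2 G.card + 6 ∧
      ∀ u ∈ G, ∀ u' ∈ G, u ≠ u' → ∀ x ∈ unitI, ∀ y ∈ unitI,
        (1 / 2) ^ (t * l) ≤ |compWord ψ u x - compWord ψ u' y| := by
  classical
  set X : List W → ℤ := fun ω => ⌊2 ^ (t * l) * compWord ψ ω x₀⌋ with hX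
  set F := (words W l).image X with hF
  have hFne : F.Nonempty := (words_nonempty l).image X
  have h1 : hh ψ x₀ (t * l) - 4 ≤ Real.logb 2 F.card := by
    have h2 := (abs_le.1 (hS.abs_ent_prefix h₀ h₀ (n := l) (n' := t * l - l) (m := t * l)
      le_rfl)).2
    rw [show l + (t * l - l) = t * l by
      have := Nat.le_mul_of_pos_left l hS.one_le_t; omega] at h2
    have h3 : ent (words W l) X ≤ Real.logb 2 F.card :=
      ent_le_logb F (fun ω hω => Finset.mem_image_of_mem X hω) le_rfl
        (by exact_mod_cast hFne.card_pos)
    change hh ψ x₀ (t * l) - _ ≤ 4 at h2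
    linarith
  obtain ⟨c, -, hcard⟩ := Finset.exists_le_card_fiber_of_nsmul_le_card_of_maps_to
    (s := F) (t := Finset.Ico (0 : ℤ) 4) (f := fun q => q % 4) (b := (F.card : ℝ) / 4)
    (fun q _ => Finset.mem_Ico.2
      ⟨Int.emod_nonneg _ (by norm_num), Int.emod_lt_of_pos _ (by norm_num)⟩)
    ⟨0, by simp⟩ (by rw [Int.card_Ico, nsmul_eq_mul, show (4 - 0 : ℤ).toNat = 4 from rfl]; push_cast; linarith)
  set F' := F.filter fun q => q % 4 = c with hF'
  have hch : ∀ q ∈ F, ∃ u, u ∈ words W l ∧ X u = q := fun q hq => by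
    simpa using Finset.mem_image.1 hq
  choose! g hg using hch
  have hgF : ∀ q ∈ F', g q ∈ words W l ∧ X (g q) = q := fun q hq =>
    hg q (Finset.mem_filter.1 hq).1
  have hinj : Set.InjOn g F' := fun q hq q' hq' h => by
    rw [← (hgF q hq).2, h, (hgF q' hq').2]
  refine ⟨F'.image g, fun u hu => ?_, ?_, fun u hu u' hu' hne x hx y hy => ?_⟩
  · obtain ⟨q, hq, rfl⟩ := Finset.mem_image.1 hu
    exact mem_words.1 (hgF q hq).1
  · rw [Finset.card_image_of_injOn hinj]
    have hF0 : (0 : ℝ) < F.card := by exact_mod_cast hFne.card_pos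
    have h2 : Real.logb 2 ((F.card : ℝ) / 4) ≤ Real.logb 2 F'.card :=
      Real.logb_le_logb_of_le (by norm_num) (by positivity) hcard
    rw [Real.logb_div hF0.ne' (by norm_num), show (4 : ℝ) = 2 ^ (2 : ℕ) by norm_num,
      Real.logb_pow, Real.logb_self_eq_one (by norm_num)] at h2
    push_cast at h2
    linarith
  · obtain ⟨q, hq, rfl⟩ := Finset.mem_image.1 hu
    obtain ⟨q', hq', rfl⟩ := Finset.mem_image.1 hu'
    have hqq : q ≠ q' := fun h => hne (by rw [h])
    have hm : q % 4 = q' % 4 := by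
      rw [(Finset.mem_filter.1 hq).2, (Finset.mem_filter.1 hq').2]
    have h4 : (4 : ℤ) ≤ |q - q'| := by
      rw [le_abs]; omega
    have h4' : (4 : ℝ) ≤ |(q : ℝ) - q'| := by exact_mod_cast h4
    have key : ∀ q ∈ F', ∀ x ∈ unitI, |2 ^ (t * l) * compWord ψ (g q) x -
        2 ^ (t * l) * compWord ψ (g q) x₀| ≤ 1 := fun q hq x hx => by
      rw [← mul_sub, abs_mul, abs_of_pos (by positivity)]
      have h1 := hS.word_up (g q) hx h₀
      rw [mem_words.1 (hgF q hq).1] at h1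
      calc _ ≤ 2 ^ (t * l) * ((1 / 2 : ℝ) ^ (t * l) * 1) := by
            gcongr
            exact h1.trans (mul_le_mul_of_nonneg_left (abs_sub_le_one_of_mem hx h₀)
              (by positivity))
        _ = 1 := by rw [mul_one, ← mul_pow]; norm_num
    have fl : ∀ q ∈ F', (q : ℝ) ≤ 2 ^ (t * l) * compWord ψ (g q) x₀ ∧
        2 ^ (t * l) * compWord ψ (g q) x₀ < q + 1 := fun q hq => by
      have h1 := (hgF q hq).2
      exact ⟨by conv_lhs => rw [← h1]
                exact Int.floor_le _, by conv_rhs => rw [← h1]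
                                         exact Int.lt_floor_add_one _⟩
    have a1 := abs_le.1 (key q hq x hx)
    have a2 := abs_le.1 (key q' hq' y hy)
    have a3 := fl q hq
    have a4 := fl q' hq'
    have hP : (0 : ℝ) < 2 ^ (t * l) := by positivity
    have h5 : 1 ≤ |2 ^ (t * l) * compWord ψ (g q) x - 2 ^ (t * l) * compWord ψ (g q') y| := by
      rcases le_abs.1 h4' with h | h
      · exact le_abs.2 (Or.inl (by linarith [a1.1, a2.2, a3.1, a4.2]))
      · exact le_abs.2 (Or.inr (by linarith [a1.2, a2.1, a3.2, a4.1]))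
    rw [← mul_sub, abs_mul, abs_of_pos hP] at h5
    rw [one_div, inv_pow, inv_le_iff_one_le_mul₀ hP, mul_comm]
    exact h5

theorem ConfSys.le_dimH (hS : ConfSys ψ t T D) (htT : t ≤ T) {x₀ α : ℝ} (h₀ : x₀ ∈ unitI)
    (hα : Tendsto (fun m : ℕ => hh ψ x₀ m / m) atTop (𝓝 α)) {K : Set ℝ} (hK : IsCompact K)
    (hne : K.Nonempty) (hKI : K ⊆ unitI) (hmaps : ∀ a, MapsTo (ψ a) K K) :
    ENNReal.ofReal (α * t / T) ≤ dimH K := by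
  have ht := hS.one_le_t
  have hT0 : (0 : ℝ) < T := by exact_mod_cast (by omega : 0 < T)
  have ht0 : (0 : ℝ) < t := by exact_mod_cast (by omega : 0 < t)
  have hmapsw : ∀ u : List W, MapsTo (compWord ψ u) K K := fun u => by
    induction u with
    | nil => exact mapsTo_id K
    | cons a u ih => exact (hmaps a).comp ih
  have hbound : ∀ l : ℕ, 1 ≤ l →
      ENNReal.ofReal ((hh ψ x₀ (t * l) - 6) / (T * l)) ≤ dimH K := by
    intro l hl
    have hl0 : (0 : ℝ) < l := by exact_mod_cast hl
    obtain ⟨G, hGl, hG, hGs⟩ := hS.exists_separated_words h₀ l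
    by_cases hG1 : 1 < G.card
    · have hTl : T * l ≠ 0 := Nat.mul_ne_zero (by omega) (by omega)
      set e := G.equivFin.symm
      have := le_dimH_of_separated hG1 (fun g => compWord ψ (e g).1) hK hne
        (fun g => by
          have : LipschitzOnWith 1 (compWord ψ (e g).1) unitI :=
            LipschitzOnWith.of_dist_le_mul fun x hx y hy => by
              rw [Real.dist_eq, Real.dist_eq, NNReal.coe_one]
              refine (hS.word_up _ hx hy).trans (mul_le_mul_of_nonneg_right ?_ (abs_nonneg _))
              exact pow_le_one₀ (by norm_num) (by norm_num)
          exact this.continuousOn.mono hKI)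
        (fun g => hmapsw _) (r := (1 / 2) ^ (T * l)) (δ := (1 / 2) ^ (t * l)) (by positivity)
        (pow_lt_one₀ (by norm_num) (by norm_num) hTl) (by positivity)
        (fun g x hx y hy => by
          have := hS.word_lo (e g).1 (hKI hx) (hKI hy)
          rwa [hGl _ (e g).2] at this)
        (fun g g' hgg x hx y hy => hGs _ (e g).2 _ (e g').2
          (fun h => hgg (e.injective (Subtype.ext h))) x (hKI hx) y (hKI hy))
      refine le_trans (ENNReal.ofReal_le_ofReal ?_) this
      have e1 : Real.log (1 / (1 / 2) ^ (T * l)) = T * l * Real.log 2 := by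
        rw [one_div_pow, one_div_one_div, Real.log_pow]; push_cast; ring
      have hl2 : 0 < Real.log 2 := Real.log_pos (by norm_num)
      rw [e1, mul_comm _ (Real.log 2), ← div_div (Real.log _)]
      refine div_le_div_of_nonneg_right ?_ (by positivity)
      rw [Real.log_div_log]
      linarith
    · have h1 : Real.logb 2 G.card = 0 := by
        have : G.card = 0 ∨ G.card = 1 := by omega
        rcases this with h | h <;> simp [h]
      rw [ENNReal.ofReal_of_nonpos]
      · exact zero_le
      · exact div_nonpos_of_nonpos_of_nonneg (by linarith) (by positivity)
  have hlim : Tendsto (fun l : ℕ => (hh ψ x₀ (t * l) - 6) / (T * l)) atTop (𝓝 (α * t / T)) := by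
    have h1 : Tendsto (fun l : ℕ => t * l) atTop atTop :=
      tendsto_id.const_mul_atTop' (by omega)
    have h2 := ((hα.comp h1).mul_const ((t : ℝ) / T)).sub
      (tendsto_const_div_atTop_nhds_zero_nat ((6 : ℝ) / T))
    rw [sub_zero, ← mul_div_assoc] at h2
    refine h2.congr' ?_
    filter_upwards [eventually_ge_atTop 1] with l hl
    have hl0 : (0 : ℝ) < l := by exact_mod_cast hl
    simp only [Function.comp_apply]
    push_cast
    field_simp
  exact le_of_tendsto (ENNReal.tendsto_ofReal hlim)
    (by filter_upwards [eventually_ge_atTop 1] with l hl using hbound l hl)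

end LowerBound

section UpperBound

variable {Λ : Type} {φ : Λ → ℝ → ℝ} {b lam K : ℝ}

namespace AnSys

variable (hA : AnSys φ b lam K)

include hA

lemma bddAbove_abs_deriv (u : List Λ) :
    BddAbove ((fun x => |deriv (compWord φ u) x|) '' unitI) := by
  refine ⟨lam ^ u.length, ?_⟩
  rintro _ ⟨x, hx, rfl⟩
  exact hA.abs_deriv_le_pow u hx

lemma abs_deriv_le_supDerivNorm (u : List Λ) {x : ℝ} (hx : x ∈ unitI) :
    |deriv (compWord φ u) x| ≤ supDerivNorm φ u :=
  le_csSup (hA.bddAbove_abs_deriv u) ⟨x, hx, rfl⟩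

lemma supDerivNorm_pos (u : List Λ) : 0 < supDerivNorm φ u :=
  (hA.abs_deriv_pos u zero_mem_unitI).trans_le (hA.abs_deriv_le_supDerivNorm u zero_mem_unitI)

lemma supDerivNorm_le_pow (u : List Λ) : supDerivNorm φ u ≤ lam ^ u.length := by
  refine csSup_le ⟨_, 0, zero_mem_unitI, rfl⟩ ?_
  rintro _ ⟨x, hx, rfl⟩
  exact hA.abs_deriv_le_pow u hx

lemma supDerivNorm_le (u : List Λ) {x : ℝ} (hx : x ∈ unitI) :
    supDerivNorm φ u ≤ (1 + K) * |deriv (compWord φ u) x| := by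
  refine csSup_le ⟨_, 0, zero_mem_unitI, rfl⟩ ?_
  rintro _ ⟨y, hy, rfl⟩
  exact hA.abs_deriv_le u hy hx

lemma abs_sub_le_supDerivNorm (u : List Λ) {x y : ℝ} (hx : x ∈ unitI) (hy : y ∈ unitI) :
    |compWord φ u x - compWord φ u y| ≤ supDerivNorm φ u * |x - y| := by
  obtain ⟨ξ, hξ, h⟩ := exists_mvt (hA.differentiableAt u) hx hy
  rw [h, abs_mul]
  exact mul_le_mul_of_nonneg_right (hA.abs_deriv_le_supDerivNorm u hξ) (abs_nonneg _)

lemma lam_pos [Nonempty Λ] : 0 < lam :=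
  hA.pos.trans_le ((hA.lo (Classical.arbitrary Λ) 0 zero_mem_unitI).trans
    (hA.hi _ 0 zero_mem_unitI))

end AnSys

/-- The partition sums of the pressure function. -/
def psum [Fintype Λ] (φ : Λ → ℝ → ℝ) (s : ℝ) (n : ℕ) : ℝ :=
  ∑ u : Fin n → Λ, (supDerivNorm φ (List.ofFn u)) ^ s

variable [Fintype Λ] [Nonempty Λ] {s : ℝ}

lemma AnSys.psum_pos (hA : AnSys φ b lam K) (n : ℕ) : 0 < psum φ s n :=
  Finset.sum_pos (fun _ _ => Real.rpow_pos_of_pos (hA.supDerivNorm_pos _) _) Finset.univ_nonempty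

lemma AnSys.psum_bounds (hA : AnSys φ b lam K)
    (hs : Tendsto (fun n : ℕ => (1 / (n : ℝ)) * Real.logb 2 (psum φ s n)) atTop (𝓝 0)) {η : ℝ}
    (hη : 0 < η) :
    ∀ᶠ n : ℕ in atTop, (2 : ℝ) ^ (-(η * n)) ≤ psum φ s n ∧ psum φ s n ≤ 2 ^ (η * n) := by
  filter_upwards [hs.eventually (gt_mem_nhds hη), hs.eventually (lt_mem_nhds (neg_neg_of_pos hη)),
    eventually_ge_atTop 1] with n h1 h2 hn
  have hn0 : (0 : ℝ) < n := by exact_mod_cast hn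
  have hP := hA.psum_pos (s := s) n
  rw [one_div, inv_mul_lt_iff₀ hn0] at h1
  rw [one_div, lt_inv_mul_iff₀ hn0] at h2
  constructor
  · rw [← Real.le_logb_iff_rpow_le (by norm_num) hP]; linarith
  · rw [← Real.logb_le_iff_le_rpow (by norm_num) hP]; linarith

omit [Fintype Λ] [Nonempty Λ] in
lemma subset_iUnion_words {A : Set ℝ} (hA : A = ⋃ i, φ i '' A) (n : ℕ) :
    A ⊆ ⋃ u : Fin n → Λ, compWord φ (List.ofFn u) '' A := by
  induction n with
  | zero => intro x hx; exact mem_iUnion.2 ⟨Fin.elim0, x, hx, by simp [compWord]⟩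
  | succ n ih =>
    intro x hx
    rw [hA] at hx
    obtain ⟨i, y, hy, rfl⟩ := mem_iUnion.1 hx
    obtain ⟨u, z, hz, rfl⟩ := mem_iUnion.1 (ih hy)
    exact mem_iUnion.2 ⟨Fin.cons i u, z, hz, by simp [compWord, List.ofFn_succ]⟩

theorem AnSys.dimH_le (hA : AnSys φ b lam K) (hs0 : 0 ≤ s)
    (hs : Tendsto (fun n : ℕ => (1 / (n : ℝ)) * Real.logb 2 (psum φ s n)) atTop (𝓝 0))
    {A : Set ℝ} (hAI : A ⊆ unitI) (hAinv : A = ⋃ i, φ i '' A) :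
    dimH A ≤ ENNReal.ofReal s := by
  have hlam := hA.lam_pos
  have hdiam : ∀ (n : ℕ) (u : Fin n → Λ), Metric.ediam (compWord φ (List.ofFn u) '' A) ≤
      ENNReal.ofReal (supDerivNorm φ (List.ofFn u)) := fun n u => by
    rw [Metric.ediam_image_le_iff]
    intro x hx y hy
    rw [edist_dist, Real.dist_eq]
    refine ENNReal.ofReal_le_ofReal
      ((hA.abs_sub_le_supDerivNorm _ (hAI hx) (hAI hy)).trans ?_)
    exact mul_le_of_le_one_right (hA.supDerivNorm_pos _).le
      (abs_sub_le_one_of_mem (hAI hx) (hAI hy))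
  have key : ∀ γ : ℝ, 0 < γ → dimH A ≤ ENNReal.ofReal (s + γ) := by
    intro γ hγ
    have hη : 0 < γ * Real.logb 2 (1 / lam) := mul_pos hγ
      (Real.logb_pos (by norm_num) (by rw [lt_div_iff₀ hlam]; linarith [hA.lt_one]))
    have hη2 : (2 : ℝ) ^ (γ * Real.logb 2 (1 / lam)) = (lam ^ γ)⁻¹ := by
      rw [mul_comm, Real.rpow_mul (by norm_num), Real.rpow_logb (by norm_num) (by norm_num)
        (by positivity), one_div, Real.inv_rpow hlam.le]
    have hfin : μH[s + γ] A ≤ 1 := by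
      refine (Measure.hausdorffMeasure_le_liminf_sum (s + γ) A (l := atTop)
        (ι := fun n : ℕ => Fin n → Λ) (fun n : ℕ => ENNReal.ofReal (lam ^ n)) ?_
        (fun n u => compWord φ (List.ofFn u) '' A) ?_
        (Eventually.of_forall (subset_iUnion_words hAinv))).trans ?_
      · rw [← ENNReal.ofReal_zero]
        exact ENNReal.tendsto_ofReal (tendsto_pow_atTop_nhds_zero_of_lt_one hlam.le hA.lt_one)
      · refine Eventually.of_forall fun n u => (hdiam n u).trans (ENNReal.ofReal_le_ofReal ?_)
        simpa using hA.supDerivNorm_le_pow (List.ofFn u)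
      · refine (liminf_le_liminf (v := fun _ => (1 : ENNReal)) ?_).trans (by simp)
        filter_upwards [hA.psum_bounds hs hη] with n hn
        have h1 : ∀ u : Fin n → Λ, Metric.ediam (compWord φ (List.ofFn u) '' A) ^ (s + γ) ≤
            ENNReal.ofReal (supDerivNorm φ (List.ofFn u) ^ s * (lam ^ γ) ^ n) := fun u => by
          have hp := hA.supDerivNorm_pos (List.ofFn u)
          refine (ENNReal.rpow_le_rpow (hdiam n u) (by linarith)).trans ?_
          rw [ENNReal.ofReal_rpow_of_pos hp]
          refine ENNReal.ofReal_le_ofReal ?_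
          rw [Real.rpow_add hp]
          refine mul_le_mul_of_nonneg_left ?_ (Real.rpow_nonneg hp.le _)
          rw [← Real.rpow_natCast (lam ^ γ), ← Real.rpow_mul hlam.le, mul_comm γ,
            Real.rpow_mul hlam.le, Real.rpow_natCast]
          exact Real.rpow_le_rpow hp.le (by simpa using hA.supDerivNorm_le_pow (List.ofFn u))
            hγ.le
        refine (Finset.sum_le_sum fun u _ => h1 u).trans ?_
        rw [← ENNReal.ofReal_sum_of_nonneg fun u _ => mul_nonneg
          (Real.rpow_nonneg (hA.supDerivNorm_pos _).le _) (by positivity), ← Finset.sum_mul]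
        refine ENNReal.ofReal_le_one.2 ?_
        have h2 := hn.2
        rw [Real.rpow_mul (by norm_num), hη2, Real.rpow_natCast, inv_pow] at h2
        exact (mul_le_mul_of_nonneg_right h2 (by positivity)).trans
          (inv_mul_cancel₀ (by positivity)).le
    have := dimH_le_of_hausdorffMeasure_ne_top (s := A) (d := Real.toNNReal (s + γ)) (by
      rw [Real.coe_toNNReal _ (by linarith)]
      exact (hfin.trans_lt ENNReal.one_lt_top).ne)
    exact this
  refine ge_of_tendsto (f := fun γ : ℝ => ENNReal.ofReal (s + γ)) (x := 𝓝[>] 0) ?_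
    (by filter_upwards [self_mem_nhdsWithin] with γ hγ using key γ hγ)
  refine ENNReal.tendsto_ofReal ?_
  have : Tendsto (fun γ : ℝ => s + γ) (𝓝 0) (𝓝 (s + 0)) := tendsto_const_nhds.add tendsto_id
  rw [add_zero] at this
  exact this.mono_left nhdsWithin_le_nhds

end UpperBound

section Classes

variable {Λ : Type} {φ : Λ → ℝ → ℝ} {b lam K : ℝ} [Fintype Λ] [Nonempty Λ] {s : ℝ}

lemma exists_nat_half_pow {x : ℝ} (hx : 0 < x) (hx1 : x ≤ 1) :
    ∃ t : ℕ, (1 / 2) ^ (t + 1) ≤ x ∧ x ≤ (1 / 2) ^ t := by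
  obtain ⟨t, h1, h2⟩ := exists_nat_pow_near_of_lt_one hx hx1 (y := (1 / 2 : ℝ)) (by norm_num)
    (by norm_num)
  exact ⟨t, h1.le, h2⟩

/-- Many words have derivatives of the same size, in agreement with the pressure. -/
lemma AnSys.exists_class (hA : AnSys φ b lam K) (hs0 : 0 ≤ s)
    (hs : Tendsto (fun n : ℕ => (1 / (n : ℝ)) * Real.logb 2 (psum φ s n)) atTop (𝓝 0)) :
    ∃ A₀ : ℕ, 1 ≤ A₀ ∧ ∀ ε : ℝ, 0 < ε → ∀ t₀ : ℕ, ∃ t ≥ t₀, ∃ n, 1 ≤ n ∧ n ≤ A₀ * (t + 1) ∧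
      ∃ U : Finset (List Λ), (∀ u ∈ U, u.length = n ∧ (1 / 2) ^ (t + 1) ≤ supDerivNorm φ u ∧
        supDerivNorm φ u ≤ (1 / 2) ^ t) ∧ (2 : ℝ) ^ ((s - ε) * t) ≤ U.card := by
  classical
  have hlam := hA.lam_pos
  obtain ⟨A₀, hA₀⟩ := exists_pow_lt_of_lt_one (show (0 : ℝ) < 1 / 2 by norm_num) hA.lt_one
  have hA1 : 1 ≤ A₀ := by
    rcases Nat.eq_zero_or_pos A₀ with rfl | h
    · norm_num at hA₀
    · exact h
  refine ⟨A₀, hA1, fun ε hε t₀ => ?_⟩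
  set r : ℝ := 2 ^ (-(ε / 2)) with hr
  have hr0 : 0 < r := by positivity
  have hr1 : r < 1 := Real.rpow_lt_one_of_one_lt_of_neg (by norm_num) (by linarith)
  have hr2 : r ^ 2 < 1 := pow_lt_one₀ hr0.le hr1 (by norm_num)
  have hm : Tendsto (fun m : ℕ => A₀ * m) atTop atTop := tendsto_id.const_mul_atTop' (by omega)
  obtain ⟨m, hm0, hP, hrm⟩ := ((eventually_ge_atTop (t₀ + 1)).and
    ((hm.eventually (hA.psum_bounds hs (η := ε / 2 / A₀) (by positivity))).and
    ((tendsto_pow_atTop_nhds_zero_of_lt_one hr0.le hr1).eventually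
      (gt_mem_nhds (show 0 < 1 - r ^ 2 by linarith))))).exists
  set n := A₀ * m with hn
  choose c hc1 hc2 using fun u : Fin n → Λ => exists_nat_half_pow
    (hA.supDerivNorm_pos (List.ofFn u))
    ((hA.supDerivNorm_le_pow _).trans (pow_le_one₀ hlam.le hA.lt_one.le))
  have hcm : ∀ u, m ≤ c u := fun u => by
    by_contra! h
    have h1 := (hc1 u).trans (hA.supDerivNorm_le_pow _)
    rw [List.length_ofFn, hn, pow_mul] at h1
    have h2 : (lam ^ A₀) ^ m < (1 / 2) ^ m := pow_lt_pow_left₀ hA₀ (by positivity) (by omega)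
    have h3 : (1 / 2 : ℝ) ^ m ≤ (1 / 2) ^ (c u + 1) :=
      pow_le_pow_of_le_one (by norm_num) (by norm_num) h
    linarith
  obtain ⟨M, hM⟩ := (Set.finite_range c).bddAbove
  by_contra! hcon
  have hfib : ∀ t ∈ Finset.Ico m (M + 1),
      ∑ u ∈ Finset.univ.filter (fun u => c u = t), supDerivNorm φ (List.ofFn u) ^ s ≤
        (r ^ 2) ^ t := by
    intro t ht
    rw [Finset.mem_Ico] at ht
    set U := (Finset.univ.filter (fun u => c u = t)).image (fun u : Fin n → Λ => List.ofFn u)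
      with hU
    have h1 := hcon t (by omega) n (by rw [hn]; exact Nat.mul_pos hA1 (by omega))
      (by rw [hn]; exact Nat.mul_le_mul_left _ (by omega)) U (fun u hu => by
        obtain ⟨u', hu', rfl⟩ := Finset.mem_image.1 hu
        obtain rfl := (Finset.mem_filter.1 hu').2
        exact ⟨List.length_ofFn, hc1 u', hc2 u'⟩)
    rw [hU, Finset.card_image_of_injective _ List.ofFn_injective] at h1
    have h2 : ∀ u ∈ Finset.univ.filter (fun u => c u = t), supDerivNorm φ (List.ofFn u) ^ s ≤
        ((1 / 2 : ℝ) ^ t) ^ s := fun u hu => by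
      obtain rfl := (Finset.mem_filter.1 hu).2
      exact Real.rpow_le_rpow (hA.supDerivNorm_pos _).le (hc2 u) hs0
    refine (Finset.sum_le_sum h2).trans ?_
    rw [Finset.sum_const, nsmul_eq_mul]
    refine (mul_le_mul_of_nonneg_right h1.le (by positivity)).trans (le_of_eq ?_)
    rw [one_div, inv_pow, Real.inv_rpow (by positivity), ← Real.rpow_natCast 2 t,
      ← Real.rpow_mul (by norm_num), ← Real.rpow_neg (by norm_num), ← Real.rpow_add (by norm_num),
      ← pow_mul, hr, ← Real.rpow_mul_natCast (by norm_num)]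
    congr 1
    push_cast
    ring
  have hsum : psum φ s n ≤ (r ^ 2) ^ m / (1 - r ^ 2) := by
    rw [psum, ← Finset.sum_fiberwise_of_maps_to (s := Finset.univ) (t := Finset.Ico m (M + 1))
      (g := c) fun u _ => Finset.mem_Ico.2 ⟨hcm u, Nat.lt_succ_of_le (hM ⟨u, rfl⟩)⟩]
    exact (Finset.sum_le_sum hfib).trans (geom_sum_Ico_le_of_lt_one (by positivity) hr2)
  have hlow := hP.1.trans hsum
  have hA0 : (A₀ : ℝ) ≠ 0 := by positivity
  have e : (2 : ℝ) ^ (-(ε / 2 / A₀ * ((A₀ * m : ℕ) : ℝ))) = r ^ m := by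
    rw [hr, ← Real.rpow_mul_natCast (by norm_num)]
    congr 1
    push_cast
    field_simp
  rw [e, le_div_iff₀ (by linarith), ← pow_mul, mul_comm 2, pow_mul, sq (r ^ m)] at hlow
  have := le_of_mul_le_mul_left hlow (by positivity)
  linarith

end Classes

section Assembly

variable {Λ : Type} {φ : Λ → ℝ → ℝ} {b lam K : ℝ}

lemma AnSys.exists_disjoint_words (hA : AnSys φ b lam K) [Nonempty Λ]
    (hno : ¬ ∃ x ∈ unitI, ∀ i, φ i x = x) : ∃ k, ∃ v w : List Λ, v.length = k ∧ w.length = k ∧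
      ∃ δ, 0 < δ ∧ ∀ x ∈ unitI, ∀ y ∈ unitI, δ ≤ |compWord φ v x - compWord φ w y| := by
  have hfix : ∀ i, ∃ x ∈ unitI, φ i x = x := fun i =>
    exists_mem_Icc_isFixedPt_of_mapsTo (hA.an i).continuousOn zero_le_one (hA.maps i)
  choose z hz hfz using hfix
  obtain ⟨i, j, hij⟩ : ∃ i j, z i ≠ z j := by
    by_contra! h
    exact hno ⟨z (Classical.arbitrary Λ), hz _, fun i => by rw [h _ i, hfz]⟩
  have hd : 0 < |z i - z j| := abs_pos.2 (sub_ne_zero.2 hij)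
  have hrep : ∀ (k : ℕ) (l : Λ), compWord φ (List.replicate k l) (z l) = z l := fun k l => by
    induction k with
    | zero => rfl
    | succ k ih => rw [List.replicate_succ]; exact (congrArg (φ l) ih).trans (hfz l)
  obtain ⟨k, hk⟩ := exists_pow_lt_of_lt_one (show 0 < |z i - z j| / 4 by positivity) hA.lt_one
  have hclose : ∀ l, ∀ x ∈ unitI, |compWord φ (List.replicate k l) x - z l| ≤ |z i - z j| / 4 := by
    intro l x hx
    have h := abs_compWord_sub_le hA.an hA.maps hA.hi hA.lam_pos.le (List.replicate k l) hx (hz l)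
    rw [hrep, List.length_replicate] at h
    refine h.trans ((mul_le_of_le_one_right (pow_nonneg hA.lam_pos.le _) ?_).trans hk.le)
    exact abs_sub_le_one_of_mem hx (hz l)
  refine ⟨k, List.replicate k i, List.replicate k j, List.length_replicate,
    List.length_replicate, |z i - z j| / 2, by positivity, fun x hx y hy => ?_⟩
  have h1 := hclose i x hx
  have h2 := hclose j y hy
  rw [abs_sub_comm] at h1
  have h3 := _root_.abs_sub_le (z i) (compWord φ (List.replicate k i) x) (z j)
  have h4 := _root_.abs_sub_le (compWord φ (List.replicate k i) x)
    (compWord φ (List.replicate k j) y) (z j)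
  linarith

lemma flatMap_injective_of_length {W : Type} {wd : W → List Λ} (hwd : Function.Injective wd)
    {l : ℕ} (hl : ∀ a, (wd a).length = l) {u v : List W} (h : u.length = v.length)
    (huv : u.flatMap wd = v.flatMap wd) : u = v := by
  induction u generalizing v with
  | nil => exact (List.length_eq_zero_iff.1 h.symm).symm
  | cons a u ih =>
    cases v with
    | nil => simp at h
    | cons a' v =>
      rw [List.flatMap_cons, List.flatMap_cons] at huv
      obtain ⟨h1, h2⟩ := List.append_inj huv (by rw [hl, hl])
      rw [hwd h1, ih (by simpa using h) h2]

lemma length_flatMap_of_length {W : Type} {wd : W → List Λ} {l : ℕ}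
    (hl : ∀ a, (wd a).length = l) (u : List W) : (u.flatMap wd).length = l * u.length := by
  induction u with
  | nil => simp
  | cons a u ih => rw [List.flatMap_cons, List.length_append, ih, hl, List.length_cons]; ring

/-- Exponential separation passes to systems of words of equal length. -/
lemma AnSys.exists_separation_rate (hA : AnSys φ b lam K) [Nonempty Λ] (hsep : ExpSep φ) :
    ∃ r : ℕ, ∀ {W : Type} [Fintype W] (wd : W → List Λ), Function.Injective wd → ∀ l, 0 < l →
      (∀ a, (wd a).length = l) → ∀ m > 0, ∀ N, ∃ n ≥ N, m ∣ n ∧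
        ∀ u ∈ words W n, ∀ u' ∈ words W n, u ≠ u' → ∀ w ∈ words W n, ∃ z ∈ unitI,
          (1 / 2) ^ (r * l * n) ≤ |compWord (fun a => compWord φ (wd a)) u
            (compWord (fun a => compWord φ (wd a)) w z) -
            compWord (fun a => compWord φ (wd a)) u'
            (compWord (fun a => compWord φ (wd a)) w z)| := by
  obtain ⟨c, hc, h⟩ := hsep
  obtain ⟨r, hr⟩ := exists_pow_lt_of_lt_one hc (show (1 / 2 : ℝ) < 1 by norm_num)
  refine ⟨4 * r, fun {W} _ wd hwd l hl hlen m hm N => ?_⟩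
  obtain ⟨M, hM, hsM⟩ := h (2 * l * m * (N + 1))
  set q := M / (2 * l * m) with hq
  have hpos : 0 < 2 * l * m := by positivity
  have hq1 : N + 1 ≤ q := (Nat.le_div_iff_mul_le hpos).2 (by rw [mul_comm]; exact hM)
  have hq2 : 2 * l * m * q ≤ M := Nat.mul_div_le M _
  have hq3 : M < 2 * l * m * (q + 1) := Nat.lt_mul_div_succ M hpos
  refine ⟨m * q, le_trans (by omega : N ≤ q) (Nat.le_mul_of_pos_left q hm), dvd_mul_right _ _,
    fun u hu u' hu' huu w hw => ?_⟩
  rw [mem_words] at hu hu' hw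
  set e := List.replicate (M - 2 * l * m * q) (Classical.arbitrary Λ)
  have hlenw : ∀ v : List W, v.length = m * q → (e ++ (v ++ w).flatMap wd).length = M :=
    fun v hv => by
      rw [List.length_append, List.length_replicate, length_flatMap_of_length hlen,
        List.length_append, hv, hw]
      have : l * (m * q + m * q) = 2 * l * m * q := by ring
      omega
  obtain ⟨z, hz, hzM⟩ := hsM _ _ (hlenw u hu) (hlenw u' hu') fun heq => huu <| by
    have h1 := flatMap_injective_of_length hwd hlen (by simp [hu, hu'])
      (List.append_cancel_left heq)
    exact List.append_cancel_right h1
  refine ⟨z, hz, ?_⟩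
  simp only [compWord_flatMap]
  rw [compWord_append, compWord_append, List.flatMap_append, List.flatMap_append,
    compWord_append, compWord_append] at hzM
  have hw' := hA.mapsTo (w.flatMap wd) hz
  have h1 := abs_compWord_sub_le hA.an hA.maps hA.hi hA.lam_pos.le e
    (hA.mapsTo (u.flatMap wd) hw') (hA.mapsTo (u'.flatMap wd) hw')
  have h2 := mul_le_of_le_one_left
    (abs_nonneg (compWord φ (u.flatMap wd) (compWord φ (w.flatMap wd) z) -
      compWord φ (u'.flatMap wd) (compWord φ (w.flatMap wd) z)))
    (pow_le_one₀ (n := e.length) hA.lam_pos.le hA.lt_one.le)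
  refine le_trans ?_ (hzM.trans (h1.trans h2))
  calc (1 / 2 : ℝ) ^ (4 * r * l * (m * q)) ≤ (1 / 2) ^ (r * M) := by
        refine pow_le_pow_of_le_one (by norm_num) (by norm_num) ?_
        have : 2 * l * m * (q + 1) ≤ 4 * l * m * q := by
          have : 2 * l * m * 1 ≤ 2 * l * m * q := Nat.mul_le_mul_left _ (by omega)
          linarith
        calc r * M ≤ r * (4 * l * m * q) := Nat.mul_le_mul_left _ (by omega)
          _ = _ := by ring
    _ ≤ c ^ M := by rw [pow_mul]; exact pow_le_pow_left₀ (by positivity) hr.le _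

end Assembly

section Lower

variable {Λ : Type} {φ : Λ → ℝ → ℝ} {b lam K s : ℝ}

/-- The words `u v` and `u w`, for `u` in `U`. -/
def branch (U : Finset (List Λ)) (v w : List Λ) (a : U × Bool) : List Λ :=
  a.1 ++ bif a.2 then v else w

lemma branch_injective {U : Finset (List Λ)} {v w : List Λ} {n : ℕ} (hU : ∀ u ∈ U, u.length = n)
    (hvw : v ≠ w) : Function.Injective (branch U v w) := by
  rintro ⟨⟨u, hu⟩, c⟩ ⟨⟨u', hu'⟩, c'⟩ h
  obtain ⟨h1, h2⟩ := List.append_inj h (by simp [hU u hu, hU u' hu'])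
  obtain rfl : u = u' := h1
  cases c <;> cases c' <;> simp_all [hvw.symm]

lemma length_branch {U : Finset (List Λ)} {v w : List Λ} {n k : ℕ} (hU : ∀ u ∈ U, u.length = n)
    (hv : v.length = k) (hw : w.length = k) (a : U × Bool) :
    (branch U v w a).length = n + k := by
  obtain ⟨⟨u, hu⟩, c⟩ := a
  cases c <;> simp [branch, hU u hu, hv, hw]

lemma AnSys.abs_deriv_branch_le [Nonempty Λ] (hA : AnSys φ b lam K)
    {U : Finset (List Λ)} {v w : List Λ} {t : ℕ}
    (hU : ∀ u ∈ U, supDerivNorm φ u ≤ (1 / 2) ^ t) (a : U × Bool) {x : ℝ} (hx : x ∈ unitI) :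
    |deriv (compWord φ (branch U v w a)) x| ≤ (1 / 2) ^ t := by
  obtain ⟨⟨u, hu⟩, c⟩ := a
  simp only [branch]
  set e := bif c then v else w
  rw [deriv_compWord_append hA.an hA.maps _ _ hx, abs_mul]
  refine (mul_le_of_le_one_right (abs_nonneg _) ((hA.abs_deriv_le_pow e hx).trans
    (pow_le_one₀ hA.lam_pos.le hA.lt_one.le))).trans ?_
  exact (hA.abs_deriv_le_supDerivNorm u (hA.mapsTo e hx)).trans (hU u hu)

lemma AnSys.le_abs_deriv_branch (hA : AnSys φ b lam K) {U : Finset (List Λ)} {v w : List Λ}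
    {t k C : ℕ} (hU : ∀ u ∈ U, (1 / 2) ^ (t + 1) ≤ supDerivNorm φ u) (hv : v.length = k)
    (hw : w.length = k) (hC : (1 / 2) ^ C ≤ b ^ k / (2 * (1 + K))) (a : U × Bool) {x : ℝ}
    (hx : x ∈ unitI) : (1 / 2) ^ (t + C) ≤ |deriv (compWord φ (branch U v w a)) x| := by
  obtain ⟨⟨u, hu⟩, c⟩ := a
  simp only [branch]
  have he : (bif c then v else w).length = k := by cases c <;> simp [hv, hw]
  set e := bif c then v else w
  have hK := hA.nonneg
  rw [deriv_compWord_append hA.an hA.maps _ _ hx, abs_mul]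
  have h1 := hA.pow_le_abs_deriv e hx
  rw [he] at h1
  have h2 : (1 / 2) ^ (t + 1) / (1 + K) ≤ |deriv (compWord φ u) (compWord φ e x)| := by
    rw [div_le_iff₀' (by linarith)]
    exact (hU u hu).trans (hA.supDerivNorm_le u (hA.mapsTo e hx))
  calc (1 / 2 : ℝ) ^ (t + C) ≤ (1 / 2) ^ t * (b ^ k / (2 * (1 + K))) := by
        rw [pow_add]; exact mul_le_mul_of_nonneg_left hC (by positivity)
    _ = (1 / 2) ^ (t + 1) / (1 + K) * b ^ k := by
        rw [pow_succ]; field_simp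
    _ ≤ _ := mul_le_mul h2 h1 (pow_nonneg hA.pos.le _) (abs_nonneg _)

lemma AnSys.mapsTo_attractor {A : Set ℝ} (hAinv : A = ⋃ i, φ i '' A) (u : List Λ) :
    MapsTo (compWord φ u) A A := by
  induction u with
  | nil => exact mapsTo_id A
  | cons i u ih =>
    intro x hx
    rw [hAinv]
    exact mem_iUnion.2 ⟨i, mem_image_of_mem _ (ih hx)⟩

variable [Fintype Λ] [Nonempty Λ]

theorem AnSys.le_dimH_of_pos (hA : AnSys φ b lam K) (hno : ¬ ∃ x ∈ unitI, ∀ i, φ i x = x)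
    (hsep : ExpSep φ) (hs0 : 0 ≤ s)
    (hs : Tendsto (fun n : ℕ => (1 / (n : ℝ)) * Real.logb 2 (psum φ s n)) atTop (𝓝 0))
    {A : Set ℝ} (hAne : A.Nonempty) (hAc : IsCompact A) (hAI : A ⊆ unitI)
    (hAinv : A = ⋃ i, φ i '' A) {ε : ℝ} (hε : 0 < ε) (hε1 : ε < 1) :
    ENNReal.ofReal ((min 1 s - 2 * ε) * (1 - ε)) ≤ dimH A := by
  classical
  have hK := hA.nonneg
  obtain ⟨k, v, w, hv, hw, δ, hδ, hvw⟩ := hA.exists_disjoint_words hno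
  have hvw' : v ≠ w := by
    rintro rfl
    have := hvw 0 zero_mem_unitI 0 zero_mem_unitI
    simp at this
    linarith
  obtain ⟨r, hr⟩ := hA.exists_separation_rate hsep
  obtain ⟨A₀, hA₀, hcl⟩ := hA.exists_class hs0 hs
  obtain ⟨C, hC⟩ := exists_pow_lt_of_lt_one
    (show 0 < b ^ k / (2 * (1 + K)) by have := hA.pos; positivity) (show (1 / 2 : ℝ) < 1 by norm_num)
  set q := r * (2 * A₀ + 1) with hq
  set τ := C * (q + 4) + 1 with hτ
  obtain ⟨t₁, ht₁⟩ := exists_nat_ge ((C + 6 * τ) / ε)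
  obtain ⟨t, ht, n, hn1, hn, U, hU, hcard⟩ := hcl ε hε (t₁ + 2 * τ + C + k + 1)
  have hUl : ∀ u ∈ U, u.length = n := fun u hu => (hU u hu).1
  have hUne : U.Nonempty := by
    rw [← Finset.card_pos]
    exact_mod_cast (Real.rpow_pos_of_pos (by norm_num : (0 : ℝ) < 2) _).trans_le hcard
  obtain ⟨u₀, hu₀⟩ := hUne
  have : Nonempty (U × Bool) := ⟨(⟨u₀, hu₀⟩, true)⟩
  have hhi := fun a x (hx : x ∈ unitI) =>
    hA.abs_deriv_branch_le (v := v) (w := w) (fun u hu => (hU u hu).2.2) a hx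
  have hlo := fun a x (hx : x ∈ unitI) =>
    hA.le_abs_deriv_branch (fun u hu => (hU u hu).2.1) hv hw hC.le a hx
  have hS := hA.confSys (by omega) hlo hhi
  have hd := hA.smoothSys hlo hhi
  obtain ⟨α, hα0, hα1, hα, hup⟩ := hS.exists_entropy_rate zero_mem_unitI
  have htR : (t₁ + 2 * τ + C + k + 1 : ℝ) ≤ t := by exact_mod_cast ht
  have hτ0 : (0 : ℝ) ≤ τ := Nat.cast_nonneg _
  have hC0 : (0 : ℝ) ≤ C := Nat.cast_nonneg _
  have hk0 : (0 : ℝ) ≤ k := Nat.cast_nonneg _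
  have ht0 : (0 : ℝ) < t := by have : (0 : ℝ) ≤ t₁ := Nat.cast_nonneg _; linarith
  have hsmall : C + 6 * τ ≤ ε * t := by
    rw [div_le_iff₀' hε] at ht₁
    exact ht₁.trans (mul_le_mul_of_nonneg_left (by linarith) hε.le)
  have hαlow : min 1 s - 2 * ε ≤ α := by
    rcases hα1.eq_or_lt with rfl | hα1
    · have := min_le_left 1 s
      linarith
    set d₀ := |deriv (compWord φ u₀) 0| * δ / (1 + K) with hd₀
    have hd₀p : 0 < d₀ := by
      have := hA.abs_deriv_pos u₀ zero_mem_unitI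
      positivity
    obtain ⟨y, hy, Ch, hint⟩ := hA.exists_hint hlo hhi (α := (⟨u₀, hu₀⟩, true))
      (β := (⟨u₀, hu₀⟩, false)) hd₀p (fun x hx y hy => by
        simp only [branch, cond_true, cond_false, compWord_append]
        rw [hd₀, div_le_iff₀' (by linarith)]
        exact (mul_le_mul_of_nonneg_left (hvw x hx y hy) (abs_nonneg _)).trans
          (hA.le_abs_sub u₀ (hA.mapsTo v hx) (hA.mapsTo w hy) zero_mem_unitI)) q
    have hnk : n + k ≤ (2 * A₀ + 1) * t := by
      have h1 : A₀ * (t + 1) ≤ A₀ * (t + t) := Nat.mul_le_mul_left _ (by omega)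
      have : (2 * A₀ + 1) * t = A₀ * (t + t) + t := by ring
      omega
    have hqs : r * (n + k) ≤ q * t := by
      rw [hq, mul_assoc]
      exact Nat.mul_le_mul_left _ hnk
    set Q := r * (n + k) / τ + 1 with hQ
    have hQ1 : r * (n + k) + 1 ≤ Q * τ := by
      rw [hQ, mul_comm _ τ]
      exact Nat.lt_mul_div_succ _ (by omega)
    have hQ2 : Q * τ ≤ r * (n + k) + τ := by
      rw [hQ, add_mul, one_mul]
      exact Nat.add_le_add_right (Nat.div_mul_le_self _ _) _
    have hlt := card_lt_of_rate_lt_one hS hd zero_mem_unitI hα1 hα hup (τ := τ)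
      (qs := r * (n + k)) (p := q + 1) (Q := Q) (k := q) (by omega) (by omega) (by omega)
      (by omega) (by omega) (Nat.succ_pos _) (by rw [mul_comm t, add_mul]; omega)
      (by omega) (by
        have e1 : t + C - t = C := by omega
        have e2 : τ - 1 = C * (q + 4) := by omega
        rw [e1, e2, mul_assoc]
        refine Nat.mul_le_mul_left _ ?_
        have : (q + 4) * (t + C) = q * t + q * C + 4 * t + 4 * C := by ring
        omega) y hy Ch hint
      (hr (branch U v w) (branch_injective hUl hvw') (n + k) (by omega) (length_branch hUl hv hw))
    have hcd : (s - ε) * t ≤ Real.logb 2 (Fintype.card (U × Bool)) := by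
      rw [Real.le_logb_iff_rpow_le (by norm_num) (by exact_mod_cast Fintype.card_pos)]
      refine hcard.trans ?_
      rw [Fintype.card_prod, Fintype.card_coe, Fintype.card_bool]
      exact_mod_cast Nat.le_mul_of_pos_right _ two_pos
    push_cast at hlt
    have h1 : (s - 2 * ε) * t ≤ α * t := by linarith
    have := min_le_right 1 s
    linarith [le_of_mul_le_mul_right h1 ht0]
  refine (ENNReal.ofReal_le_ofReal ?_).trans (hS.le_dimH (by omega) zero_mem_unitI hα hAc hAne hAI
    fun a => AnSys.mapsTo_attractor hAinv _)
  have hT0 : (0 : ℝ) < ((t + C : ℕ) : ℝ) := by push_cast; linarith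
  rw [le_div_iff₀ hT0]
  push_cast
  have h1 : (1 - ε) * (t + C) ≤ t := by
    have : 0 ≤ ε * C := by positivity
    linarith
  calc (min 1 s - 2 * ε) * (1 - ε) * (t + C) = (min 1 s - 2 * ε) * ((1 - ε) * (t + C)) := by ring
    _ ≤ α * ((1 - ε) * (t + C)) := mul_le_mul_of_nonneg_right hαlow
        (mul_nonneg (by linarith) (by linarith))
    _ ≤ α * t := mul_le_mul_of_nonneg_left h1 hα0

theorem AnSys.le_dimH (hA : AnSys φ b lam K) (hno : ¬ ∃ x ∈ unitI, ∀ i, φ i x = x)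
    (hsep : ExpSep φ) (hs0 : 0 ≤ s)
    (hs : Tendsto (fun n : ℕ => (1 / (n : ℝ)) * Real.logb 2 (psum φ s n)) atTop (𝓝 0))
    {A : Set ℝ} (hAne : A.Nonempty) (hAc : IsCompact A) (hAI : A ⊆ unitI)
    (hAinv : A = ⋃ i, φ i '' A) : ENNReal.ofReal (min 1 s) ≤ dimH A := by
  have hlim : Tendsto (fun ε : ℝ => ENNReal.ofReal ((min 1 s - 2 * ε) * (1 - ε))) (𝓝[>] 0)
      (𝓝 (ENNReal.ofReal (min 1 s))) := by
    have hc : Continuous fun ε : ℝ => (min 1 s - 2 * ε) * (1 - ε) := by fun_prop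
    have := (ENNReal.continuous_ofReal.comp hc).tendsto 0
    simp only [Function.comp_def, mul_zero, sub_zero, mul_one] at this
    exact this.mono_left nhdsWithin_le_nhds
  refine le_of_tendsto hlim ?_
  filter_upwards [Ioo_mem_nhdsGT (zero_lt_one' ℝ)] with ε hε
  exact hA.le_dimH_of_pos hno hsep hs0 hs hAne hAc hAI hAinv hε.1 hε.2

end Lower

theorem dimension_of_self_conformal_set
    {Λ : Type} [Fintype Λ] [Nonempty Λ]
    (φ : Λ → ℝ → ℝ)
    (hanal : ∀ i, AnalyticOnNhd ℝ (φ i) unitI)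
    (hmaps : ∀ i, Set.MapsTo (φ i) unitI unitI)
    (hderiv : ∀ i, ∀ x ∈ unitI, 0 < |deriv (φ i) x| ∧ |deriv (φ i) x| < 1)
    (hnofix : ¬ ∃ x ∈ unitI, ∀ i, φ i x = x)
    (hsep : ExpSep φ)
    -- `K` is the attractor of `Φ`
    (K : Set ℝ) (hKne : K.Nonempty) (hKcpt : IsCompact K) (hKI : K ⊆ unitI)
    (hKinv : K = ⋃ i, φ i '' K)
    -- `s` is the conformal similarity dimension: the root of the pressure function
    (s : ℝ) (hs0 : 0 ≤ s)
    (hs : Tendsto (fun n : ℕ => (1 / (n : ℝ)) * Real.logb 2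
        (∑ u : Fin n → Λ, (supDerivNorm φ (List.ofFn u)) ^ s)) atTop (nhds 0)) :
    dimH K = ENNReal.ofReal (min 1 s) := by
  obtain ⟨b, lam, D, hA⟩ := exists_anSys hanal hmaps hderiv
  refine le_antisymm ?_ (hA.le_dimH hnofix hsep hs0 hs hKne hKcpt hKI hKinv)
  rw [ENNReal.ofReal_min, ENNReal.ofReal_one]
  refine le_min ?_ (hA.dimH_le hs0 hs hKI hKinv)
  exact (dimH_mono (subset_univ K)).trans_eq Real.dimH_univ
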